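/- arXiv:1211.3106 — 4 statements merged into one kernel-verified Lean document; each statement's English description precedes it below -/
import Mathlib

section
/- There is a constant C > 0 such that for every finite simple graph G on n ≥ 3 vertices, p_0(G) + p_3(G) ≥ 1/4 − C/n. -/
open Finset

open scoped Classical

/-- The induced density `d(H;G)`: the probability that a uniformly random
`|V(H)|`-element subset of `V(G)` induces a subgraph isomorphic to `H`. -/
noncomputable def inducedDensity {W V : Type*} [Fintype W] [Fintype V] [DecidableEq V]
    (H : SimpleGraph W) (G : SimpleGraph V) : ℝ :=
  (((univ : Finset V).powersetCard (Fintype.card W)).filter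
      (fun S => Nonempty (H ≃g G.induce (S : Set V)))).card /
    ((univ : Finset V).powersetCard (Fintype.card W)).card

/-- The number of edges of `G` spanned by the vertex set `S`. -/
noncomputable def edgesIn {V : Type*} [Fintype V] [DecidableEq V]
    (G : SimpleGraph V) (S : Finset V) : ℕ :=
  ((S.powersetCard 2).filter (fun T => ∀ x ∈ T, ∀ y ∈ T, x ≠ y → G.Adj x y)).card

/-- `localProfile G i = p_i(G)`: the probability that a uniformly random 3-element
subset of `V(G)` spans exactly `i` edges. -/
noncomputable def localProfile {V : Type*} [Fintype V] [DecidableEq V]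
    (G : SimpleGraph V) (i : ℕ) : ℝ :=
  (((univ : Finset V).powersetCard 3).filter (fun S => edgesIn G S = i)).card /
    ((univ : Finset V).powersetCard 3).card

lemma edgesIn_none {V : Type*} [Fintype V] [DecidableEq V] (G : SimpleGraph V) (S : Finset V)
    (h : ∀ x ∈ S, ∀ y ∈ S, ¬ G.Adj x y) : edgesIn G S = 0 := by
  unfold edgesIn
  rw [Finset.card_eq_zero, Finset.filter_eq_empty_iff]
  intro T hT hall
  rw [Finset.mem_powersetCard] at hT
  obtain ⟨u, v, huv, rfl⟩ := Finset.card_eq_two.mp hT.2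
  exact h u (hT.1 (by simp)) v (hT.1 (by simp)) (hall u (by simp) v (by simp) huv)

lemma edgesIn_all {V : Type*} [Fintype V] [DecidableEq V] (G : SimpleGraph V) (S : Finset V)
    (hS : S.card = 3)
    (h : ∀ x ∈ S, ∀ y ∈ S, x ≠ y → G.Adj x y) : edgesIn G S = 3 := by
  unfold edgesIn
  rw [Finset.filter_true_of_mem, Finset.card_powersetCard, hS]
  · rfl
  · intro T hT x hx y hy hxy
    rw [Finset.mem_powersetCard] at hT
    exact h x (hT.1 hx) y (hT.1 hy) hxy

/-- Sign of a pair: `1` for adjacent, `-1` otherwise. -/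
noncomputable def gsgn {V : Type*} (G : SimpleGraph V) (x y : V) : ℝ := if G.Adj x y then 1 else -1

lemma gsgn_comm {V : Type*} (G : SimpleGraph V) (x y : V) : gsgn G x y = gsgn G y x := by
  unfold gsgn; simp only [G.adj_comm]

/-- The family of monochromatic triples. -/
noncomputable def monoSets {n : ℕ} (G : SimpleGraph (Fin n)) : Finset (Finset (Fin n)) :=
  ((univ : Finset (Fin n)).powersetCard 3).filter (fun S => edgesIn G S = 0 ∨ edgesIn G S = 3)

/-- Ordered triples whose vertex set is a monochromatic triple. -/
noncomputable def monoTriples {n : ℕ} (G : SimpleGraph (Fin n)) :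
    Finset (Fin n × Fin n × Fin n) :=
  univ.filter (fun p => ({p.1, p.2.1, p.2.2} : Finset (Fin n)) ∈ monoSets G)

lemma card_monoTriples_le {n : ℕ} (G : SimpleGraph (Fin n)) :
    (monoTriples G).card ≤ 6 * (monoSets G).card := by
  apply Finset.card_le_mul_card_image_of_maps_to
    (f := fun p => ({p.1, p.2.1, p.2.2} : Finset (Fin n)))
  · intro p hp
    simpa [monoTriples] using hp
  · intro S hS
    have h3 : S.card = 3 := by
      unfold monoSets at hS
      rw [Finset.mem_filter, Finset.mem_powersetCard] at hS
      exact hS.1.2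
    obtain ⟨a, b, c, hab, hac, hbc, rfl⟩ := Finset.card_eq_three.mp h3
    refine le_trans (Finset.card_le_card (t := {(a, b, c), (a, c, b), (b, a, c), (b, c, a),
      (c, a, b), (c, b, a)}) ?_) Finset.card_le_six
    rintro ⟨x, y, z⟩ hp
    have hp := (Finset.mem_filter.mp hp).2
    simp only at hp
    have ha : a ∈ ({x, y, z} : Finset (Fin n)) := by rw [hp]; simp
    have hb : b ∈ ({x, y, z} : Finset (Fin n)) := by rw [hp]; simp
    have hc : c ∈ ({x, y, z} : Finset (Fin n)) := by rw [hp]; simp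
    simp only [Finset.mem_insert, Finset.mem_singleton, Prod.mk.injEq] at ha hb hc ⊢
    grind

lemma pointwise {n : ℕ} (G : SimpleGraph (Fin n)) (x y z : Fin n) :
    1 + gsgn G x y * gsgn G x z + gsgn G y x * gsgn G y z + gsgn G z x * gsgn G z y
      - 4 * ((if x = y then 1 else 0) + (if y = z then 1 else 0) + (if x = z then 1 else 0))
      ≤ 4 * (if (x, y, z) ∈ monoTriples G then (1 : ℝ) else 0) := by
  by_cases hd : x ≠ y ∧ y ≠ z ∧ x ≠ z
  · obtain ⟨h1, h2, h3⟩ := hd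
    have hS : ({x, y, z} : Finset (Fin n)).card = 3 := Finset.card_eq_three.mpr
      ⟨x, y, z, h1, h3, h2, rfl⟩
    have e1 := G.adj_comm x y
    have e2 := G.adj_comm y z
    have e3 := G.adj_comm x z
    have m1 : (G.Adj x y ∧ G.Adj y z ∧ G.Adj x z) → (x, y, z) ∈ monoTriples G := by
      rintro ⟨a1, a2, a3⟩
      have := edgesIn_all G {x, y, z} hS (by
        simp only [Finset.mem_insert, Finset.mem_singleton]; grind)
      simp [monoTriples, monoSets, Finset.mem_powersetCard, hS, this]
    have m2 : (¬ G.Adj x y ∧ ¬ G.Adj y z ∧ ¬ G.Adj x z) → (x, y, z) ∈ monoTriples G := by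
      rintro ⟨a1, a2, a3⟩
      have i1 := G.loopless.irrefl x
      have i2 := G.loopless.irrefl y
      have i3 := G.loopless.irrefl z
      have := edgesIn_none G {x, y, z} (by
        simp only [Finset.mem_insert, Finset.mem_singleton]; grind)
      simp [monoTriples, monoSets, Finset.mem_powersetCard, hS, this]
    rw [gsgn_comm G y x, gsgn_comm G z x, gsgn_comm G z y]
    simp only [h1, h2, h3, if_false]
    unfold gsgn
    by_cases a1 : G.Adj x y <;> by_cases a2 : G.Adj y z <;> by_cases a3 : G.Adj x z <;>
      simp only [a1, a2, a3, if_true, if_false] <;>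
      first
      | (rw [if_pos (m1 ⟨a1, a2, a3⟩)]; norm_num)
      | (rw [if_pos (m2 ⟨a1, a2, a3⟩)]; norm_num)
      | (split_ifs <;> norm_num)
  · have hb : ∀ u v w : Fin n, gsgn G u v * gsgn G u w ≤ 1 := by
      intro u v w; unfold gsgn; split_ifs <;> norm_num
    have b1 := hb x y z
    have b2 := hb y x z
    have b3 := hb z x y
    have hr : (0 : ℝ) ≤ 4 * (if (x, y, z) ∈ monoTriples G then (1 : ℝ) else 0) := by
      split_ifs <;> norm_num
    have hl : (1 : ℝ) ≤ (if x = y then 1 else 0) + (if y = z then 1 else 0)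
        + (if x = z then 1 else 0) := by
      split_ifs <;> first | (exfalso; tauto) | norm_num
    linarith

lemma key {n : ℕ} (G : SimpleGraph (Fin n)) :
    (n : ℝ) ^ 3 - 12 * (n : ℝ) ^ 2 ≤ 24 * ((monoSets G).card : ℝ) := by
  have h1 : ((monoTriples G).card : ℝ) ≤ 6 * (monoSets G).card := by
    exact_mod_cast card_monoTriples_le G
  have h2 : ((monoTriples G).card : ℝ) =
      ∑ x, ∑ y, ∑ z, (if (x, y, z) ∈ monoTriples G then (1 : ℝ) else 0) := by
    have : ((monoTriples G).card : ℝ) =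
        ∑ p : Fin n × Fin n × Fin n, (if p ∈ monoTriples G then (1 : ℝ) else 0) := by
      simp
    rw [this, Fintype.sum_prod_type]
    exact Finset.sum_congr rfl fun x _ => Fintype.sum_prod_type _
  have h3 := Finset.sum_le_sum fun x (_ : x ∈ univ) => Finset.sum_le_sum fun y (_ : y ∈ univ) =>
    Finset.sum_le_sum fun z (_ : z ∈ univ) => pointwise G x y z
  simp only [← Finset.mul_sum] at h3
  rw [← h2] at h3
  have s1 : 0 ≤ ∑ x, ∑ y, ∑ z, gsgn G x y * gsgn G x z := by
    refine Finset.sum_nonneg fun x _ => ?_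
    rw [← Finset.sum_mul_sum]
    exact mul_self_nonneg _
  have s2 : ∑ x, ∑ y, ∑ z, gsgn G y x * gsgn G y z = ∑ x, ∑ y, ∑ z, gsgn G x y * gsgn G x z :=
    Finset.sum_comm
  have s3 : ∑ x, ∑ y, ∑ z, gsgn G z x * gsgn G z y = ∑ x, ∑ y, ∑ z, gsgn G x y * gsgn G x z := by
    rw [← s2]
    exact Finset.sum_congr rfl fun x _ => Finset.sum_comm
  simp only [Finset.sum_sub_distrib, Finset.sum_add_distrib, ← Finset.mul_sum] at h3 s1 s2 s3
  rw [s2, s3] at h3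
  simp only [Finset.sum_ite_eq, Finset.sum_const, Finset.card_univ, Fintype.card_fin,
    Finset.mem_univ, if_true, nsmul_eq_mul, mul_one, ← Finset.mul_sum] at h3
  nlinarith

/-- Goodman's inequality: there is a constant `C > 0` such that every graph on `n ≥ 3`
vertices satisfies `p₀(G) + p₃(G) ≥ 1/4 - C/n`. -/
theorem goodman_inequality :
    ∃ C : ℝ, 0 < C ∧ ∀ n : ℕ, 3 ≤ n → ∀ G : SimpleGraph (Fin n),
      localProfile G 0 + localProfile G 3 ≥ 1 / 4 - C / n := by
  refine ⟨3, by norm_num, fun n hn G => ?_⟩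
  have hk := key G
  have hsum : localProfile G 0 + localProfile G 3 = ((monoSets G).card : ℝ) / (n.choose 3 : ℕ) := by
    unfold localProfile monoSets
    rw [Finset.filter_or, Finset.card_union_of_disjoint, Finset.card_powersetCard]
    · simp [add_div]
    · rw [Finset.disjoint_filter]
      intro S _ h
      omega
  rw [hsum]
  have hc : (6 : ℝ) * (n.choose 3 : ℕ) ≤ (n : ℝ) ^ 3 := by
    have h := Nat.choose_le_pow_div (α := ℝ) 3 n
    have : ((3 : ℕ).factorial : ℝ) = 6 := by norm_num [Nat.factorial]
    rw [this] at h
    linarith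
  have hp : (0 : ℝ) < (n.choose 3 : ℕ) := by exact_mod_cast Nat.choose_pos hn
  have hn0 : (0 : ℝ) < n := by
    have : 0 < n := by omega
    exact_mod_cast this
  have he : (1 : ℝ) / 4 - 3 / n = (n - 12) / (4 * n) := by field_simp; ring
  rw [ge_iff_le, he, div_le_div_iff₀ (by positivity) hp]
  by_cases h12 : (n : ℝ) ≤ 12
  · have : ((n : ℝ) - 12) * (n.choose 3 : ℕ) ≤ 0 :=
      mul_nonpos_of_nonpos_of_nonneg (by linarith) hp.le
    have : (0 : ℝ) ≤ (monoSets G).card * (4 * n) := by positivity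
    linarith
  · have h1 := mul_le_mul_of_nonneg_left hc (by linarith : (0 : ℝ) ≤ n - 12)
    have h2 := mul_le_mul_of_nonneg_left hk hn0.le
    nlinarith
end

section
/- Let r, s ≥ 2 be integers. For every ε > 0 there exists N such that for every finite simple graph G on n ≥ N vertices and every α ∈ [0,1] with d(K̄_r; G) ≥ α, if β is the unique root in [0,1] of β^r + r·β^{r−1}(1−β) = α, then d(K_s; G) ≤ max{(1 − α^{1/r})^s + s·α^{1/r}·(1 − α^{1/r})^{s−1}, (1−β)^s} + ε. -/
open Finset

open scoped Classical

lemma quasi_max {g c D : ℝ → ℝ} {l u : ℝ} (hg : ContinuousOn g (Set.Icc l u))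
    (hd : ∀ t ∈ Set.Ioo l u, HasDerivAt g (c t * D t) t)
    (hc : ∀ t ∈ Set.Ioo l u, 0 ≤ c t) (hD : MonotoneOn D (Set.Ioo l u))
    {t : ℝ} (ht : t ∈ Set.Icc l u) : g t ≤ max (g l) (g u) := by
  rcases eq_or_lt_of_le ht.1 with h1 | h1
  · subst h1; exact le_max_left _ _
  rcases eq_or_lt_of_le ht.2 with h2 | h2
  · subst h2; exact le_max_right _ _
  have htI : t ∈ Set.Ioo l u := ⟨h1, h2⟩
  rcases le_total 0 (D t) with h | h
  · apply le_max_of_le_right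
    have hm : MonotoneOn g (Set.Icc t u) := by
      apply monotoneOn_of_deriv_nonneg (convex_Icc t u)
        (hg.mono (Set.Icc_subset_Icc h1.le le_rfl))
      · intro x hx
        rw [interior_Icc] at hx
        exact (hd x ⟨h1.trans hx.1, hx.2⟩).differentiableAt.differentiableWithinAt
      · intro x hx
        rw [interior_Icc] at hx
        have hxI : x ∈ Set.Ioo l u := ⟨h1.trans hx.1, hx.2⟩
        rw [(hd x hxI).deriv]
        exact mul_nonneg (hc x hxI) (h.trans (hD htI hxI hx.1.le))
    exact hm ⟨le_rfl, h2.le⟩ ⟨h2.le, le_rfl⟩ h2.le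
  · apply le_max_of_le_left
    have hm : AntitoneOn g (Set.Icc l t) := by
      apply antitoneOn_of_deriv_nonpos (convex_Icc l t)
        (hg.mono (Set.Icc_subset_Icc le_rfl h2.le))
      · intro x hx
        rw [interior_Icc] at hx
        exact (hd x ⟨hx.1, hx.2.trans h2⟩).differentiableAt.differentiableWithinAt
      · intro x hx
        rw [interior_Icc] at hx
        have hxI : x ∈ Set.Ioo l u := ⟨hx.1, hx.2.trans h2⟩
        rw [(hd x hxI).deriv]
        exact mul_nonpos_of_nonneg_of_nonpos (hc x hxI) ((hD hxI htI hx.2.le).trans h)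
    exact hm ⟨le_rfl, h1.le⟩ ⟨h1.le, le_rfl⟩ h1.le

/-- the basic algebraic identity behind both derivative computations -/
lemma E_identity (k m : ℕ) {p q : ℝ} (hp : 0 < p) :
    (p + q) ^ (k+1) - p ^ (k+1) - (k+1) * m * q * p ^ k
      = q * p ^ k * ((∑ i ∈ range (k+1), (1 + q / p) ^ i) - (k+1) * m) := by
  have h := mul_geom_sum (1 + q / p) (k+1)
  have e : p * (1 + q / p) = p + q := by field_simp
  have : (p + q)^(k+1) = p^(k+1) * (1 + q/p)^(k+1) := by rw [← mul_pow, e]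
  rw [this]
  have e2 : (1 + q/p)^(k+1) = 1 + (q/p) * ∑ i ∈ range (k+1), (1 + q / p) ^ i := by
    rw [show (1 + q / p - 1) = q/p by ring] at h
    linarith
  rw [e2]
  generalize (∑ i ∈ range (k+1), (1 + q / p) ^ i) = S
  field_simp
  ring

lemma stage1_aux (k m : ℕ) {q b : ℝ} (hq : 0 < q) (hq1 : q ≤ 1) (hb : 0 < b) (hb1 : b ≤ 1) :
    q ≤ (1 - (1-q)^(k+1))^(m+1) ∨
      1 - (1 - q * b^(m+1))^(k+1) ≤ b * (1 - (1-q)^(k+1)) := by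
  set z := b^(m+1) with hz
  have hz0 : 0 < z := by positivity
  have hz1 : z ≤ 1 := pow_le_one₀ hb.le hb1
  have hl0 : 0 < q * z := by positivity
  have hf0 : ∀ t : ℝ, 0 < t → t ≤ 1 → 0 < 1 - (1-t)^(k+1) := by
    intro t h0 h1
    have : (1-t)^(k+1) < 1 := pow_lt_one₀ (by linarith) (by linarith) (by omega)
    linarith
  have key := quasi_max (g := fun t => - ((1 - (1-t)^(k+1))^(m+1) / t))
    (c := fun t => (1 - (1-t)^(k+1))^m / t^2 * (t * (1-t)^k))
    (D := fun t => (∑ i ∈ range (k+1), (1 + t / (1-t)) ^ i) - (k+1) * (m+1 : ℕ))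
    (l := q * z) (u := 1) (t := q) ?_ ?_ ?_ ?_ ⟨by nlinarith, hq1⟩
  · rcases le_max_iff.1 key with h | h
    · right
      have h' : (1 - (1-q*z)^(k+1))^(m+1) / (q*z) ≤ (1 - (1-q)^(k+1))^(m+1) / q := by
        simpa using h
      rw [div_le_div_iff₀ hl0 hq] at h'
      have h2 : (1 - (1-q*z)^(k+1))^(m+1) ≤ (b * (1 - (1-q)^(k+1)))^(m+1) := by
        rw [mul_pow, ← hz]
        nlinarith
      exact le_of_pow_le_pow_left₀ (by omega) (mul_nonneg hb.le (hf0 q hq hq1).le) h2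
    · left
      have h' : 1 ≤ (1 - (1-q)^(k+1))^(m+1) / q := by
        simpa using h
      rwa [le_div_iff₀ hq, one_mul] at h'
  · apply ContinuousOn.neg
    apply ContinuousOn.div
    · fun_prop
    · fun_prop
    · intro x hx; exact (hl0.trans_le hx.1).ne'
  · intro t ht
    have ht0 : 0 < t := hl0.trans ht.1
    have hp : 0 < 1 - t := by linarith [ht.2]
    have hE := E_identity k (m+1) (q := t) hp
    have h1 : HasDerivAt (fun t : ℝ => 1 - (1-t)^(k+1)) ((k+1) * (1-t)^k) t := by
      have := (((hasDerivAt_id t).const_sub 1).pow (k+1)).const_sub 1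
      refine this.congr_deriv ?_
      simp
    have h2 := ((h1.pow (m+1)).div (hasDerivAt_id t) ht0.ne').neg
    refine h2.congr_deriv ?_
    simp only [id, Pi.pow_apply, add_tsub_cancel_right, mul_one]
    have e : (1 - t + t)^(k+1) = 1 := by simp
    rw [e] at hE
    rw [mul_assoc _ (t * (1-t)^k), ← hE]
    push_cast
    field_simp
    ring
  · intro t ht
    have ht0 : 0 < t := hl0.trans ht.1
    have hp : 0 < 1 - t := by linarith [ht.2]
    have := hf0 t ht0 ht.2.le
    positivity
  · intro x hx y hy hxy
    have hx0 : 0 < x := hl0.trans hx.1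
    have hpx : 0 < 1 - x := by linarith [hx.2]
    have hpy : 0 < 1 - y := by linarith [hy.2]
    have hy0 : 0 < y := hl0.trans hy.1
    show _ - _ ≤ _ - _
    gcongr

lemma gr_le_one (m : ℕ) {b : ℝ} (hb : 0 ≤ b) (hb1 : b ≤ 1) :
    b^(m+1+1) + (m+1+1) * b^(m+1) * (1-b) ≤ 1 := by
  induction m with
  | zero => norm_num; nlinarith
  | succ m ih =>
    have : b * (b^(m+1+1) + (m+1+1) * b^(m+1) * (1-b)) ≤ b * 1 := by gcongr
    have h2 : b^(m+1+1) ≤ 1 := pow_le_one₀ hb hb1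
    push_cast
    have e : b ^ (m + 1 + 1 + 1) = b * b^(m+1+1) := by ring
    have h3 : b^(m+1+1) * (1-b) ≤ 1 * (1-b) := by gcongr
    have e2 : b * (b^(m+1+1) + (m+1+1) * b^(m+1) * (1-b)) =
      b * b^(m+1+1) + (m+1+1) * (b^(m+1+1) * (1-b)) := by ring
    rw [e]
    linarith

/-- stage 2 : right-up-right paths -/
lemma stage2 (k m : ℕ) {p b q : ℝ} (hp : 0 ≤ p) (hb : 0 ≤ b) (hq : 0 ≤ q) (h1 : p + b + q = 1) :
    ∃ x y : ℝ, 0 ≤ x ∧ 0 ≤ y ∧ x + y = 1 ∧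
     (((p+q)^(k+1+1) + (k+1+1) * p^(k+1) * b ≤ x^(k+1+1) + (k+1+1) * x^(k+1) * y ∧
        b^(m+1+1) + (m+1+1) * b^(m+1) * q ≤ y^(m+1+1)) ∨
      ((p+q)^(k+1+1) + (k+1+1) * p^(k+1) * b ≤ x^(k+1+1) ∧
        b^(m+1+1) + (m+1+1) * b^(m+1) * q ≤ y^(m+1+1) + (m+1+1) * y^(m+1) * x)) := by
  rcases eq_or_lt_of_le hb with h0 | h0
  · subst h0
    refine ⟨1, 0, by simp, by simp, by simp, Or.inl ⟨?_, by simp⟩⟩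
    have : p + q = 1 := by linarith
    simp [this]
  set α := b^(m+1+1) + (m+1+1) * b^(m+1) * q with hα
  have hα0 : 0 < α := by positivity
  have hb1 : b ≤ 1 := by linarith
  have hαb : α ≤ b^(m+1+1) + (m+1+1) * b^(m+1) * (1-b) := by
    rw [hα]; gcongr; linarith
  have hα1 : α ≤ 1 := hαb.trans (gr_le_one m hb hb1)
  -- β
  obtain ⟨β, hβI, hβ⟩ : ∃ β ∈ Set.Icc 0 b, β^(m+1+1) + (m+1+1) * β^(m+1) * (1-β) = α := by
    have := intermediate_value_Icc (f := fun β : ℝ => β^(m+1+1) + (m+1+1) * β^(m+1) * (1-β)) hb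
      (by fun_prop)
    exact this ⟨by simpa using hα0.le, hαb⟩
  have hβ0 : 0 < β := by
    rcases eq_or_lt_of_le hβI.1 with h | h
    · rw [← h] at hβ; simp at hβ; linarith
    · exact h
  obtain ⟨c, hc0, hc⟩ : ∃ c : ℝ, 0 ≤ c ∧ c^(m+1+1) = α :=
    ⟨α ^ ((1:ℝ)/(m+1+1 : ℕ)), by positivity, by
      rw [one_div]; exact Real.rpow_inv_natCast_pow hα0.le (by omega)⟩
  have hbc : b ≤ c := by
    apply le_of_pow_le_pow_left₀ (n := m+1+1) (by omega) hc0
    rw [hc, hα]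
    have : 0 ≤ (m+1+1) * b^(m+1) * q := by positivity
    linarith
  have hc1 : c ≤ 1 := by
    apply le_of_pow_le_pow_left₀ (n := m+1+1) (by omega) zero_le_one
    rw [hc]; simpa using hα1
  have hcpos : 0 < c := h0.trans_le hbc
  -- the functions
  let Q : ℝ → ℝ := fun t => (α / t^(m+1) - t) / (m+1+1)
  let P : ℝ → ℝ := fun t => 1 - t - Q t
  have hQb : Q b = q := by
    simp only [Q, hα]; field_simp; ring
  have hPb : P b = p := by simp only [P, hQb]; linarith
  have hQc : Q c = 0 := by
    simp only [Q, ← hc]; field_simp; ring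
  have hQβ : Q β = 1 - β := by
    simp only [Q, ← hβ]; field_simp; ring
  have hQanti : ∀ x y, 0 < x → x < y → Q y < Q x := by
    intro x y hx hxy
    simp only [Q]
    have : α / y^(m+1) ≤ α / x^(m+1) := by gcongr
    gcongr
  have hQder : ∀ t, 0 < t → HasDerivAt Q (-1 - (m+1) * Q t / t) t := by
    intro t ht
    have := (((hasDerivAt_const t α).div ((hasDerivAt_id t).pow (m+1)) (by simp; positivity)).sub
      (hasDerivAt_id t)).div_const ((m:ℝ)+1+1)
    refine this.congr_deriv ?_
    simp only [Q, id, Pi.pow_apply]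
    field_simp
    push_cast
    simp
    ring
  have hPder : ∀ t, 0 < t → HasDerivAt P ((m+1) * Q t / t) t := by
    intro t ht
    have := ((hasDerivAt_id t).const_sub 1).sub (hQder t ht)
    refine this.congr_deriv ?_
    ring
  have hpos : ∀ t ∈ Set.Icc β c, 0 < t := fun t ht => hβ0.trans_le ht.1
  have hQpos : ∀ t ∈ Set.Ioo β c, 0 < Q t := fun t ht => by
    rw [← hQc]; exact hQanti t c (hβ0.trans ht.1) ht.2
  have hPmono : StrictMonoOn P (Set.Icc β c) := by
    apply strictMonoOn_of_deriv_pos (convex_Icc _ _)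
    · intro t ht; exact (hPder t (hpos t ht)).continuousAt.continuousWithinAt
    · intro t ht
      rw [interior_Icc] at ht
      have h0t : 0 < t := hβ0.trans ht.1
      rw [(hPder t h0t).deriv]
      have := hQpos t ht
      positivity
  have hβc : β ≤ c := hβI.2.trans hbc
  have hPβ : P β = 0 := by simp only [P, hQβ]; ring
  have hPpos : ∀ t ∈ Set.Ioo β c, 0 < P t := fun t ht => by
    rw [← hPβ]; exact hPmono ⟨le_rfl, hβc⟩ ⟨ht.1.le, ht.2.le⟩ ht.1
  have hGder : ∀ t, 0 < t → HasDerivAt (fun t => (1-t)^(k+1+1) + (k+1+1) * P t^(k+1) * t)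
      (-(k+1+1) * (1-t)^(k+1) + (k+1+1) * ((k+1) * P t^k * ((m+1) * Q t / t) * t + P t^(k+1))) t := by
    intro t ht
    have := (((hasDerivAt_id t).const_sub 1).pow (k+1+1)).add
      ((((hPder t ht).pow (k+1)).const_mul ((k:ℝ)+1+1)).mul (hasDerivAt_id t))
    refine this.congr_deriv ?_
    simp
    ring
  have key := quasi_max (g := fun t => (1-t)^(k+1+1) + (k+1+1) * P t^(k+1) * t)
    (c := fun t => (k+1+1) * (Q t * P t^k))
    (D := fun t => (k+1) * (m+1 : ℕ) - (∑ i ∈ range (k+1), (1 + Q t / P t) ^ i))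
    (l := β) (u := c) (t := b) ?_ ?_ ?_ ?_ ⟨hβI.2, hbc⟩
  · simp only [hPb, hPβ] at key
    have e : 1 - b = p + q := by linarith
    rw [e] at key
    rcases le_max_iff.1 key with h | h
    · refine ⟨1 - β, β, by linarith, hβ0.le, by ring, Or.inr ⟨?_, hβ.ge⟩⟩
      simpa using h
    · refine ⟨1 - c, c, by linarith, hc0, by ring, Or.inl ⟨?_, hc.ge⟩⟩
      have : P c = 1 - c := by simp only [P, hQc]; ring
      rwa [this] at h
  · intro t ht
    exact (hGder t (hpos t ht)).continuousAt.continuousWithinAt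
  · intro t ht
    have h0t : 0 < t := hβ0.trans ht.1
    refine (hGder t h0t).congr_deriv ?_
    have hE := E_identity k (m+1) (q := Q t) (hPpos t ht)
    have e : P t + Q t = 1 - t := by simp only [P]; ring
    rw [e] at hE
    have : ((k:ℝ)+1+1) * (Q t * P t^k) * ((k+1) * (m+1 : ℕ) - (∑ i ∈ range (k+1), (1 + Q t / P t) ^ i))
      = -(k+1+1) * (Q t * P t ^ k * ((∑ i ∈ range (k+1), (1 + Q t / P t) ^ i) - (k+1) * (m+1 : ℕ))) := by
      ring
    rw [this, ← hE]
    push_cast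
    field_simp
    ring
  · intro t ht
    have := hPpos t ht
    have := hQpos t ht
    positivity
  · intro x hx y hy hxy
    have hpx := hPpos x hx
    have hqx := hQpos x hx
    have hqy := hQpos y hy
    have hP : P x ≤ P y := hPmono.monotoneOn ⟨hx.1.le, hx.2.le⟩ ⟨hy.1.le, hy.2.le⟩ hxy
    have hQ : Q y ≤ Q x := by
      rcases eq_or_lt_of_le hxy with h | h
      · rw [h]
      · exact (hQanti x y (hβ0.trans hx.1) h).le
    have hpy := hPpos y hy
    have : 0 ≤ 1 + Q y / P y := by positivity
    show _ - _ ≤ _ - _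
    gcongr

/-- path functional: `true` means that the next block increases the coordinate `x`. -/
def pathF (k : ℕ) : Bool → ℝ → List ℝ → ℝ
  | _, x, [] => x ^ (k+1)
  | true, x, p :: L => pathF k false (x + p) L
  | false, x, b :: L => (k+1) * x ^ k * b + pathF k true x L

/-- the target region -/
def Good (k m : ℕ) (P Q : ℝ) : Prop :=
  ∃ x y : ℝ, 0 ≤ x ∧ 0 ≤ y ∧ x + y = 1 ∧
     ((P ≤ x^(k+1) + (k+1) * x^k * y ∧ Q ≤ y^(m+1)) ∨
      (P ≤ x^(k+1) ∧ Q ≤ y^(m+1) + (m+1) * y^m * x))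

lemma Good.symm {k m : ℕ} {P Q : ℝ} (h : Good k m P Q) : Good m k Q P := by
  obtain ⟨x, y, hx, hy, hxy, h⟩ := h
  refine ⟨y, x, hy, hx, by linarith, ?_⟩
  rcases h with h | h
  · exact Or.inr ⟨h.2, h.1⟩
  · exact Or.inl ⟨h.2, h.1⟩

lemma Good.mono {k m : ℕ} {P Q P' Q' : ℝ} (h : Good k m P Q) (hP : P' ≤ P) (hQ : Q' ≤ Q) :
    Good k m P' Q' := by
  obtain ⟨x, y, hx, hy, hxy, h⟩ := h
  refine ⟨x, y, hx, hy, hxy, ?_⟩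
  rcases h with h | h
  · exact Or.inl ⟨hP.trans h.1, hQ.trans h.2⟩
  · exact Or.inr ⟨hP.trans h.1, hQ.trans h.2⟩

/-- stage 1: an initial right-up-right-up piece can be simplified -/
lemma stage1 (k m : ℕ) {p b q c : ℝ} (hp : 0 ≤ p) (hb : 0 ≤ b) (hq : 0 ≤ q) (hc : 0 ≤ c) :
    (∃ b', 0 ≤ b' ∧ b' ≤ b + c ∧ b'^(m+1) * (p+q) = b^(m+1) * q ∧
        p^(k+1) * b + (p+q)^(k+1) * c ≤ (p+q)^(k+1) * (b + c - b')) ∨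
    (∃ q', 0 ≤ q' ∧ q' ≤ p + q ∧ (b+c)^(m+1) * q' = b^(m+1) * q ∧
        p^(k+1) * b + (p+q)^(k+1) * c ≤ (p + q - q')^(k+1) * (b + c)) := by
  rcases eq_or_lt_of_le hb with h0 | hb0
  · subst h0
    exact Or.inl ⟨0, le_rfl, by linarith, by simp, by simp⟩
  rcases eq_or_lt_of_le hq with h0 | hq0
  · subst h0
    exact Or.inl ⟨0, le_rfl, by linarith, by simp, by simp; linarith⟩
  have hX : 0 < p + q := by linarith
  have hY : 0 < b + c := by linarith
  have hpX : 1 - q / (p+q) = p / (p+q) := by field_simp; ring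
  have hq1 : q / (p+q) ≤ 1 := by rw [div_le_one hX]; linarith
  have hb1 : b / (b+c) ≤ 1 := by rw [div_le_one hY]; linarith
  have hpp : (p / (p+q))^(k+1) * (p+q)^(k+1) = p^(k+1) := by
    rw [← mul_pow]; congr 1; field_simp
  rcases stage1_aux k m (q := q / (p+q)) (b := b / (b+c)) (by positivity) hq1 (by positivity) hb1
    with h | h
  · left
    set e : ℝ := (q / (p+q)) ^ ((1:ℝ)/(m+1 : ℕ)) with he
    have he0 : 0 ≤ e := by positivity
    have hem : e^(m+1) = q / (p+q) := by
      rw [he, one_div]; exact Real.rpow_inv_natCast_pow (by positivity) (by omega)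
    have hf : 0 ≤ 1 - (1 - q/(p+q))^(k+1) := by
      rw [hpX]
      have : (p/(p+q))^(k+1) ≤ 1 := pow_le_one₀ (by positivity) (by rw [div_le_one hX]; linarith)
      linarith
    have hef : e ≤ 1 - (p/(p+q))^(k+1) := by
      rw [← hem] at h
      rw [← hpX, ← hem]
      rw [hem] at h ⊢
      rw [← hem] at h
      nth_rewrite 2 [hem] at h
      exact le_of_pow_le_pow_left₀ (by omega) hf h
    have he1 : e ≤ 1 := by
      have : 0 ≤ (p/(p+q))^(k+1) := by positivity
      linarith
    refine ⟨b * e, by positivity, by nlinarith, ?_, ?_⟩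
    · rw [mul_pow, hem]; field_simp
    · have : e * (p+q)^(k+1) ≤ (1 - (p/(p+q))^(k+1)) * (p+q)^(k+1) := by gcongr
      rw [sub_mul, hpp, one_mul] at this
      have h2 : b * (e * (p+q)^(k+1)) ≤ b * ((p+q)^(k+1) - p^(k+1)) := by gcongr
      linarith
  · right
    set w := (b / (b+c))^(m+1) with hw
    have hw1 : w ≤ 1 := pow_le_one₀ (by positivity) hb1
    have hw0 : 0 ≤ w := by positivity
    refine ⟨q * w, by positivity, by nlinarith, ?_, ?_⟩
    · rw [hw, div_pow]; field_simp
    · rw [hpX] at h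
      have e1 : (1 - q / (p+q) * w) = (p + q - q * w) / (p+q) := by field_simp
      rw [e1] at h
      have e2 : ((p + q - q * w) / (p+q))^(k+1) * (p+q)^(k+1) = (p+q-q*w)^(k+1) := by
        rw [← mul_pow]; congr 1; field_simp
      have h2 : (1 - ((p + q - q * w) / (p+q))^(k+1)) * ((p+q)^(k+1) * (b+c)) ≤
        (b / (b+c) * (1 - (p / (p+q))^(k+1))) * ((p+q)^(k+1) * (b+c)) := by gcongr
      have e3 : (b / (b+c) * (1 - (p / (p+q))^(k+1))) * ((p+q)^(k+1) * (b+c)) =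
        b * ((p+q)^(k+1) - p^(k+1)) := by
        rw [← hpp]; field_simp
      have e4 : (1 - ((p + q - q * w) / (p+q))^(k+1)) * ((p+q)^(k+1) * (b+c)) =
        ((p+q)^(k+1) - (p+q-q*w)^(k+1)) * (b+c) := by rw [← e2]; ring
      rw [e3, e4] at h2
      linarith

lemma good_path (N : ℕ) : ∀ (k m : ℕ) (L : List ℝ), L.length ≤ N → (∀ x ∈ L, 0 ≤ x) → L.sum = 1 →
    Good (k+1) (m+1) (pathF (k+1) true 0 L) (pathF (m+1) false 0 L) := by
  induction N with
  | zero =>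
    intro k m L hL _ hs
    have : L = [] := by simpa using hL
    subst this; simp at hs
  | succ N ih =>
    intro k m L hL hpos hs
    match L with
    | [] => simp at hs
    | [p] =>
      have hp : p = 1 := by simpa using hs
      subst hp
      exact ⟨1, 0, by simp, by simp, by simp, by simp [pathF]⟩
    | [p, b] =>
      have hs' : p + b = 1 := by simpa using hs
      refine ⟨p, b, hpos _ (by simp), hpos _ (by simp), hs', Or.inl ?_⟩
      simp [pathF]
      linarith
    | [p, b, q] =>
      have h := stage2 k m (p := p) (b := b) (q := q) (hpos _ (by simp)) (hpos _ (by simp))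
        (hpos _ (by simp)) (by simp at hs; linarith)
      have e1 : pathF (k+1) true 0 [p, b, q] = (p+q)^(k+1+1) + (k+1+1) * p^(k+1) * b := by
        simp [pathF]; ring
      have e2 : pathF (m+1) false 0 [p, b, q] = b^(m+1+1) + (m+1+1) * b^(m+1) * q := by
        simp [pathF]; ring
      rw [e1, e2]
      unfold Good
      push_cast
      exact h
    | p :: b :: q :: c :: L' =>
      have hp : 0 ≤ p := hpos _ (by simp)
      have hb : 0 ≤ b := hpos _ (by simp)
      have hq : 0 ≤ q := hpos _ (by simp)
      have hc : 0 ≤ c := hpos _ (by simp)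
      have hL' : ∀ x ∈ L', 0 ≤ x := fun x hx => hpos x (by simp [hx])
      simp only [List.sum_cons] at hs
      simp only [List.length_cons] at hL
      have e1 : pathF (k+1) true 0 (p :: b :: q :: c :: L') =
        (k+1+1) * (p^(k+1) * b + (p+q)^(k+1) * c) + pathF (k+1) true (p+q) L' := by
        simp [pathF]; ring
      have e2 : pathF (m+1) false 0 (p :: b :: q :: c :: L') =
        (m+1+1) * (b^(m+1) * q) + pathF (m+1) false (b+c) L' := by
        simp [pathF]; ring
      rcases stage1 k m hp hb hq hc with ⟨b', h0, h1, h2, h3⟩ | ⟨q', h0, h1, h2, h3⟩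
      · have := ih m k (b' :: (p+q) :: (b + c - b') :: L') (by simp; omega)
          (by
            intro x hx
            simp only [List.mem_cons] at hx
            rcases hx with rfl | rfl | rfl | hx
            · exact h0
            · positivity
            · linarith
            · exact hL' x hx)
          (by simp only [List.sum_cons]; linarith)
        apply this.symm.mono
        · have : pathF (k+1) false 0 (b' :: (p+q) :: (b + c - b') :: L') =
            (k+1+1) * ((p+q)^(k+1) * (b + c - b')) + pathF (k+1) true (p+q) L' := by
            simp [pathF]; ring
          rw [this, e1]
          gcongr
        · have : pathF (m+1) true 0 (b' :: (p+q) :: (b + c - b') :: L') =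
            (m+1+1) * (b'^(m+1) * (p+q)) + pathF (m+1) false (b+c) L' := by
            simp [pathF]; ring
          rw [this, e2, h2]
      · match L' with
        | [] =>
          have := ih k m [p + q - q', b + c, q'] (by simp; omega)
            (by
              intro x hx
              simp only [List.mem_cons] at hx
              rcases hx with rfl | rfl | rfl | hx
              · linarith
              · positivity
              · exact h0
              · simp at hx)
            (by simp only [List.sum_cons]; linarith)
          apply this.mono
          · have : pathF (k+1) true 0 [p + q - q', b + c, q'] =
              (k+1+1) * ((p+q-q')^(k+1) * (b + c)) + pathF (k+1) true (p+q) [] := by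
              simp [pathF]; ring
            rw [this, e1]
            gcongr
          · have : pathF (m+1) false 0 [p + q - q', b + c, q'] =
              (m+1+1) * ((b+c)^(m+1) * q') + pathF (m+1) false (b+c) [] := by
              simp [pathF]; ring
            rw [this, e2, h2]
        | d :: L'' =>
          have hd : 0 ≤ d := hL' d (by simp)
          simp only [List.sum_cons] at hs
          simp only [List.length_cons] at hL
          have := ih k m ((p + q - q') :: (b + c) :: (q' + d) :: L'') (by simp; omega)
            (by
              intro x hx
              simp only [List.mem_cons] at hx
              rcases hx with rfl | rfl | rfl | hx
              · linarith
              · positivity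
              · positivity
              · exact hL' x (by simp [hx]))
            (by simp only [List.sum_cons]; linarith)
          apply this.mono
          · have : pathF (k+1) true 0 ((p + q - q') :: (b + c) :: (q' + d) :: L'') =
              (k+1+1) * ((p+q-q')^(k+1) * (b + c)) + pathF (k+1) true (p+q) (d :: L'') := by
              simp only [pathF]
              have : 0 + (p + q - q') + (q' + d) = p + q + d := by ring
              rw [this]; push_cast; ring
            rw [this, e1]
            gcongr
          · have : pathF (m+1) false 0 ((p + q - q') :: (b + c) :: (q' + d) :: L'') =
              (m+1+1) * ((b+c)^(m+1) * q') + pathF (m+1) false (b+c) (d :: L'') := by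
              simp [pathF]; ring
            rw [this, e2, h2]

/-- the path coming from a sequence of unit steps -/
def stepList (δ : ℝ) : List Bool → List ℝ
  | [] => []
  | true :: w => δ :: 0 :: stepList δ w
  | false :: w => 0 :: δ :: stepList δ w

lemma stepList_nonneg {δ : ℝ} (h : 0 ≤ δ) (w : List Bool) : ∀ x ∈ stepList δ w, 0 ≤ x := by
  induction w with
  | nil => simp [stepList]
  | cons a w ih => cases a <;> simp [stepList, h] <;> exact ih

lemma stepList_sum (δ : ℝ) (w : List Bool) : (stepList δ w).sum = w.length * δ := by
  induction w with
  | nil => simp [stepList]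
  | cons a w ih => cases a <;> simp [stepList, ih] <;> ring

/-- `∑_t x_t^k` along a word, `x` increasing at letters equal to `a`. -/
def wordSum (k : ℕ) (a : Bool) : ℕ → List Bool → ℕ
  | _, [] => 0
  | x, c :: w => x ^ k + wordSum k a (if c = a then x + 1 else x) w

lemma pow_step (k : ℕ) {x δ : ℝ} (hx : 0 ≤ x) (hδ : 0 ≤ δ) :
    x^(k+1) + (k+1) * x^k * δ ≤ (x+δ)^(k+1) := by
  induction k with
  | zero => simp
  | succ k ih =>
    have : (x^(k+1) + (k+1) * x^k * δ) * (x + δ) ≤ (x+δ)^(k+1) * (x + δ) := by gcongr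
    have h2 : 0 ≤ (k+1) * x^k * δ * δ := by positivity
    calc _ = (x^(k+1) + (k+1) * x^k * δ) * (x + δ) - (k+1) * x^k * δ * δ := by push_cast; ring
      _ ≤ (x+δ)^(k+1) * (x + δ) := by linarith
      _ = _ := by ring

lemma pathF_true_ge (k : ℕ) {δ : ℝ} (hδ : 0 ≤ δ) (w : List Bool) (x : ℕ) :
    (k+1) * δ^(k+1) * wordSum k true x w + (x * δ)^(k+1) ≤ pathF k true (x * δ) (stepList δ w) := by
  induction w generalizing x with
  | nil => simp [wordSum, stepList, pathF]
  | cons c w ih =>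
    cases c
    · simp only [stepList, pathF, wordSum]
      have := ih x
      simp only [Bool.false_eq_true, if_false, add_zero]
      push_cast
      have e : (k+1) * ((x:ℝ) * δ)^k * δ = (k+1) * δ^(k+1) * (x:ℝ)^k := by ring
      rw [e]; linarith
    · simp only [stepList, pathF, wordSum]
      have := ih (x+1)
      simp only [if_true, mul_zero, zero_add]
      have e0 : (x:ℝ) * δ + δ = (x+1 : ℕ) * δ := by push_cast; ring
      rw [e0]
      have h2 := pow_step k (x := x * δ) (by positivity) hδ
      rw [e0] at h2
      push_cast at *
      have e : (k+1) * ((x:ℝ) * δ)^k * δ = (k+1) * δ^(k+1) * (x:ℝ)^k := by ring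
      rw [e] at h2; linarith

lemma pathF_false_ge (k : ℕ) {δ : ℝ} (hδ : 0 ≤ δ) (w : List Bool) (x : ℕ) :
    (k+1) * δ^(k+1) * wordSum k false x w + (x * δ)^(k+1) ≤ pathF k false (x * δ) (stepList δ w) := by
  induction w generalizing x with
  | nil => simp [wordSum, stepList, pathF]
  | cons c w ih =>
    cases c
    · simp only [stepList, pathF, wordSum]
      have := ih (x+1)
      simp only [if_true, mul_zero, zero_add]
      have e0 : (x:ℝ) * δ + δ = (x+1 : ℕ) * δ := by push_cast; ring
      rw [e0]
      have h2 := pow_step k (x := x * δ) (by positivity) hδ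
      rw [e0] at h2
      push_cast at *
      have e : (k+1) * ((x:ℝ) * δ)^k * δ = (k+1) * δ^(k+1) * (x:ℝ)^k := by ring
      rw [e] at h2; linarith
    · simp only [stepList, pathF, wordSum]
      have := ih x
      simp only [reduceCtorEq, if_false, add_zero]
      push_cast
      have e : (k+1) * ((x:ℝ) * δ)^k * δ = (k+1) * δ^(k+1) * (x:ℝ)^k := by ring
      rw [e]; linarith

lemma good_word (k m : ℕ) (w : List Bool) (hw : w ≠ []) :
    Good (k+1) (m+1) ((k+1+1) * wordSum (k+1) true 0 w / (w.length : ℝ)^(k+1+1))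
      ((m+1+1) * wordSum (m+1) false 0 w / (w.length : ℝ)^(m+1+1)) := by
  have hn : 0 < (w.length : ℝ) := by
    have := List.length_pos_iff.2 hw
    exact_mod_cast this
  have hδ : 0 ≤ 1 / (w.length : ℝ) := by positivity
  have h := good_path _ k m (stepList (1 / (w.length : ℝ)) w) le_rfl (stepList_nonneg hδ w)
    (by rw [stepList_sum]; field_simp)
  have h1 := pathF_true_ge (k+1) hδ w 0
  have h2 := pathF_false_ge (m+1) hδ w 0
  simp at h1 h2
  apply h.mono
  · refine le_trans (le_of_eq ?_) (by simpa using h1)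
    field_simp
  · refine le_trans (le_of_eq ?_) (by simpa using h2)
    field_simp

def Cross (A B : Finset ℕ) : Prop := ∀ x y, x ∈ A → x ∈ B → y ∈ A → y ∈ B → x = y

noncomputable def shf (i j : ℕ) (A : Finset ℕ) : Finset ℕ :=
  if i ∉ A ∧ j ∈ A then insert i (A.erase j) else A

noncomputable def shfam (i j : ℕ) (F : Finset (Finset ℕ)) (A : Finset ℕ) : Finset ℕ :=
  if shf i j A ∈ F then A else shf i j A

lemma shfam_injOn (i j : ℕ) (F : Finset (Finset ℕ)) : Set.InjOn (shfam i j F) (F : Set (Finset ℕ)) := by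
  intro A hA B hB h
  rw [Finset.mem_coe] at hA hB
  unfold shfam at h
  split_ifs at h with h1 h2 h2
  · exact h
  · rw [h] at hA; exact absurd hA h2
  · rw [← h] at hB; exact absurd hB h1
  · have hA' : i ∉ A ∧ j ∈ A := by
      by_contra hn
      rw [shf, if_neg hn] at h1; exact h1 hA
    have hB' : i ∉ B ∧ j ∈ B := by
      by_contra hn
      rw [shf, if_neg hn] at h2; exact h2 hB
    rw [shf, if_pos hA', shf, if_pos hB'] at h
    ext x
    have := congrArg (fun S => x ∈ S) h
    simp only [mem_insert, mem_erase, eq_iff_iff] at this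
    by_cases hxi : x = i
    · subst hxi; simp [hA'.1, hB'.1]
    · by_cases hxj : x = j
      · subst hxj; simp [hA'.2, hB'.2]
      · simpa [hxi, hxj] using this

lemma shfam_card_eq (i j : ℕ) (F : Finset (Finset ℕ)) (A : Finset ℕ) :
    (shfam i j F A).card = A.card := by
  unfold shfam shf
  split_ifs with h1 h2 h2 <;> try rfl
  rw [card_insert_of_notMem (by simp [h1.1]), card_erase_of_mem h1.2]
  have : 0 < A.card := card_pos.2 ⟨j, h1.2⟩
  omega

lemma shfam_subset {i j n : ℕ} (hi : i < n) (F : Finset (Finset ℕ)) (A : Finset ℕ)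
    (hA : A ⊆ range n) : shfam i j F A ⊆ range n := by
  unfold shfam shf
  split_ifs with h1 h2 h2 <;> try exact hA
  intro x hx
  simp only [mem_insert, mem_erase] at hx
  rcases hx with rfl | hx
  · simpa using hi
  · exact hA hx.2

lemma cross_aux1 {i j : ℕ} {A B : Finset ℕ} (hi : i ∉ A) (hj : j ∈ A)
    (h1 : Cross A B) (h2 : Cross A (shf j i B)) : Cross (insert i (A.erase j)) B := by
  intro x y hxA hxB hyA hyB
  simp only [mem_insert, mem_erase] at hxA hyA
  unfold shf at h2
  unfold Cross at h1 h2
  split_ifs at h2 with h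
  · have := h2 x y
    have := h2 x j
    have := h2 j y
    simp only [mem_insert, mem_erase] at *
    grind
  · have := h1 x y
    have := h1 x j
    have := h1 j y
    grind

lemma Cross.symm {A B : Finset ℕ} (h : Cross A B) : Cross B A :=
  fun x y a b c d => h x y b a d c

lemma cross_shfam {i j : ℕ} (hij : i ≠ j) {F G : Finset (Finset ℕ)}
    (h : ∀ A ∈ F, ∀ B ∈ G, Cross A B) {A B : Finset ℕ} (hA : A ∈ F) (hB : B ∈ G) :
    Cross (shfam i j F A) (shfam j i G B) := by
  unfold shfam
  split_ifs with h1 h2 h2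
  · exact h A hA B hB
  · have hB' : j ∉ B ∧ i ∈ B := by
      by_contra hn
      rw [shf, if_neg hn] at h2; exact h2 hB
    have := cross_aux1 hB'.1 hB'.2 (h A hA B hB).symm (h _ h1 B hB).symm
    rw [shf, if_pos hB']
    exact this.symm
  · have hA' : i ∉ A ∧ j ∈ A := by
      by_contra hn
      rw [shf, if_neg hn] at h1; exact h1 hA
    have := cross_aux1 hA'.1 hA'.2 (h A hA B hB) (h A hA _ h2)
    rw [shf, if_pos hA']
    exact this
  · have hB' : j ∉ B ∧ i ∈ B := by
      by_contra hn
      rw [shf, if_neg hn] at h2; exact h2 hB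
    have hA' : i ∉ A ∧ j ∈ A := by
      by_contra hn
      rw [shf, if_neg hn] at h1; exact h1 hA
    rw [shf, if_pos hA', shf, if_pos hB']
    have := h A hA B hB
    intro x y hxA hxB hyA hyB
    have := this x y
    simp only [mem_insert, mem_erase] at *
    grind

lemma exists_compressed (n s r N : ℕ) : ∀ F G : Finset (Finset ℕ),
    (∑ A ∈ F, ∑ x ∈ A, x) ≤ N →
    (∀ A ∈ F, A ⊆ range n ∧ A.card = s) → (∀ B ∈ G, B ⊆ range n ∧ B.card = r) →
    (∀ A ∈ F, ∀ B ∈ G, Cross A B) →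
    ∃ F' G' : Finset (Finset ℕ), F'.card = F.card ∧ G'.card = G.card ∧
      (∀ A ∈ F', A ⊆ range n ∧ A.card = s) ∧ (∀ B ∈ G', B ⊆ range n ∧ B.card = r) ∧
      (∀ A ∈ F', ∀ B ∈ G', Cross A B) ∧
      (∀ A ∈ F', ∀ i j, i < j → j ∈ A → i ∉ A → insert i (A.erase j) ∈ F') := by
  induction N with
  | zero =>
    intro F G hN hF hG hX
    refine ⟨F, G, rfl, rfl, hF, hG, hX, ?_⟩
    intro A hA i j hij hj hi
    exfalso
    have h0 : (∑ A ∈ F, ∑ x ∈ A, x) = 0 := by omega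
    rw [sum_eq_zero_iff] at h0
    have := h0 A hA
    rw [sum_eq_zero_iff] at this
    have := this j hj
    omega
  | succ N ih =>
    intro F G hN hF hG hX
    by_cases hcomp : ∀ A ∈ F, ∀ i j, i < j → j ∈ A → i ∉ A → insert i (A.erase j) ∈ F
    · exact ⟨F, G, rfl, rfl, hF, hG, hX, hcomp⟩
    push Not at hcomp
    obtain ⟨A, hA, i, j, hij, hj, hi, hnot⟩ := hcomp
    have hjn : j < n := by simpa using (hF A hA).1 hj
    have hsum : ∀ C ∈ F, (∑ x ∈ shfam i j F C, x) ≤ ∑ x ∈ C, x ∧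
        (shfam i j F C ≠ C → (∑ x ∈ shfam i j F C, x) < ∑ x ∈ C, x) := by
      intro C hC
      unfold shfam shf
      split_ifs with h1 h2 <;> try simp
      rw [sum_insert (by simp [h1.1])]
      have := add_sum_erase C (fun x => x) h1.2
      constructor
      · omega
      · intro; omega
    have hlt : (∑ C ∈ F.image (shfam i j F), ∑ x ∈ C, x) < ∑ C ∈ F, ∑ x ∈ C, x := by
      rw [sum_image (shfam_injOn i j F)]
      apply sum_lt_sum
      · intro C hC; exact (hsum C hC).1
      · refine ⟨A, hA, (hsum A hA).2 ?_⟩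
        have : shf i j A = insert i (A.erase j) := by rw [shf, if_pos ⟨hi, hj⟩]
        rw [shfam, this, if_neg hnot]
        intro h
        rw [← h] at hi
        simp at hi
    obtain ⟨F', G', h1, h2, h3⟩ := ih (F.image (shfam i j F)) (G.image (shfam j i G)) (by omega)
      (by
        intro C hC
        obtain ⟨D, hD, rfl⟩ := mem_image.1 hC
        exact ⟨shfam_subset (hij.trans hjn) F D (hF D hD).1, by
          rw [shfam_card_eq]; exact (hF D hD).2⟩)
      (by
        intro C hC
        obtain ⟨D, hD, rfl⟩ := mem_image.1 hC
        exact ⟨shfam_subset hjn G D (hG D hD).1, by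
          rw [shfam_card_eq]; exact (hG D hD).2⟩)
      (by
        intro C hC C' hC'
        obtain ⟨D, hD, rfl⟩ := mem_image.1 hC
        obtain ⟨D', hD', rfl⟩ := mem_image.1 hC'
        exact cross_shfam hij.ne hX hD hD')
    refine ⟨F', G', ?_, ?_, h3⟩
    · rw [h1, card_image_of_injOn (shfam_injOn i j F)]
    · rw [h2, card_image_of_injOn (shfam_injOn j i G)]

lemma count_vertex (k v : ℕ) (T : Finset ℕ) (F : Finset (Finset ℕ))
    (hF : ∀ A ∈ F, A.card = k + 1 ∧ v ∈ A ∧ ∀ u ∈ A, u ≠ v → u ∈ T) :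
    k.factorial * F.card ≤ T.card ^ k := by
  have h : F ⊆ (T.powersetCard k).image (insert v) := by
    intro A hA
    obtain ⟨h1, h2, h3⟩ := hF A hA
    rw [mem_image]
    refine ⟨A.erase v, ?_, insert_erase h2⟩
    rw [mem_powersetCard]
    refine ⟨?_, by rw [card_erase_of_mem h2, h1]; rfl⟩
    intro u hu
    rw [mem_erase] at hu
    exact h3 u hu.2 hu.1
  have h2 : F.card ≤ T.card.choose k :=
    (card_le_card h).trans (card_image_le.trans (card_powersetCard _ _).le)
  calc k.factorial * F.card ≤ k.factorial * T.card.choose k := by gcongr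
    _ = T.card.descFactorial k := (Nat.descFactorial_eq_factorial_mul_choose _ _).symm
    _ ≤ _ := Nat.descFactorial_le_pow _ _

lemma exists_word (k m n : ℕ) (F G : Finset (Finset ℕ))
    (hF : ∀ A ∈ F, A ⊆ range n ∧ A.card = k + 1) (hG : ∀ B ∈ G, B ⊆ range n ∧ B.card = m + 1)
    (hX : ∀ A ∈ F, ∀ B ∈ G, Cross A B)
    (hC : ∀ A ∈ F, ∀ i j, i < j → j ∈ A → i ∉ A → insert i (A.erase j) ∈ F) (l : ℕ) :
    ∀ x y : ℕ, x + l + y = n →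
      (∀ A ∈ F, ∀ u ∈ A, ∀ v ∈ A, x + l ≤ u → v ∉ Finset.Ico x (x+l)) →
      (∀ B ∈ G, ∀ u ∈ B, ∀ v ∈ B, u < x → v ∉ Finset.Ico x (x+l)) →
      ∃ w : List Bool, w.length = l ∧
        k.factorial * (F.filter (fun A => ∃ v ∈ A, v ∈ Finset.Ico x (x+l))).card ≤ wordSum k true x w ∧
        m.factorial * (G.filter (fun A => ∃ v ∈ A, v ∈ Finset.Ico x (x+l))).card
          ≤ wordSum m false y w := by
  have hE : ∀ A ∈ F, ∀ u ∈ A, ∀ v ∈ A, ∀ u' ≤ u, u ≠ v → u' ≠ v → ∃ A' ∈ F, u' ∈ A' ∧ v ∈ A' := by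
    intro A hA u hu v hv u' hu' huv hu'v
    by_cases h : u' ∈ A
    · exact ⟨A, hA, h, hv⟩
    · have : u' < u := lt_of_le_of_ne hu' (by rintro rfl; exact h hu)
      exact ⟨_, hC A hA u' u this hu h, by simp, by simp [hv, huv.symm]⟩
  have hsplit : ∀ (K : ℕ) (H : Finset (Finset ℕ)) (I J T : Finset ℕ) (v0 : ℕ),
      (∀ A ∈ H, A ⊆ range n ∧ A.card = K + 1) →
      (∀ v ∈ I, v = v0 ∨ v ∈ J) → 
      (∀ A ∈ H, v0 ∈ A → (∀ v ∈ A, v ∉ J) → ∀ u ∈ A, u ≠ v0 → u ∈ T) →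
      K.factorial * (H.filter (fun A => ∃ v ∈ A, v ∈ I)).card ≤ T.card ^ K +
        K.factorial * (H.filter (fun A => ∃ v ∈ A, v ∈ J)).card := by
    intro K H I J T v0 h1 h2 h3
    have hs : H.filter (fun A => ∃ v ∈ A, v ∈ I) ⊆
      H.filter (fun A => v0 ∈ A ∧ ∀ v ∈ A, v ∉ J) ∪ H.filter (fun A => ∃ v ∈ A, v ∈ J) := by
      intro A hA
      rw [mem_filter] at hA
      rw [mem_union, mem_filter, mem_filter]
      by_cases h : ∃ v ∈ A, v ∈ J
      · exact Or.inr ⟨hA.1, h⟩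
      · left
        obtain ⟨v, hv, hvI⟩ := hA.2
        push Not at h
        rcases h2 v hvI with rfl | h'
        · exact ⟨hA.1, hv, h⟩
        · exact absurd h' (h v hv)
    have hc := (card_le_card hs).trans (card_union_le _ _)
    have hv := count_vertex K v0 T (H.filter (fun A => v0 ∈ A ∧ ∀ v ∈ A, v ∉ J)) (by
      intro A hA
      rw [mem_filter] at hA
      exact ⟨(h1 A hA.1).2, hA.2.1, h3 A hA.1 hA.2.1 hA.2.2⟩)
    have := Nat.mul_le_mul_left K.factorial hc
    rw [mul_add] at this
    omega
  induction l with
  | zero =>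
    intro x y hxy _ _
    exact ⟨[], rfl, by simp [wordSum], by simp [wordSum]⟩
  | succ l ih =>
    intro x y hxy I1 I2
    by_cases hD : l = 0 ∨ ∃ A ∈ F, x ∈ A ∧ x + l ∈ A
    · obtain ⟨w, hw, hw1, hw2⟩ := ih (x+1) y (by omega)
        (by
          intro A hA u hu v hv huv hvI
          have := I1 A hA u hu v hv (by omega)
          simp only [Finset.mem_Ico] at this hvI
          omega)
        (by
          intro B hB u hu v hv hux hvI
          have := I2 B hB u hu v hv
          simp only [Finset.mem_Ico] at this hvI
          have hu' : u = x := by omega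
          subst hu'
          rcases hD with rfl | ⟨A, hA, h1, h2⟩
          · omega
          · obtain ⟨A', hA', h3, h4⟩ := hE A hA (u + l) h2 u h1 v (by omega) (by omega) (by omega)
            have := hX A' hA' B hB u v h4 hu h3 hv
            omega)
      refine ⟨true :: w, by simp [hw], ?_, ?_⟩
      · have := hsplit k F (Finset.Ico x (x+(l+1))) (Finset.Ico (x+1) (x+1+l)) (range x) x hF
          (by intro v hv; simp only [Finset.mem_Ico] at *; omega)
          (by
            intro A hA hx hJ u hu hux
            have h1 := I1 A hA u hu x hx
            have h2 := hJ u hu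
            simp only [Finset.mem_Ico, mem_range] at *
            omega)
        simp only [wordSum, if_true, card_range] at *
        omega
      · have := hsplit m G (Finset.Ico x (x+(l+1))) (Finset.Ico (x+1) (x+1+l)) (Finset.Ico (x+(l+1)) n) x hG
          (by intro v hv; simp only [Finset.mem_Ico] at *; omega)
          (by
            intro A hA hx hJ u hu hux
            have h1 := I2 A hA u hu x hx
            have h2 := hJ u hu
            have h3 := (hG A hA).1 hu
            simp only [Finset.mem_Ico, mem_range] at *
            omega)
        have hy : n - (x + (l+1)) = y := by omega
        simp only [wordSum, reduceCtorEq, if_false, Nat.card_Ico, hy] at *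
        omega
    · push Not at hD
      obtain ⟨hl, hD⟩ := hD
      obtain ⟨w, hw, hw1, hw2⟩ := ih x (y+1) (by omega)
        (by
          intro A hA u hu v hv huv hvI
          have := I1 A hA u hu v hv
          simp only [Finset.mem_Ico] at this hvI
          have hu' : u = x + l := by omega
          subst hu'
          obtain ⟨A', hA', h3, h4⟩ := hE A hA v hv (x+l) hu x (by omega) (by omega) (by omega)
          exact hD A' hA' h3 h4)
        (by
          intro B hB u hu v hv hux hvI
          have := I2 B hB u hu v hv (by omega)
          simp only [Finset.mem_Ico] at this hvI
          omega)
      refine ⟨false :: w, by simp [hw], ?_, ?_⟩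
      · have := hsplit k F (Finset.Ico x (x+(l+1))) (Finset.Ico x (x+l)) (range x) (x+l) hF
          (by intro v hv; simp only [Finset.mem_Ico] at *; omega)
          (by
            intro A hA hx hJ u hu hux
            have h1 := I1 A hA u hu (x+l) hx
            have h2 := hJ u hu
            simp only [Finset.mem_Ico, mem_range] at *
            omega)
        simp only [wordSum, reduceCtorEq, if_false, card_range] at *
        omega
      · have := hsplit m G (Finset.Ico x (x+(l+1))) (Finset.Ico x (x+l)) (Finset.Ico (x+(l+1)) n) (x+l) hG
          (by intro v hv; simp only [Finset.mem_Ico] at *; omega)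
          (by
            intro A hA hx hJ u hu hux
            have h1 := I2 A hA u hu (x+l) hx
            have h2 := hJ u hu
            have h3 := (hG A hA).1 hu
            simp only [Finset.mem_Ico, mem_range] at *
            omega)
        have hy : n - (x + (l+1)) = y := by omega
        simp only [wordSum, if_true, Nat.card_Ico, hy] at *
        omega

/-- Finite version: cross families satisfy the region bound. -/
lemma good_families (k m n : ℕ) (hn : 0 < n) (F G : Finset (Finset ℕ))
    (hF : ∀ A ∈ F, A ⊆ range n ∧ A.card = k + 1 + 1)
    (hG : ∀ B ∈ G, B ⊆ range n ∧ B.card = m + 1 + 1)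
    (hX : ∀ A ∈ F, ∀ B ∈ G, Cross A B) :
    Good (k+1) (m+1) ((k+1+1).factorial * F.card / (n:ℝ)^(k+1+1))
      ((m+1+1).factorial * G.card / (n:ℝ)^(m+1+1)) := by
  obtain ⟨F', G', h1, h2, hF', hG', hX', hC⟩ := exists_compressed n _ _ _ F G le_rfl hF hG hX
  obtain ⟨w, hw, hw1, hw2⟩ := exists_word (k+1) (m+1) n F' G' hF' hG' hX' hC n 0 0 (by omega)
    (by
      intro A hA u hu v hv h
      have := (hF' A hA).1 hu
      simp at this
      omega)
    (by intro B hB u hu v hv h; omega)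
  have full : ∀ (K : ℕ) (H : Finset (Finset ℕ)), (∀ A ∈ H, A ⊆ range n ∧ A.card = K + 1) →
      H.filter (fun A => ∃ v ∈ A, v ∈ Finset.Ico 0 (0+n)) = H := by
    intro K H hH
    rw [filter_eq_self]
    intro A hA
    obtain ⟨h1, h2⟩ := hH A hA
    obtain ⟨v, hv⟩ := card_pos.1 (by omega : 0 < A.card)
    exact ⟨v, hv, by simpa using h1 hv⟩
  rw [full (k+1) F' hF', h1] at hw1
  rw [full (m+1) G' hG', h2] at hw2
  have hg := good_word k m w (by rintro rfl; simp at hw; omega)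
  rw [hw] at hg
  have c1 : ((k+1).factorial : ℝ) * F.card ≤ wordSum (k+1) true 0 w := by exact_mod_cast hw1
  have c2 : ((m+1).factorial : ℝ) * G.card ≤ wordSum (m+1) false 0 w := by exact_mod_cast hw2
  apply hg.mono
  · rw [Nat.factorial_succ (k+1)]
    push_cast
    rw [mul_assoc]
    gcongr
  · rw [Nat.factorial_succ (m+1)]
    push_cast
    rw [mul_assoc]
    gcongr

lemma compact_compare {f h : ℝ → ℝ} (hf : Continuous f) (hh : Continuous h)
    (hfm : StrictMonoOn f (Set.Icc 0 1)) (hha : AntitoneOn h (Set.Icc 0 1)) {ε : ℝ} (hε : 0 < ε) :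
    ∃ η > 0, ∀ x ∈ Set.Icc (0:ℝ) 1, ∀ y ∈ Set.Icc (0:ℝ) 1, f y - η ≤ f x → h x ≤ h y + ε := by
  let K : Set (ℝ × ℝ) := (Set.Icc (0:ℝ) 1 ×ˢ Set.Icc (0:ℝ) 1) ∩ {z | h z.2 + ε ≤ h z.1}
  have hK : IsCompact K := by
    apply (isCompact_Icc.prod isCompact_Icc).inter_right
    exact isClosed_le (by fun_prop) (by fun_prop)
  have hpos : ∀ z ∈ K, 0 < f z.2 - f z.1 := by
    rintro ⟨x, y⟩ ⟨⟨hx, hy⟩, hz⟩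
    simp only at hx hy
    have hz' : h y + ε ≤ h x := hz
    have : x < y := by
      by_contra hn
      have := hha hy hx (not_lt.1 hn)
      linarith
    have := hfm hx hy this
    simp only
    linarith
  rcases K.eq_empty_or_nonempty with he | hne
  · refine ⟨1, one_pos, fun x hx y hy _ => ?_⟩
    by_contra hn
    have : (x, y) ∈ K := ⟨⟨hx, hy⟩, (not_le.1 hn).le⟩
    rw [he] at this
    exact this
  · obtain ⟨z0, hz0, hmin⟩ := hK.exists_isMinOn hne
      (f := fun z : ℝ × ℝ => f z.2 - f z.1) (by fun_prop)
    refine ⟨(f z0.2 - f z0.1) / 2, half_pos (hpos z0 hz0), fun x hx y hy hxy => ?_⟩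
    by_contra hn
    have hm : (x, y) ∈ K := ⟨⟨hx, hy⟩, (not_le.1 hn).le⟩
    have h1 : f z0.2 - f z0.1 ≤ f y - f x := hmin hm
    have := hpos z0 hz0
    linarith

lemma gr_strictMono (m : ℕ) :
    StrictMonoOn (fun b : ℝ => b^(m+1+1) + (m+1+1) * b^(m+1) * (1-b)) (Set.Icc 0 1) := by
  apply strictMonoOn_of_deriv_pos (convex_Icc _ _) (by fun_prop)
  intro t ht
  rw [interior_Icc] at ht
  have h1 := ht.1
  have h2 : 0 < 1 - t := by linarith [ht.2]
  have : HasDerivAt (fun b : ℝ => b^(m+1+1) + (m+1+1) * b^(m+1) * (1-b))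
      ((m+1+1) * (m+1) * t^m * (1-t)) t := by
    have := ((hasDerivAt_id t).pow (m+1+1)).add
      ((((hasDerivAt_id t).pow (m+1)).const_mul ((m:ℝ)+1+1)).mul ((hasDerivAt_id t).const_sub 1))
    refine this.congr_deriv ?_
    simp only [id, Pi.pow_apply, add_tsub_cancel_right]
    push_cast
    ring
  rw [this.deriv]
  positivity

lemma choose_asymp (s : ℕ) {η : ℝ} (hη : 0 < η) : ∃ N : ℕ, 0 < N ∧ ∀ n ≥ N, s ≤ n ∧
    (1 - η) * (n:ℝ)^s ≤ s.factorial * (n.choose s : ℝ) := by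
  obtain ⟨M, hM⟩ := exists_nat_gt ((s:ℝ)*s/η)
  refine ⟨max (M+1) (s+1), by simp, fun n hn => ?_⟩
  have hnM : M + 1 ≤ n := (le_max_left _ _).trans hn
  have hns : s + 1 ≤ n := (le_max_right _ _).trans hn
  refine ⟨by omega, ?_⟩
  have hn0 : (0:ℝ) < n := by
    have : 0 < n := by omega
    exact_mod_cast this
  have h1 : ((n:ℝ) - s)^s ≤ s.factorial * (n.choose s : ℝ) := by
    have := Nat.pow_sub_le_descFactorial n s
    rw [Nat.descFactorial_eq_factorial_mul_choose] at this
    have h2 : (n - s)^s ≤ s.factorial * n.choose s :=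
      (Nat.pow_le_pow_left (by omega) s).trans this
    have h3 : (((n - s)^s : ℕ) : ℝ) ≤ ((s.factorial * n.choose s : ℕ) : ℝ) := by exact_mod_cast h2
    push_cast [Nat.cast_sub (by omega : s ≤ n)] at h3
    exact h3
  refine le_trans ?_ h1
  have hsn : (s:ℝ)/n ≤ 1 := by
    rw [div_le_one hn0]; exact_mod_cast (by omega : s ≤ n)
  have hb := one_add_mul_le_pow (a := -((s:ℝ)/n)) (by linarith) s
  have e : ((n:ℝ) - s)^s = (1 + -((s:ℝ)/n))^s * (n:ℝ)^s := by
    rw [← mul_pow]; congr 1; field_simp; ring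
  rw [e]
  gcongr
  refine le_trans ?_ hb
  have : (s:ℝ) * (s/n) ≤ η := by
    rw [← mul_div_assoc, div_le_iff₀ hn0]
    rw [div_lt_iff₀ hη] at hM
    have : (M:ℝ) ≤ n := by exact_mod_cast (by omega : M ≤ n)
    nlinarith
  linarith

lemma inducedDensity_eq {W V : Type*} [Fintype W] [Fintype V] [DecidableEq V]
    (H : SimpleGraph W) (G : SimpleGraph V) : inducedDensity H G =
  ((((univ : Finset V).powersetCard (Fintype.card W)).filter
      (fun S : Finset V => Nonempty (H ≃g G.induce (S : Set V)))).card : ℝ) /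
    ((univ : Finset V).powersetCard (Fintype.card W)).card := by
  unfold inducedDensity
  congr 2
  have e : (do let a ← powersetCard (Fintype.card W) (univ : Finset V)
               pure (a : Set V) : Finset (Set V)) =
      (powersetCard (Fintype.card W) (univ : Finset V)).image (fun a : Finset V => (a : Set V)) := by
    ext S
    simp [Finset.bind_def, Finset.mem_sup, eq_comm]
  rw [e, filter_image, card_image_of_injective _ Finset.coe_injective]

lemma good_graph (k m n : ℕ) (hn : 0 < n) (hk : k + 1 + 1 ≤ n) (hm : m + 1 + 1 ≤ n)
    (G : SimpleGraph (Fin n)) :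
    Good (k+1) (m+1)
      (((k+1+1).factorial * (n.choose (k+1+1) : ℝ)) / (n:ℝ)^(k+1+1) *
        inducedDensity (⊤ : SimpleGraph (Fin (k+1+1))) G)
      (((m+1+1).factorial * (n.choose (m+1+1) : ℝ)) / (n:ℝ)^(m+1+1) *
        inducedDensity (⊥ : SimpleGraph (Fin (m+1+1))) G) := by
  let F0 := (((univ : Finset (Fin n)).powersetCard (k+1+1)).filter
      (fun S : Finset (Fin n) => Nonempty ((⊤ : SimpleGraph (Fin (k+1+1))) ≃g G.induce (S : Set (Fin n)))))
  let G0 := (((univ : Finset (Fin n)).powersetCard (m+1+1)).filter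
      (fun S : Finset (Fin n) => Nonempty ((⊥ : SimpleGraph (Fin (m+1+1))) ≃g G.induce (S : Set (Fin n)))))
  have hmap : ∀ (c : ℕ) (H : Finset (Finset (Fin n))), (∀ S ∈ H, S.card = c) →
      ∀ A ∈ H.image (Finset.map Fin.valEmbedding), A ⊆ range n ∧ A.card = c := by
    intro c H hH A hA
    obtain ⟨S, hS, rfl⟩ := mem_image.1 hA
    refine ⟨?_, by rw [card_map]; exact hH S hS⟩
    intro x hx
    obtain ⟨y, _, rfl⟩ := mem_map.1 hx
    simp
  have key := good_families k m n hn (F0.image (Finset.map Fin.valEmbedding))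
    (G0.image (Finset.map Fin.valEmbedding))
    (hmap _ F0 (fun S hS => (mem_powersetCard.1 (mem_filter.1 hS).1).2))
    (hmap _ G0 (fun S hS => (mem_powersetCard.1 (mem_filter.1 hS).1).2))
    (by
      intro A hA B hB
      obtain ⟨S, hS, rfl⟩ := mem_image.1 hA
      obtain ⟨T, hT, rfl⟩ := mem_image.1 hB
      intro x y hxA hxB hyA hyB
      obtain ⟨x', hx', rfl⟩ := mem_map.1 hxA
      obtain ⟨y', hy', rfl⟩ := mem_map.1 hyA
      rw [mem_map' Fin.valEmbedding] at hxB hyB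
      by_contra hne
      have hne' : x' ≠ y' := fun h => hne (by rw [h])
      obtain ⟨e⟩ := (mem_filter.1 hS).2
      obtain ⟨e'⟩ := (mem_filter.1 hT).2
      have h1 : G.Adj x' y' := by
        have : (G.induce (S : Set (Fin n))).Adj ⟨x', hx'⟩ ⟨y', hy'⟩ := by
          rw [← e.symm.map_adj_iff, SimpleGraph.top_adj]
          intro h
          have := e.symm.injective h
          simp only [Subtype.mk.injEq] at this
          exact hne' this
        simpa using this
      have h2 : ¬ G.Adj x' y' := by
        intro h
        have : (G.induce (T : Set (Fin n))).Adj ⟨x', hxB⟩ ⟨y', hyB⟩ := by simpa using h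
        rw [← e'.symm.map_adj_iff] at this
        simp at this
      exact h2 h1)
  rw [card_image_of_injective _ (Finset.map_injective _),
    card_image_of_injective _ (Finset.map_injective _)] at key
  have d1 : inducedDensity (⊤ : SimpleGraph (Fin (k+1+1))) G = F0.card / (n.choose (k+1+1) : ℝ) := by
    rw [inducedDensity_eq]
    simp only [Fintype.card_fin, card_powersetCard, card_univ, F0]
  have d2 : inducedDensity (⊥ : SimpleGraph (Fin (m+1+1))) G = G0.card / (n.choose (m+1+1) : ℝ) := by
    rw [inducedDensity_eq]
    simp only [Fintype.card_fin, card_powersetCard, card_univ, G0]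
  have c1 : (0:ℝ) < n.choose (k+1+1) := by exact_mod_cast Nat.choose_pos hk
  have c2 : (0:ℝ) < n.choose (m+1+1) := by exact_mod_cast Nat.choose_pos hm
  have hn' : (0:ℝ) < n := by exact_mod_cast hn
  apply key.mono
  · rw [d1]; apply le_of_eq; field_simp
  · rw [d2]; apply le_of_eq; field_simp

lemma inducedDensity_mem {W V : Type*} [Fintype W] [Fintype V] [DecidableEq V]
    (H : SimpleGraph W) (G : SimpleGraph V) : 0 ≤ inducedDensity H G ∧ inducedDensity H G ≤ 1 := by
  rw [inducedDensity_eq]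
  refine ⟨by positivity, ?_⟩
  apply div_le_one_of_le₀
  · exact_mod_cast card_filter_le _ _
  · positivity

/-- Theorem (Huang–Linial–Naves–Peled–Sudakov): for integers `r, s ≥ 2`, for every `ε > 0`
there is `N` such that every graph `G` on `n ≥ N` vertices with `d(K̄_r;G) ≥ α` satisfies
`d(K_s;G) ≤ max{(1-α^{1/r})^s + s α^{1/r}(1-α^{1/r})^{s-1}, (1-β)^s} + ε`, where `β` is the
unique root in `[0,1]` of `β^r + r β^{r-1}(1-β) = α`. -/
theorem clique_density_upper_bound (r s : ℕ) (hr : 2 ≤ r) (hs : 2 ≤ s) :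
    ∀ ε : ℝ, 0 < ε → ∃ N : ℕ, ∀ n : ℕ, N ≤ n → ∀ G : SimpleGraph (Fin n),
      ∀ α : ℝ, α ∈ Set.Icc (0 : ℝ) 1 →
        inducedDensity (⊥ : SimpleGraph (Fin r)) G ≥ α →
        ∀ β : ℝ, β ∈ Set.Icc (0 : ℝ) 1 →
          β ^ r + r * β ^ (r - 1) * (1 - β) = α →
          inducedDensity (⊤ : SimpleGraph (Fin s)) G ≤
            max ((1 - α ^ ((1 : ℝ) / r)) ^ s +
                  s * α ^ ((1 : ℝ) / r) * (1 - α ^ ((1 : ℝ) / r)) ^ (s - 1))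
                ((1 - β) ^ s) + ε := by
  intro ε hε
  obtain ⟨m, rfl⟩ : ∃ m, r = m + 1 + 1 := ⟨r - 2, by omega⟩
  obtain ⟨k, rfl⟩ : ∃ k, s = k + 1 + 1 := ⟨s - 2, by omega⟩
  have anti1 : AntitoneOn (fun b : ℝ => (1-b)^(k+1+1) + (k+1+1) * (1-b)^(k+1) * b) (Set.Icc 0 1) := by
    intro x hx y hy hxy
    have := (gr_strictMono k).monotoneOn (a := 1 - y) (b := 1 - x)
      ⟨by linarith [hy.2], by linarith [hy.1]⟩ ⟨by linarith [hx.2], by linarith [hx.1]⟩ (by linarith)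
    simpa using this
  have anti2 : AntitoneOn (fun b : ℝ => (1-b)^(k+1+1)) (Set.Icc 0 1) := by
    intro x hx y hy hxy
    have : 0 ≤ 1 - y := by linarith [hy.2]
    show (1-y)^(k+1+1) ≤ (1-x)^(k+1+1)
    gcongr
  have smono : StrictMonoOn (fun b : ℝ => b^(m+1+1)) (Set.Icc 0 1) := by
    intro x hx y hy hxy
    exact pow_lt_pow_left₀ hxy hx.1 (by omega)
  obtain ⟨η1, hη1, H1⟩ := compact_compare (by fun_prop) (by fun_prop) smono anti1 (half_pos hε)
  obtain ⟨η2, hη2, H2⟩ := compact_compare (by fun_prop) (by fun_prop) (gr_strictMono m) anti2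
    (half_pos hε)
  set η := min η1 η2 with hη
  have hη0 : 0 < η := lt_min hη1 hη2
  obtain ⟨N1, hN1, C1⟩ := choose_asymp (k+1+1) (half_pos hε)
  obtain ⟨N2, hN2, C2⟩ := choose_asymp (m+1+1) hη0
  refine ⟨max N1 N2, fun n hn G α hα hd β hβ hroot => ?_⟩
  obtain ⟨hk, c1⟩ := C1 n ((le_max_left _ _).trans hn)
  obtain ⟨hm, c2⟩ := C2 n ((le_max_right _ _).trans hn)
  have hn0 : 0 < n := by omega
  have hn' : (0:ℝ) < n := by exact_mod_cast hn0
  have hg := good_graph k m n hn0 hk hm G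
  obtain ⟨p0, p1⟩ := inducedDensity_mem (⊤ : SimpleGraph (Fin (k+1+1))) G
  obtain ⟨q0, q1⟩ := inducedDensity_mem (⊥ : SimpleGraph (Fin (m+1+1))) G
  generalize inducedDensity (⊤ : SimpleGraph (Fin (k+1+1))) G = p at *
  generalize inducedDensity (⊥ : SimpleGraph (Fin (m+1+1))) G = q at *
  rw [← le_div_iff₀ (by positivity)] at c1 c2
  have hP : p - ε / 2 ≤ ((k+1+1).factorial * (n.choose (k+1+1) : ℝ)) / (n:ℝ)^(k+1+1) * p := by
    have := mul_le_mul_of_nonneg_right c1 p0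
    nlinarith
  have hQ : α - η ≤ ((m+1+1).factorial * (n.choose (m+1+1) : ℝ)) / (n:ℝ)^(m+1+1) * q := by
    have := mul_le_mul_of_nonneg_right c2 q0
    nlinarith
  obtain ⟨x, y, hx, hy, hxy, h⟩ := hg.mono hP hQ
  have hx' : x = 1 - y := by linarith
  have hyI : y ∈ Set.Icc (0:ℝ) 1 := ⟨hy, by linarith⟩
  push_cast at h
  rcases h with ⟨h1, h2⟩ | ⟨h1, h2⟩
  · set c := α ^ ((1 : ℝ) / (m+1+1 : ℕ)) with hc
    have hc0 : 0 ≤ c := Real.rpow_nonneg hα.1 _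
    have hcp : c^(m+1+1) = α := by
      rw [hc, one_div]; exact Real.rpow_inv_natCast_pow hα.1 (by omega)
    have hcI : c ∈ Set.Icc (0:ℝ) 1 := ⟨hc0, Real.rpow_le_one hα.1 hα.2 (by positivity)⟩
    have := H1 y hyI c hcI (by
      rw [hcp]; have := min_le_left η1 η2; linarith)
    rw [hx'] at h1
    have hmax := le_max_left ((1 - c) ^ (k+1+1) + ((k+1+1 : ℕ):ℝ) * c * (1 - c) ^ (k+1+1 - 1))
      ((1 - β) ^ (k+1+1))
    have e : (1 - c) ^ (k+1+1) + ((k+1+1 : ℕ):ℝ) * c * (1 - c) ^ (k+1+1 - 1) =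
      (1 - c) ^ (k+1+1) + (k+1+1) * (1 - c) ^ (k+1) * c := by
      simp only [add_tsub_cancel_right]; push_cast; ring
    linarith
  · have := H2 y hyI β hβ (by
      simp only [add_tsub_cancel_right] at hroot
      push_cast at hroot
      rw [hroot]; have := min_le_right η1 η2
      rw [hx'] at h2; linarith)
    rw [hx'] at h1
    have hmax := le_max_right ((1 - α ^ ((1 : ℝ) / (m+1+1 : ℕ))) ^ (k+1+1) +
      ((k+1+1 : ℕ):ℝ) * α ^ ((1 : ℝ) / (m+1+1 : ℕ)) * (1 - α ^ ((1 : ℝ) / (m+1+1 : ℕ))) ^ (k+1+1 - 1))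
      ((1 - β) ^ (k+1+1))
    linarith
end

section
/- Let p_0, p_3 ∈ [0,1] and let β be the unique root in [0,1] of β³ + 3β²(1−β) = p_0. Then (p_0, p_3) ∈ Δ(K̄_3, K_3) if and only if p_0 + p_3 ≥ 1/4 and p_3 ≤ max{(1 − p_0^{1/3})³ + 3·p_0^{1/3}·(1 − p_0^{1/3})², (1−β)³}. -/
open Finset

open scoped Classical

/-- Membership in `Δ(K̄₃, K₃)`: there is a sequence of graphs `G_n` with `|V(G_n)| → ∞`,
`d(K̄₃;G_n) → p₀` and `d(K₃;G_n) → p₃`. -/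
def memDeltaK3 (p₀ p₃ : ℝ) : Prop :=
  ∃ (m : ℕ → ℕ) (Gs : ∀ j, SimpleGraph (Fin (m j))),
    Filter.Tendsto m Filter.atTop Filter.atTop ∧
    Filter.Tendsto (fun j => inducedDensity (⊥ : SimpleGraph (Fin 3)) (Gs j))
      Filter.atTop (nhds p₀) ∧
    Filter.Tendsto (fun j => inducedDensity (⊤ : SimpleGraph (Fin 3)) (Gs j))
      Filter.atTop (nhds p₃)


lemma alg_case1 {y z e d α β : ℝ} (hy : 0 < y) (hz : 0 ≤ z) (he : 0 ≤ e) (hd : 0 ≤ d)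
    (hα : 0 ≤ α) (hβ : 0 ≤ β)
    (h1 : e * y * (3 * y + 2 * α) = d ^ 2 * (3 * y + d + α))
    (h2 : (e + d) * (3 * y + 2 * α) ≤ y * (6 * z + 2 * β)) :
    0 ≤ (3 * z + β) * (2 * e * y - d ^ 2) + 3 * e * (e * y - d ^ 2) - d ^ 3 := by
  have hP : 0 < 3 * y + 2 * α := by positivity
  have hC : (2 * e * y - d ^ 2) * (3 * y + 2 * α) = d ^ 2 * (3 * y + 2 * d) := by linarith
  have hC0 : 0 ≤ 2 * e * y - d ^ 2 := by
    by_contra hneg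
    push Not at hneg
    have := mul_neg_of_neg_of_pos hneg hP
    have : 0 ≤ d ^ 2 * (3 * y + 2 * d) := by positivity
    linarith
  have h3 := mul_le_mul_of_nonneg_right h2 hC0
  have h4 : (e + d) * (3 * y + 2 * α) * (2 * e * y - d ^ 2)
      = (e + d) * (d ^ 2 * (3 * y + 2 * d)) := by rw [← hC]; ring
  rw [h4] at h3
  have h5 : 0 ≤ 2 * y * ((3 * z + β) * (2 * e * y - d ^ 2) + 3 * e * (e * y - d ^ 2) - d ^ 3) := by
    have hA : 0 ≤ e * d ^ 3 := by positivity
    have hB : 0 ≤ d ^ 3 * y := by positivity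
    nlinarith [sq_nonneg (4 * (e * y) - d ^ 2), sq_nonneg (e * y), sq_nonneg (d ^ 2)]
  exact nonneg_of_mul_nonneg_right h5 (by positivity) 

lemma alg_case2 {x z w d α β : ℝ} (hx : 0 ≤ x) (hz : 0 ≤ z) (hw : 0 ≤ w) (hd : 0 ≤ d)
    (hy : 0 < w + d) (hα : 0 ≤ α) (hβ : 0 ≤ β)
    (h1 : z * w * (3 * w + 2 * α)
      = d * (3 * w * d + d ^ 2 + 6 * w * x + 3 * d * x + α * (d + 2 * x)))
    (h2 : (w + d) * (6 * z + 2 * β) ≤ x * (3 * (w + d) + 2 * α)) :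
    0 ≤ 3 * (x + z) ^ 2 * d + 3 * (x + z) * d ^ 2 + d ^ 3 - 3 * z ^ 2 * (w + d)
      + β * (2 * x * d + d ^ 2 - 2 * z * w) := by
  set C := 2 * z * w - 2 * x * d - d ^ 2 with hCdef
  have hC : C * (3 * w + 2 * α) = d * (6 * x * w + 3 * d * w + 2 * d ^ 2 + 6 * d * x) := by
    rw [hCdef]; linarith
  have hC0 : 0 ≤ C ∨ (w = 0 ∧ α = 0) := by
    by_contra! hneg
    have hP : 0 < 3 * w + 2 * α := by
      rcases hw.eq_or_lt with h | h
      · have := hneg.2 h.symm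
        have : 0 < α := lt_of_le_of_ne hα (Ne.symm this)
        positivity
      · positivity
    have := mul_neg_of_neg_of_pos hneg.1 hP
    have : 0 ≤ d * (6 * x * w + 3 * d * w + 2 * d ^ 2 + 6 * d * x) := by positivity
    linarith
  rcases hC0 with hC0 | ⟨rfl, rfl⟩
  · have h3 := mul_le_mul_of_nonneg_right h2 hC0
    have h5 : 0 ≤ 2 * (w + d) * (3 * (x + z) ^ 2 * d + 3 * (x + z) * d ^ 2 + d ^ 3
        - 3 * z ^ 2 * (w + d) + β * (2 * x * d + d ^ 2 - 2 * z * w)) := by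
      have e1 : x * (3 * (w + d) + 2 * α) * C
        = x * (d * (6 * x * w + 3 * d * w + 2 * d ^ 2 + 6 * d * x)) + 3 * d * x * C := by
        rw [← hC]; ring
      rw [e1] at h3
      have key : 2 * (w + d) * (3 * (x + z) ^ 2 * d + 3 * (x + z) * d ^ 2 + d ^ 3
        - 3 * z ^ 2 * (w + d) + β * (2 * x * d + d ^ 2 - 2 * z * w))
        = (x * (d * (6 * x * w + 3 * d * w + 2 * d ^ 2 + 6 * d * x)) + 3 * d * x * C
            - (w + d) * (6 * z + 2 * β) * C)
          + (w + d) * (3 * x * d ^ 2 + 2 * d ^ 3) + 6 * z ^ 2 * w * (w + d)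
          + 4 * x * d ^ 3 - 6 * x * d * z * w + 6 * x ^ 2 * d ^ 2 := by
        rw [hCdef]; ring
      rw [key]
      have q : 0 ≤ 6 * (z * w) ^ 2 - 6 * (x * d) * (z * w) + 6 * (x * d) ^ 2 := by
        nlinarith [sq_nonneg (z * w - x * d), sq_nonneg (z * w), sq_nonneg (x * d)]
      have q2 : 0 ≤ (w + d) * (3 * x * d ^ 2 + 2 * d ^ 3) := by positivity
      have q3 : 0 ≤ 6 * z ^ 2 * w * d := by positivity
      have q4 : 0 ≤ x * d ^ 3 := by positivity
      nlinarith
    exact nonneg_of_mul_nonneg_right h5 (by positivity) 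
  · exfalso
    simp at h1 hy
    have : 0 < d ^ 2 := by positivity
    rcases h1 with h1 | h1
    · linarith
    · nlinarith [mul_nonneg hd hx]

/-- three blocks (independent `x`, dominating `y`, isolated `z`) are dominated by two blocks. -/
lemma three_block {x y z α β : ℝ} (hx : 0 ≤ x) (hy : 0 ≤ y) (hz : 0 ≤ z)
    (hα : 0 ≤ α) (hβ : 0 ≤ β) :
    ∃ x' y' : ℝ, 0 ≤ x' ∧ 0 ≤ y' ∧ x' + y' = x + y + z ∧
      ((y ^ 3 + 3 * y ^ 2 * x + α * (y ^ 2 + 2 * x * y)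
          ≤ y' ^ 3 + 3 * y' ^ 2 * x' + α * (y' ^ 2 + 2 * x' * y') ∧
        (x + z) ^ 3 + 3 * z ^ 2 * y + β * ((x + z) ^ 2 + 2 * z * y) ≤ x' ^ 3 + β * x' ^ 2) ∨
       (y ^ 3 + 3 * y ^ 2 * x + α * (y ^ 2 + 2 * x * y) ≤ x' ^ 3 + α * x' ^ 2 ∧
        (x + z) ^ 3 + 3 * z ^ 2 * y + β * ((x + z) ^ 2 + 2 * z * y)
          ≤ y' ^ 3 + 3 * y' ^ 2 * x' + β * (y' ^ 2 + 2 * x' * y'))) := by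
  rcases hy.eq_or_lt with rfl | hy
  · exact ⟨x + z, 0, by positivity, le_rfl, by ring, Or.inl ⟨by simp, by simp⟩⟩
  rcases le_total (x * (3 * y + 2 * α)) (y * (6 * z + 2 * β)) with hc | hc
  · -- case 1
    have hcont : ContinuousOn (fun d : ℝ => (y + d) ^ 3 + α * (y + d) ^ 2) (Set.Icc 0 x) := by
      fun_prop
    have := intermediate_value_Icc hx hcont
    obtain ⟨d, ⟨hd0, hdx⟩, hd⟩ := this (show y ^ 3 + 3 * y ^ 2 * x + α * (y ^ 2 + 2 * x * y) ∈ _ by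
      constructor
      · have : 0 ≤ y ^ 2 * x := by positivity
        have : 0 ≤ α * (x * y) := by positivity
        nlinarith
      · have : 0 ≤ y * x ^ 2 := by positivity
        have : 0 ≤ x ^ 3 := by positivity
        have : 0 ≤ α * (x ^ 2) := by positivity
        nlinarith)
    simp only at hd
    refine ⟨y + d, x + z - d, by positivity, by linarith, by ring, Or.inr ⟨hd.ge, ?_⟩⟩
    have := alg_case1 (y := y) (z := z) (e := x - d) (d := d) (α := α) (β := β) hy hz
      (by linarith) hd0 hα hβ (by linarith) (by simpa using hc)
    linarith
  · have hcont : ContinuousOn (fun d : ℝ => (y - d) ^ 3 + 3 * (y - d) ^ 2 * (x + z + d)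
        + α * ((y - d) ^ 2 + 2 * (x + z + d) * (y - d))) (Set.Icc 0 y) := by
      fun_prop
    have := intermediate_value_Icc' hy.le hcont
    obtain ⟨d, ⟨hd0, hdx⟩, hd⟩ := this (show y ^ 3 + 3 * y ^ 2 * x + α * (y ^ 2 + 2 * x * y) ∈ _ by
      constructor
      · simp; positivity
      · have : 0 ≤ y ^ 2 * z := by positivity
        have : 0 ≤ α * (z * y) := by positivity
        nlinarith)
    simp only at hd
    refine ⟨x + z + d, y - d, by positivity, by linarith, by ring, Or.inl ⟨hd.ge, ?_⟩⟩
    have := alg_case2 (x := x) (z := z) (w := y - d) (d := d) (α := α) (β := β) hx hz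
      (by linarith) hd0 (by linarith) hα hβ (by linarith) (by simpa using hc)
    linarith

noncomputable def hh (s : ℝ) : ℝ := (1 - s) ^ 2 * (1 + 2 * s)

lemma hh_anti {s t : ℝ} (hs : 0 ≤ s) (hst : s ≤ t) (ht : t ≤ 1) : hh t ≤ hh s := by
  unfold hh
  have h1 : 0 ≤ t - s := by linarith
  have h2 : hh s - hh t = (t - s) * (3 * (s + t) - 2 * (s ^ 2 + s * t + t ^ 2)) := by unfold hh; ring
  have h3 : 0 ≤ 3 * (s + t) - 2 * (s ^ 2 + s * t + t ^ 2) := by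
    nlinarith [mul_nonneg hs (by linarith : 0 ≤ 1 - s), mul_nonneg (hs.trans hst) (by linarith : 0 ≤ 1 - t), mul_nonneg hs (by linarith : 0 ≤ 1 - t), mul_nonneg (by linarith : 0 ≤ 1 - s) (hs.trans hst)]
  have := mul_nonneg h1 h3
  unfold hh at h2; linarith

lemma hh_anti_strict {s t : ℝ} (hs : 0 ≤ s) (hst : s < t) (ht : t ≤ 1) : hh t < hh s := by
  unfold hh
  have h1 : 0 < t - s := by linarith
  have h2 : hh s - hh t = (t - s) * (3 * (s + t) - 2 * (s ^ 2 + s * t + t ^ 2)) := by unfold hh; ring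
  have h3 : 0 < 3 * (s + t) - 2 * (s ^ 2 + s * t + t ^ 2) := by
    nlinarith [mul_nonneg hs (by linarith : 0 ≤ 1 - s), mul_nonneg (hs.trans hst.le) (by linarith : 0 ≤ 1 - t), mul_nonneg hs (by linarith : 0 ≤ 1 - t), mul_pos (by linarith : 0 < 1 - s) (hs.trans_lt hst)]
  have := mul_pos h1 h3
  unfold hh at h2; linarith

lemma exists_params {p₀ p₃ t : ℝ} (h0 : 0 ≤ p₀) (h3 : 0 ≤ p₃) (ht0 : 0 ≤ t) (ht1 : t ≤ 1)
    (ht : t ^ 3 = p₀) (hG : 1 / 4 ≤ p₀ + p₃) (hA : p₃ ≤ hh t) :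
    ∃ s μ : ℝ, 0 ≤ s ∧ s ≤ 1 ∧ 0 ≤ μ ∧ μ ≤ 1 ∧
      p₀ = (s ^ 3 * (1 + 3 * μ) + 3 * s ^ 2 * (1 - s) * (1 - μ)) / 4 ∧
      p₃ = (1 + 3 * μ) / 4 * hh s := by
  have hh0 : hh 0 = 1 := by norm_num [hh]
  have hh1 : hh 1 = 0 := by norm_num [hh]
  have hcont : Continuous hh := by unfold hh; fun_prop
  have hp31 : p₃ ≤ 1 := by
    have := hh_anti le_rfl ht0 ht1
    linarith
  have hp01 : p₀ ≤ 1 := by rw [← ht]; exact pow_le_one₀ ht0 ht1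
  rcases h3.eq_or_lt with rfl | hp
  · refine ⟨1, (4 * p₀ - 1) / 3, by norm_num, le_rfl, by linarith, by linarith, by ring, ?_⟩
    rw [hh1]; simp
  obtain ⟨s1, ⟨hs10, hs11⟩, hs1⟩ := intermediate_value_Icc' (zero_le_one' ℝ) hcont.continuousOn
    (show p₃ ∈ _ by rw [hh0, hh1]; exact ⟨h3, hp31⟩)
  have hts : t ≤ s1 := by
    by_contra hlt
    push Not at hlt
    have := hh_anti_strict hs10 hlt ht1
    linarith
  have hs0 : ∃ s0, 0 ≤ s0 ∧ s0 ≤ s1 ∧ hh s0 ≤ 4 * p₃ ∧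
      s0 ^ 3 * (p₃ / hh s0) + s0 ^ 2 * (1 - s0) * (1 - p₃ / hh s0) ≤ p₀ := by
    rcases le_total (4 * p₃) 1 with h4 | h4
    · obtain ⟨s0, ⟨ha, hb⟩, hs0⟩ := intermediate_value_Icc' hs10 hcont.continuousOn
        (show 4 * p₃ ∈ _ by rw [hh0, hs1]; exact ⟨by linarith, h4⟩)
      refine ⟨s0, ha, hb, hs0.le, ?_⟩
      have e : p₃ / hh s0 = 1 / 4 := by rw [hs0]; field_simp
      rw [e]
      unfold hh at hs0
      nlinarith
    · exact ⟨0, le_rfl, hs10, by rw [hh0]; linarith, by simpa using h0⟩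
  obtain ⟨s0, ha, hb, h4, hle⟩ := hs0
  have hpos : ∀ s ∈ Set.Icc s0 s1, p₃ ≤ hh s := fun s hs => by
    rw [← hs1]; exact hh_anti (ha.trans hs.1) hs.2 hs11
  have hc : ContinuousOn (fun s => s ^ 3 * (p₃ / hh s) + s ^ 2 * (1 - s) * (1 - p₃ / hh s))
      (Set.Icc s0 s1) := by
    have : ContinuousOn (fun s => p₃ / hh s) (Set.Icc s0 s1) :=
      continuousOn_const.div hcont.continuousOn (fun s hs => by have := hpos s hs; linarith)
    fun_prop
  obtain ⟨s, hs, hse⟩ := intermediate_value_Icc hb hc (show p₀ ∈ _ by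
    refine ⟨hle, ?_⟩
    have : p₃ / hh s1 = 1 := by rw [hs1]; field_simp
    simp only [this]
    have := pow_le_pow_left₀ ht0 hts 3
    linarith)
  simp only at hse
  have hps := hpos s hs
  have hp' : 0 < hh s := by linarith
  have hs4 : hh s ≤ 4 * p₃ := (hh_anti ha hs.1 (hs.2.trans hs11)).trans h4
  refine ⟨s, (4 * (p₃ / hh s) - 1) / 3, ha.trans hs.1, hs.2.trans hs11, ?_, ?_, ?_, ?_⟩
  · have : 1 / 4 ≤ p₃ / hh s := by rw [div_le_div_iff₀ (by norm_num) hp']; linarith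
    linarith
  · have : p₃ / hh s ≤ 1 := by rw [div_le_one hp']; exact hps
    linarith
  · rw [← hse]; ring
  · field_simp; ring

noncomputable def k2 {n : ℕ} (G : SimpleGraph (Fin n)) : ℝ :=
  ∑ x, ∑ y, if G.Adj x y then 1 else 0

noncomputable def k3 {n : ℕ} (G : SimpleGraph (Fin n)) : ℝ :=
  ∑ x, ∑ y, ∑ z, if G.Adj x y ∧ G.Adj y z ∧ G.Adj x z then 1 else 0

/-- shift adjacency from `u` to `v` -/
def shiftG {n : ℕ} (G : SimpleGraph (Fin n)) (u v : Fin n) : SimpleGraph (Fin n) where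
  Adj x y := x ≠ y ∧
    if x = u then (if y = v then G.Adj u v else G.Adj u y ∧ G.Adj v y)
    else if x = v then (if y = u then G.Adj u v else G.Adj u y ∨ G.Adj v y)
    else if y = u then G.Adj u x ∧ G.Adj v x
    else if y = v then G.Adj u x ∨ G.Adj v x
    else G.Adj x y
  symm := ⟨by
    intro x y ⟨h, h'⟩
    refine ⟨h.symm, ?_⟩
    have := G.adj_comm x y
    split_ifs at h' ⊢ <;> simp_all⟩
  loopless := ⟨by intro x h; exact h.1 rfl⟩

lemma shiftG_compl {n : ℕ} (G : SimpleGraph (Fin n)) {u v : Fin n} (huv : u ≠ v) :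
    (shiftG G u v)ᶜ = shiftG Gᶜ v u := by
  ext x y
  simp only [SimpleGraph.compl_adj, shiftG]
  have := G.adj_comm u v
  split_ifs <;> (try subst_vars) <;> (try simp_all) <;> tauto

lemma k3_shift {n : ℕ} (G : SimpleGraph (Fin n)) {u v : Fin n} (huv : u ≠ v) :
    k3 G ≤ k3 (shiftG G u v) := by
  have hsw : ∀ G : SimpleGraph (Fin n), k3 G = ∑ x, ∑ y, ∑ z,
      if G.Adj (Equiv.swap u v x) (Equiv.swap u v y) ∧ G.Adj (Equiv.swap u v y) (Equiv.swap u v z)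
        ∧ G.Adj (Equiv.swap u v x) (Equiv.swap u v z) then 1 else 0 := by
    intro G
    unfold k3
    rw [← Equiv.sum_comp (Equiv.swap u v)]
    refine sum_congr rfl fun x _ => ?_
    rw [← Equiv.sum_comp (Equiv.swap u v)]
    refine sum_congr rfl fun y _ => ?_
    rw [← Equiv.sum_comp (Equiv.swap u v)]
  have h2 : k3 G + k3 G ≤ k3 (shiftG G u v) + k3 (shiftG G u v) := by
    nth_rewrite 2 [hsw G]
    nth_rewrite 2 [hsw (shiftG G u v)]
    unfold k3
    simp only [← sum_add_distrib]
    refine sum_le_sum fun x _ => sum_le_sum fun y _ => sum_le_sum fun z _ => ?_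
    have hc : ∀ a b, G.Adj a b ↔ G.Adj b a := fun a b => G.adj_comm a b
    have hi : ∀ a, ¬ G.Adj a a := fun a => G.loopless.irrefl a
    have sx : ∀ x, x ≠ u → x ≠ v → Equiv.swap u v x = x := fun x => Equiv.swap_apply_of_ne_of_ne
    have key : ∀ x : Fin n, (x = u ∧ Equiv.swap u v x = v) ∨ (x = v ∧ Equiv.swap u v x = u) ∨
       (x ≠ u ∧ x ≠ v ∧ Equiv.swap u v x = x) := by
      intro x
      by_cases h1 : x = u
      · left; subst h1; simp
      by_cases h2 : x = v
      · right; left; subst h2; simp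
      right; right; exact ⟨h1, h2, sx x h1 h2⟩
    have huv' := huv.symm
    rcases key x with ⟨rfl, hx⟩ | ⟨rfl, hx⟩ | ⟨hx1, hx2, hx⟩ <;>
    rcases key y with ⟨hy1, hy⟩ | ⟨hy1, hy⟩ | ⟨hy1, hy2, hy⟩ <;>
    rcases key z with ⟨hz1, hz⟩ | ⟨hz1, hz⟩ | ⟨hz1, hz2, hz⟩ <;>
    (try subst hy1) <;> (try subst hz1) <;> simp only [hx, hy, hz] <;>
    (try have hx1' := Ne.symm hx1) <;> (try have hx2' := Ne.symm hx2) <;>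
    (try have hy1' := Ne.symm hy1) <;> (try have hy2' := Ne.symm hy2) <;>
    (try have hz1' := Ne.symm hz1) <;> (try have hz2' := Ne.symm hz2) <;>
    simp [shiftG, *] <;> grind
  linarith

lemma k2_shift {n : ℕ} (G : SimpleGraph (Fin n)) {u v : Fin n} (huv : u ≠ v) :
    k2 G ≤ k2 (shiftG G u v) := by
  have hsw : ∀ G : SimpleGraph (Fin n), k2 G = ∑ x, ∑ y,
      if G.Adj (Equiv.swap u v x) (Equiv.swap u v y) then 1 else 0 := by
    intro G
    unfold k2
    rw [← Equiv.sum_comp (Equiv.swap u v)]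
    refine sum_congr rfl fun x _ => ?_
    rw [← Equiv.sum_comp (Equiv.swap u v)]
  have h2 : k2 G + k2 G ≤ k2 (shiftG G u v) + k2 (shiftG G u v) := by
    nth_rewrite 2 [hsw G]
    nth_rewrite 2 [hsw (shiftG G u v)]
    unfold k2
    simp only [← sum_add_distrib]
    refine sum_le_sum fun x _ => sum_le_sum fun y _ => ?_
    have hc : ∀ a b, G.Adj a b ↔ G.Adj b a := fun a b => G.adj_comm a b
    have hi : ∀ a, ¬ G.Adj a a := fun a => G.loopless.irrefl a
    have sx : ∀ x, x ≠ u → x ≠ v → Equiv.swap u v x = x := fun x => Equiv.swap_apply_of_ne_of_ne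
    have key : ∀ x : Fin n, (x = u ∧ Equiv.swap u v x = v) ∨ (x = v ∧ Equiv.swap u v x = u) ∨
       (x ≠ u ∧ x ≠ v ∧ Equiv.swap u v x = x) := by
      intro x
      by_cases h1 : x = u
      · left; subst h1; simp
      by_cases h2 : x = v
      · right; left; subst h2; simp
      right; right; exact ⟨h1, h2, sx x h1 h2⟩
    have huv' := huv.symm
    rcases key x with ⟨rfl, hx⟩ | ⟨rfl, hx⟩ | ⟨hx1, hx2, hx⟩ <;>
    rcases key y with ⟨hy1, hy⟩ | ⟨hy1, hy⟩ | ⟨hy1, hy2, hy⟩ <;>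
    (try subst hy1) <;> simp only [hx, hy] <;>
    (try have hx1' := Ne.symm hx1) <;> (try have hx2' := Ne.symm hx2) <;>
    (try have hy1' := Ne.symm hy1) <;> (try have hy2' := Ne.symm hy2) <;>
    simp [shiftG, *] <;> grind
  linarith

/-- `H` is at least as good as `G` in all four counts. -/
def Better {n : ℕ} (G H : SimpleGraph (Fin n)) : Prop :=
  k2 G ≤ k2 H ∧ k3 G ≤ k3 H ∧ k2 Gᶜ ≤ k2 Hᶜ ∧ k3 Gᶜ ≤ k3 Hᶜ

lemma better_shift {n : ℕ} (G : SimpleGraph (Fin n)) {u v : Fin n} (huv : u ≠ v) :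
    Better G (shiftG G u v) := by
  refine ⟨k2_shift G huv, k3_shift G huv, ?_, ?_⟩
  · rw [shiftG_compl G huv]; exact k2_shift _ huv.symm
  · rw [shiftG_compl G huv]; exact k3_shift _ huv.symm

lemma exists_better {n : ℕ} (G : SimpleGraph (Fin (n + 1))) :
    ∃ H, Better G H ∧ ∃ w, (∀ x, x ≠ w → H.Adj w x) ∨ (∀ x, ¬ H.Adj w x) := by
  let v : Fin (n + 1) := 0
  obtain ⟨H, hH, hmax⟩ := Set.exists_max_image {H | Better G H}
    (fun H => (univ.filter (fun x => H.Adj v x)).card) (Set.toFinite _)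
    ⟨G, le_rfl, le_rfl, le_rfl, le_rfl⟩
  refine ⟨H, hH, ?_⟩
  have hsub : ∀ u w, u ≠ v → w ≠ v → H.Adj u w → H.Adj v w := by
    intro u w hu hw huw
    by_contra hvw
    have hb := better_shift H hu
    have hb' : Better G (shiftG H u v) :=
      ⟨hH.1.trans hb.1, hH.2.1.trans hb.2.1, hH.2.2.1.trans hb.2.2.1, hH.2.2.2.trans hb.2.2.2⟩
    have := hmax _ hb'
    refine absurd this (not_le.2 (card_lt_card ?_))
    have hwu : w ≠ u := huw.ne'
    rw [Finset.ssubset_iff_of_subset]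
    · refine ⟨w, ?_, by simpa using hvw⟩
      simp [shiftG, hu.symm, hw.symm, hwu, huw]
    · intro x
      simp only [mem_filter, mem_univ, true_and]
      intro hx
      have := hx.ne
      by_cases hxu : x = u
      · subst hxu; simp [shiftG, this, hu.symm, hx.symm]
      · simp [shiftG, this, hu.symm, hxu, hx]
  by_cases hd : ∀ x, x ≠ v → H.Adj v x
  · exact ⟨v, Or.inl hd⟩
  · push Not at hd
    obtain ⟨w, hwv, hw⟩ := hd
    refine ⟨w, Or.inr fun x hx => ?_⟩
    by_cases hxv : x = v
    · subst hxv; exact hw hx.symm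
    · exact hw (hsub x w hxv hwv hx.symm)

lemma k2_dom {n : ℕ} (H : SimpleGraph (Fin (n + 1))) (w : Fin (n + 1))
    (hw : ∀ x, x ≠ w → H.Adj w x) : k2 H = k2 (H.comap w.succAbove) + 2 * n := by
  have h1 : ∀ i, H.Adj w (w.succAbove i) := fun i => hw _ (Fin.succAbove_ne w i)
  have h2 : ∀ i, H.Adj (w.succAbove i) w := fun i => (h1 i).symm
  simp only [k2, Fin.sum_univ_succAbove _ w, SimpleGraph.comap_adj, h1, h2]
  simp [sum_add_distrib]; ring

lemma k2_iso {n : ℕ} (H : SimpleGraph (Fin (n + 1))) (w : Fin (n + 1))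
    (hw : ∀ x, ¬ H.Adj w x) : k2 H = k2 (H.comap w.succAbove) := by
  have h2 : ∀ i, ¬ H.Adj i w := fun i h => hw i h.symm
  simp only [k2, Fin.sum_univ_succAbove _ w, SimpleGraph.comap_adj, hw, h2]
  simp 

lemma k3_dom {n : ℕ} (H : SimpleGraph (Fin (n + 1))) (w : Fin (n + 1))
    (hw : ∀ x, x ≠ w → H.Adj w x) :
    k3 H = k3 (H.comap w.succAbove) + 3 * k2 (H.comap w.succAbove) := by
  have h1 : ∀ i, H.Adj w (w.succAbove i) := fun i => hw _ (Fin.succAbove_ne w i)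
  have h2 : ∀ i, H.Adj (w.succAbove i) w := fun i => (h1 i).symm
  simp only [k2, k3, Fin.sum_univ_succAbove _ w, SimpleGraph.comap_adj, h1, h2]
  simp [sum_add_distrib]; ring

lemma k3_iso {n : ℕ} (H : SimpleGraph (Fin (n + 1))) (w : Fin (n + 1))
    (hw : ∀ x, ¬ H.Adj w x) : k3 H = k3 (H.comap w.succAbove) := by
  have h2 : ∀ i, ¬ H.Adj i w := fun i h => hw i h.symm
  simp only [k3, Fin.sum_univ_succAbove _ w, SimpleGraph.comap_adj, hw, h2]
  simp 

lemma comap_compl {n : ℕ} (H : SimpleGraph (Fin (n + 1))) (w : Fin (n + 1)) :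
    (H.comap w.succAbove)ᶜ = Hᶜ.comap w.succAbove := by
  ext x y
  simp

/-- the weighted two-block domination property -/
def TwoBlock (X a2 a3 b2 b3 : ℝ) : Prop :=
  ∀ α β : ℝ, 0 ≤ α → 0 ≤ β → ∃ x y : ℝ, 0 ≤ x ∧ 0 ≤ y ∧ x + y = X ∧
    ((a3 + α * a2 ≤ y ^ 3 + 3 * y ^ 2 * x + α * (y ^ 2 + 2 * x * y) ∧
        b3 + β * b2 ≤ x ^ 3 + β * x ^ 2) ∨
     (a3 + α * a2 ≤ x ^ 3 + α * x ^ 2 ∧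
        b3 + β * b2 ≤ y ^ 3 + 3 * y ^ 2 * x + β * (y ^ 2 + 2 * x * y)))

lemma TwoBlock.swap {X a2 a3 b2 b3 : ℝ} (h : TwoBlock X a2 a3 b2 b3) :
    TwoBlock X b2 b3 a2 a3 := by
  intro α β hα hβ
  obtain ⟨x, y, hx, hy, hxy, h⟩ := h β α hβ hα
  exact ⟨x, y, hx, hy, hxy, by tauto⟩

lemma TwoBlock.mono {X a2 a3 b2 b3 a2' a3' b2' b3' : ℝ} (h : TwoBlock X a2 a3 b2 b3)
    (h1 : a2' ≤ a2) (h2 : a3' ≤ a3) (h3 : b2' ≤ b2) (h4 : b3' ≤ b3) :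
    TwoBlock X a2' a3' b2' b3' := by
  intro α β hα hβ
  obtain ⟨x, y, hx, hy, hxy, h⟩ := h α β hα hβ
  have e1 := mul_le_mul_of_nonneg_left h1 hα
  have e2 := mul_le_mul_of_nonneg_left h3 hβ
  refine ⟨x, y, hx, hy, hxy, ?_⟩
  rcases h with ⟨p, q⟩ | ⟨p, q⟩
  · left; constructor <;> linarith
  · right; constructor <;> linarith

/-- adding an isolated vertex -/
lemma TwoBlock.step {X a2 a3 b2 b3 : ℝ} (h : TwoBlock X a2 a3 b2 b3) :
    TwoBlock (X + 1) a2 a3 (b2 + 2 * X) (b3 + 3 * b2) := by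
  intro α β hα hβ
  obtain ⟨x, y, hx, hy, rfl, h'⟩ := h α (β + 3) hα (by linarith)
  rcases h' with ⟨p, q⟩ | ⟨p, q⟩
  · obtain ⟨x', y', hx', hy', hxy', h'⟩ := three_block hx hy zero_le_one hα hβ
    refine ⟨x', y', hx', hy', hxy', ?_⟩
    have : b3 + 3 * b2 + β * (b2 + 2 * (x + y)) ≤
      (x + 1) ^ 3 + 3 * 1 ^ 2 * y + β * ((x + 1) ^ 2 + 2 * 1 * y) := by nlinarith
    rcases h' with ⟨p', q'⟩ | ⟨p', q'⟩
    · left; constructor <;> linarith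
    · right; constructor <;> linarith
  · refine ⟨x, y + 1, hx, by linarith, by ring, Or.inr ⟨p, ?_⟩⟩
    nlinarith

lemma twoBlock_graph : ∀ (n : ℕ) (G : SimpleGraph (Fin n)),
    TwoBlock n (k2 G) (k3 G) (k2 Gᶜ) (k3 Gᶜ) := by
  intro n
  induction n with
  | zero =>
    intro G α β hα hβ
    refine ⟨0, 0, le_rfl, le_rfl, by simp, Or.inl ?_⟩
    simp [k2, k3]
  | succ n ih =>
    intro G
    obtain ⟨H, hb, w, hw⟩ := exists_better G
    suffices h : TwoBlock (n + 1 : ℕ) (k2 H) (k3 H) (k2 Hᶜ) (k3 Hᶜ) from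
      h.mono hb.1 hb.2.1 hb.2.2.1 hb.2.2.2
    have := ih (H.comap w.succAbove)
    rw [comap_compl] at this
    push_cast
    rcases hw with hw | hw
    · have hw' : ∀ x, ¬ Hᶜ.Adj w x := by
        intro x hx
        rw [SimpleGraph.compl_adj] at hx
        exact hx.2 (hw x hx.1.symm)
      rw [k2_dom H w hw, k3_dom H w hw, k2_iso _ w hw', k3_iso _ w hw']
      exact this.swap.step.swap
    · have hw' : ∀ x, x ≠ w → Hᶜ.Adj w x := by
        intro x hx
        rw [SimpleGraph.compl_adj]
        exact ⟨hx.symm, hw x⟩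
      rw [k2_iso H w hw, k3_iso H w hw, k2_dom _ w hw', k3_dom _ w hw']
      exact this.step

lemma upper_graph (n : ℕ) (G : SimpleGraph (Fin n)) :
    ∃ x y : ℝ, 0 ≤ x ∧ 0 ≤ y ∧ x + y = n ∧
      ((k3 G ≤ y ^ 3 + 3 * y ^ 2 * x ∧ k3 Gᶜ ≤ x ^ 3) ∨
       (k3 G ≤ x ^ 3 ∧ k3 Gᶜ ≤ y ^ 3 + 3 * y ^ 2 * x)) := by
  obtain ⟨x, y, hx, hy, hxy, h⟩ := twoBlock_graph n G 0 0 le_rfl le_rfl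
  exact ⟨x, y, hx, hy, hxy, by simpa using h⟩

lemma k3_nonneg {n : ℕ} (G : SimpleGraph (Fin n)) : 0 ≤ k3 G :=
  sum_nonneg fun _ _ => sum_nonneg fun _ _ => sum_nonneg fun _ _ => by split_ifs <;> norm_num

/-- Goodman -/
lemma goodman (n : ℕ) (G : SimpleGraph (Fin n)) :
    (n : ℝ) ^ 3 / 4 - 3 * n ^ 2 ≤ k3 G + k3 Gᶜ := by
  let a : Fin n → Fin n → ℝ := fun x y => if G.Adj x y then 1 else 0
  let d : Fin n → ℝ := fun x => ∑ y, a x y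
  have hsymm : ∀ x y, a x y = a y x := fun x y => by simp only [a, G.adj_comm]
  have hpt : ∀ x y z, 1 - a x y - a y z - a x z + a x y * a y z + a y z * a x z + a x y * a x z
      - ((if x = y then 1 else 0) + (if y = z then 1 else 0) + (if x = z then 1 else 0)) ≤
      (if G.Adj x y ∧ G.Adj y z ∧ G.Adj x z then 1 else 0)
      + (if Gᶜ.Adj x y ∧ Gᶜ.Adj y z ∧ Gᶜ.Adj x z then (1 : ℝ) else 0) := by
    intro x y z
    simp only [a, SimpleGraph.compl_adj]
    by_cases e3 : x = z
    · subst e3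
      have hyx : G.Adj y x ↔ G.Adj x y := G.adj_comm y x
      simp only [hyx]
      by_cases e1 : x = y
      · subst e1; simp
      · by_cases h1 : G.Adj x y <;> simp [h1, e1, Ne.symm e1] <;> norm_num
    · by_cases h1 : G.Adj x y <;> by_cases h2 : G.Adj y z <;> by_cases h3 : G.Adj x z <;>
      by_cases e1 : x = y <;> by_cases e2 : y = z <;>
      simp [h1, h2, h3, e1, e2, e3] <;> norm_num
  have hsum := sum_le_sum fun x (_ : x ∈ (univ : Finset (Fin n))) =>
    sum_le_sum fun y (_ : y ∈ (univ : Finset (Fin n))) =>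
    sum_le_sum fun z (_ : z ∈ (univ : Finset (Fin n))) => hpt x y z
  have hR : (∑ x, ∑ y, ∑ z, ((if G.Adj x y ∧ G.Adj y z ∧ G.Adj x z then 1 else 0)
      + (if Gᶜ.Adj x y ∧ Gᶜ.Adj y z ∧ Gᶜ.Adj x z then (1 : ℝ) else 0))) = k3 G + k3 Gᶜ := by
    simp only [sum_add_distrib, k3]
    congr!
  rw [hR] at hsum
  refine le_trans ?_ hsum
  have t1 : ∑ x, ∑ y, ∑ z : Fin n, a x y = n * ∑ x, d x := by
    simp [d, mul_sum]
  have t2 : ∑ x : Fin n, ∑ y, ∑ z, a y z = n * ∑ x, d x := by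
    simp [d]
  have t3 : ∑ x, ∑ y : Fin n, ∑ z, a x z = n * ∑ x, d x := by
    simp [d, mul_sum]
  have t4 : ∑ x, ∑ y, ∑ z, a x y * a x z = ∑ x, d x ^ 2 := by
    refine sum_congr rfl fun x _ => ?_
    simp only [d, sq, sum_mul_sum]
  have t5 : ∑ x, ∑ y, ∑ z, a x y * a y z = ∑ x, d x ^ 2 := by
    rw [sum_comm]
    refine sum_congr rfl fun y _ => ?_
    simp only [d, sq, sum_mul_sum]
    simp only [hsymm _ y]
  have t6 : ∑ x, ∑ y, ∑ z, a y z * a x z = ∑ x, d x ^ 2 := by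
    calc _ = ∑ x, ∑ z, ∑ y, a y z * a x z := sum_congr rfl fun x _ => sum_comm
      _ = ∑ z, ∑ x, ∑ y, a y z * a x z := sum_comm
      _ = _ := by
        refine sum_congr rfl fun z _ => ?_
        simp only [d, sq, sum_mul_sum]
        simp only [hsymm _ z, mul_comm]
  have t7 : ∑ x : Fin n, ∑ y : Fin n, ∑ z : Fin n, ((if x = y then (1 : ℝ) else 0) + (if y = z then 1 else 0)
      + (if x = z then 1 else 0)) = 3 * n ^ 2 := by
    simp [sum_add_distrib]; ring
  have t0 : ∑ x : Fin n, ∑ y : Fin n, ∑ z : Fin n, (1 : ℝ) = n ^ 3 := by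
    simp; ring
  simp only [sum_add_distrib, sum_sub_distrib] at t7 ⊢
  rw [t0, t1, t2, t3, t4, t5, t6]
  have q : 0 ≤ ∑ x, (d x - n / 2) ^ 2 := sum_nonneg fun _ _ => sq_nonneg _
  have q' : ∑ x, (d x - n / 2) ^ 2 = ∑ x, d x ^ 2 - n * ∑ x, d x + n ^ 3 / 4 := by
    simp only [sub_sq, sum_add_distrib, sum_sub_distrib, mul_sum]
    simp
    have : ∑ x, 2 * d x * (n / 2) = ∑ x, n * d x := sum_congr rfl fun x _ => by ring
    rw [this]; ring
  rw [q'] at q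
  linarith


def TT {n : ℕ} (G : SimpleGraph (Fin n)) (t : Fin n × Fin n × Fin n) : Prop :=
  G.Adj t.1 t.2.1 ∧ G.Adj t.2.1 t.2.2 ∧ G.Adj t.1 t.2.2

def fsup {n : ℕ} (t : Fin n × Fin n × Fin n) : Finset (Fin n) := {t.1, t.2.1, t.2.2}

lemma fsup_mem {n : ℕ} (G : SimpleGraph (Fin n)) (t : Fin n × Fin n × Fin n) (ht : TT G t) :
    (fsup t).card = 3 ∧ G.IsClique (fsup t : Set (Fin n)) := by
  obtain ⟨x, y, z⟩ := t
  obtain ⟨a, b, c⟩ := ht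
  simp only at a b c
  constructor
  · simp only [fsup]
    rw [card_eq_three]
    exact ⟨x, y, z, a.ne, c.ne, b.ne, rfl⟩
  · simp only [fsup, coe_insert, coe_singleton]
    intro p hp q hq hpq
    simp only [Set.mem_insert_iff, Set.mem_singleton_iff] at hp hq
    have a' := a.symm
    have b' := b.symm
    have c' := c.symm
    rcases hp with rfl | rfl | rfl <;> rcases hq with rfl | rfl | rfl <;>
      first | assumption | exact absurd rfl hpq

lemma fiber_eq {n : ℕ} (G : SimpleGraph (Fin n)) {a b c : Fin n} (A1 : G.Adj a b)
    (A2 : G.Adj a c) (A3 : G.Adj b c) (t : Fin n × Fin n × Fin n) :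
    (TT G t ∧ fsup t = {a, b, c}) ↔
     t ∈ ({(a, b, c), (a, c, b), (b, a, c), (b, c, a), (c, a, b), (c, b, a)} :
      Finset (Fin n × Fin n × Fin n)) := by
  obtain ⟨x, y, z⟩ := t
  simp only [TT, fsup, mem_insert, mem_singleton, Prod.mk.injEq]
  constructor
  · rintro ⟨⟨p, q, r⟩, h⟩
    have hx : x ∈ ({a, b, c} : Finset (Fin n)) := by rw [← h]; simp
    have hy : y ∈ ({a, b, c} : Finset (Fin n)) := by rw [← h]; simp
    have hz : z ∈ ({a, b, c} : Finset (Fin n)) := by rw [← h]; simp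
    simp only [mem_insert, mem_singleton] at hx hy hz
    have p' := p.ne
    have q' := q.ne
    have r' := r.ne
    clear h p q r A1 A2 A3
    rcases hx with rfl | rfl | rfl <;> rcases hy with rfl | rfl | rfl <;>
      first
      | exact absurd rfl p'
      | (rcases hz with rfl | rfl | rfl <;>
          first
          | exact absurd rfl q'
          | exact absurd rfl r'
          | simp)
  · have B1 := A1.symm
    have B2 := A2.symm
    have B3 := A3.symm
    rintro (⟨rfl, rfl, rfl⟩ | ⟨rfl, rfl, rfl⟩ | ⟨rfl, rfl, rfl⟩ | ⟨rfl, rfl, rfl⟩ |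
      ⟨rfl, rfl, rfl⟩ | ⟨rfl, rfl, rfl⟩) <;>
    refine ⟨⟨by assumption, by assumption, by assumption⟩, ?_⟩ <;>
    (ext w; simp only [mem_insert, mem_singleton]; try tauto)

lemma card_six {n : ℕ} {a b c : Fin n} (hab : a ≠ b) (hac : a ≠ c) (hbc : b ≠ c) :
    ({(a, b, c), (a, c, b), (b, a, c), (b, c, a), (c, a, b), (c, b, a)} :
      Finset (Fin n × Fin n × Fin n)).card = 6 := by
  have := hab.symm
  have := hac.symm
  have := hbc.symm
  rw [card_insert_of_notMem, card_insert_of_notMem, card_insert_of_notMem,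
    card_insert_of_notMem, card_insert_of_notMem, card_singleton] <;> simp [*]

lemma card_ordered {n : ℕ} (G : SimpleGraph (Fin n)) :
    k3 G = 6 * ((univ.powersetCard 3).filter
      (fun S : Finset (Fin n) => G.IsClique (S : Set (Fin n)))).card := by
  have h1 : k3 G = (univ.filter (fun t => TT G t)).card := by
    rw [card_filter]
    push_cast
    rw [Fintype.sum_prod_type]
    simp only [Fintype.sum_prod_type]
    unfold k3
    refine sum_congr rfl fun x _ => sum_congr rfl fun y _ => sum_congr rfl fun z _ => ?_
    simp only [TT]
    congr
  have h2 := card_eq_sum_card_fiberwise (s := univ.filter (fun t => TT G t)) (f := fsup)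
    (t := (univ.powersetCard 3).filter (fun S : Finset (Fin n) => G.IsClique (S : Set (Fin n))))
    (by
      intro t ht
      have ht' : TT G t := by simpa using ht
      have := fsup_mem G t ht'
      rw [mem_coe, mem_filter, mem_powersetCard]
      exact ⟨⟨subset_univ _, this.1⟩, this.2⟩)
  rw [h1, h2]
  have h3 : ∀ S ∈ (univ.powersetCard 3).filter
      (fun S : Finset (Fin n) => G.IsClique (S : Set (Fin n))),
      ((univ.filter (fun t => TT G t)).filter (fun t => fsup t = S)).card = 6 := by
    intro S hS
    rw [mem_filter, mem_powersetCard] at hS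
    obtain ⟨⟨-, hcard⟩, hcl⟩ := hS
    obtain ⟨a, b, c, hab, hac, hbc, rfl⟩ := card_eq_three.1 hcard
    have A1 : G.Adj a b := hcl (by simp) (by simp) hab
    have A2 : G.Adj a c := hcl (by simp) (by simp) hac
    have A3 : G.Adj b c := hcl (by simp) (by simp) hbc
    rw [← card_six hab hac hbc]
    congr 1
    ext t
    rw [mem_filter, mem_filter, ← fiber_eq G A1 A2 A3 t]
    simp
  rw [sum_congr rfl h3]
  simp [mul_comm]

lemma card_iso_top {n : ℕ} (G : SimpleGraph (Fin n)) (S : Finset (Fin n)) (hS : S.card = 3) :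
    Nonempty ((⊤ : SimpleGraph (Fin 3)) ≃g G.induce (S : Set (Fin n))) ↔ G.IsClique S := by
  constructor
  · rintro ⟨e⟩ x hx y hy hxy
    have := (e.symm.map_rel_iff (a := ⟨x, hx⟩) (b := ⟨y, hy⟩)).1 (by
      rw [SimpleGraph.top_adj]
      intro h
      apply hxy
      simpa using e.symm.injective h)
    simpa using this
  · intro h
    have e : Fin 3 ≃ (S : Set (Fin n)) := (S.equivFinOfCardEq hS).symm
    refine ⟨⟨e, ?_⟩⟩
    intro a b
    simp only [SimpleGraph.comap_adj, SimpleGraph.top_adj, Function.Embedding.subtype_apply]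
    constructor
    · intro h hab; subst hab; exact G.loopless.irrefl _ h
    · intro hab
      exact h (e a).2 (e b).2 (fun h' => hab (e.injective (Subtype.ext h')))

lemma card_iso_bot {n : ℕ} (G : SimpleGraph (Fin n)) (S : Finset (Fin n)) (hS : S.card = 3) :
    Nonempty ((⊥ : SimpleGraph (Fin 3)) ≃g G.induce (S : Set (Fin n))) ↔ Gᶜ.IsClique S := by
  constructor
  · rintro ⟨e⟩ x hx y hy hxy
    rw [SimpleGraph.compl_adj]
    refine ⟨hxy, fun h => ?_⟩
    have := (e.symm.map_rel_iff (a := ⟨x, hx⟩) (b := ⟨y, hy⟩)).2 (by simpa using h)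
    simp at this
  · intro h
    have e : Fin 3 ≃ (S : Set (Fin n)) := (S.equivFinOfCardEq hS).symm
    refine ⟨⟨e, ?_⟩⟩
    intro a b
    simp only [SimpleGraph.comap_adj, SimpleGraph.bot_adj, Function.Embedding.subtype_apply,
      iff_false]
    intro hab
    have := h (e a).2 (e b).2 (fun h' => hab.ne h')
    rw [SimpleGraph.compl_adj] at this
    exact this.2 hab

lemma dens_aux {n : ℕ} (H : SimpleGraph (Fin 3)) (G G' : SimpleGraph (Fin n))
    (hiso : ∀ S : Finset (Fin n), S.card = 3 →
      (Nonempty (H ≃g G.induce (S : Set (Fin n))) ↔ G'.IsClique S)) :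
    inducedDensity H G = k3 G' / (6 * n.choose 3) := by
  unfold inducedDensity
  rw [card_ordered, mul_div_mul_left _ _ (by norm_num)]
  simp only [Fintype.card_fin, card_powersetCard, card_univ]
  rw [← card_image_of_injective
    ((univ.powersetCard 3).filter (fun S : Finset (Fin n) => G'.IsClique (S : Set (Fin n))))
    (coe_injective (α := Fin n))]
  have aux : ∀ A B : Finset (Set (Fin n)), A = B → (A.card : ℝ) / (n.choose 3 : ℝ)
      = (B.card : ℝ) / (n.choose 3 : ℝ) := by rintro A B rfl; rfl
  apply aux
  ext S
  rw [mem_filter, mem_image]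
  simp only [Finset.bind_def, Finset.pure_def, mem_sup, mem_singleton, mem_filter]
  constructor
  · rintro ⟨⟨T, hT, rfl⟩, h⟩
    exact ⟨T, ⟨hT, (hiso T (mem_powersetCard.1 hT).2).1 h⟩, rfl⟩
  · rintro ⟨T, ⟨hT, h⟩, rfl⟩
    exact ⟨⟨T, hT, rfl⟩, (hiso T (mem_powersetCard.1 hT).2).2 h⟩

lemma dens_top {n : ℕ} (G : SimpleGraph (Fin n)) :
    inducedDensity (⊤ : SimpleGraph (Fin 3)) G = k3 G / (6 * n.choose 3) :=
  dens_aux _ _ _ (card_iso_top G)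

lemma dens_bot {n : ℕ} (G : SimpleGraph (Fin n)) :
    inducedDensity (⊥ : SimpleGraph (Fin 3)) G = k3 Gᶜ / (6 * n.choose 3) :=
  dens_aux _ _ _ (card_iso_bot G)

lemma choose_ratio : Filter.Tendsto (fun n : ℕ => (6 * (n.choose 3 : ℝ)) / (n : ℝ) ^ 3)
    Filter.atTop (nhds 1) := by
  have h1 : Filter.Tendsto (fun n : ℕ => ((n : ℝ))⁻¹) Filter.atTop (nhds 0) :=
    tendsto_inv_atTop_nhds_zero_nat
  have h2 : Filter.Tendsto (fun n : ℕ => (1 - ((n : ℝ))⁻¹) * (1 - 2 * ((n : ℝ))⁻¹)) Filter.atTop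
    (nhds ((1 - 0) * (1 - 2 * 0))) := (tendsto_const_nhds.sub h1).mul
      (tendsto_const_nhds.sub (tendsto_const_nhds.mul h1))
  rw [show ((1 : ℝ) - 0) * (1 - 2 * 0) = 1 by norm_num] at h2
  refine h2.congr' ?_
  filter_upwards [Filter.eventually_ge_atTop 3] with n hn
  have hn' : (n : ℝ) ≠ 0 := by positivity
  have : (6 * (n.choose 3 : ℝ)) = n * (n - 1) * (n - 2) := by
    obtain ⟨m, rfl⟩ := Nat.exists_eq_add_of_le hn
    have := Nat.descFactorial_eq_factorial_mul_choose (3 + m) 3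
    have h' : ((3 + m).descFactorial 3 : ℝ) = (3 + m) * (3 + m - 1) * (3 + m - 2) := by
      simp only [Nat.descFactorial, show 3 + m - 2 = m + 1 by omega,
        show 3 + m - 1 = m + 2 by omega, Nat.sub_zero]
      push_cast; ring
    rw [this] at h'
    simp [Nat.factorial] at h'
    push_cast
    linarith
  rw [this]
  field_simp

/-- `(p₀,p₃)` is in the domain iff normalized ordered counts converge. -/
lemma mem_iff (p₀ p₃ : ℝ) : memDeltaK3 p₀ p₃ ↔
    ∃ (m : ℕ → ℕ) (Gs : ∀ j, SimpleGraph (Fin (m j))),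
    Filter.Tendsto m Filter.atTop Filter.atTop ∧
    Filter.Tendsto (fun j => k3 (Gs j)ᶜ / (m j : ℝ) ^ 3) Filter.atTop (nhds p₀) ∧
    Filter.Tendsto (fun j => k3 (Gs j) / (m j : ℝ) ^ 3) Filter.atTop (nhds p₃) := by
  have key : ∀ (m : ℕ → ℕ) (f : ℕ → ℝ) (p : ℝ), Filter.Tendsto m Filter.atTop Filter.atTop →
      (Filter.Tendsto (fun j => f j / (6 * (m j).choose 3)) Filter.atTop (nhds p) ↔
       Filter.Tendsto (fun j => f j / (m j : ℝ) ^ 3) Filter.atTop (nhds p)) := by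
    intro m f p hm
    have hr := choose_ratio.comp hm
    have hev : ∀ᶠ j in Filter.atTop, 3 ≤ m j := hm.eventually_ge_atTop 3
    constructor
    · intro h
      have := h.mul hr
      rw [mul_one] at this
      refine this.congr' ?_
      filter_upwards [hev] with j hj
      have : (0 : ℝ) < (m j).choose 3 := by exact_mod_cast Nat.choose_pos hj
      simp only [Function.comp]
      field_simp
    · intro h
      have := h.div hr one_ne_zero
      rw [div_one] at this
      refine this.congr' ?_
      filter_upwards [hev] with j hj
      have : (0 : ℝ) < (m j).choose 3 := by exact_mod_cast Nat.choose_pos hj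
      have : (0 : ℝ) < m j := by exact_mod_cast (by omega)
      simp only [Function.comp, Pi.div_apply]
      field_simp
  unfold memDeltaK3
  simp only [dens_top, dens_bot]
  refine exists_congr fun m => exists_congr fun Gs => and_congr_right fun hm => ?_
  rw [key m _ p₀ hm, key m _ p₃ hm]

lemma mem_swap {p₀ p₃ : ℝ} (h : memDeltaK3 p₀ p₃) : memDeltaK3 p₃ p₀ := by
  rw [mem_iff] at h ⊢
  obtain ⟨m, Gs, hm, h0, h3⟩ := h
  exact ⟨m, fun j => (Gs j)ᶜ, hm, by simpa using h3, h0⟩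

lemma cube_root_cube {p : ℝ} (hp : 0 ≤ p) : (p ^ ((1 : ℝ) / 3)) ^ 3 = p := by
  rw [← Real.rpow_natCast, ← Real.rpow_mul hp]; norm_num

lemma hh_eq (t : ℝ) : (1 - t) ^ 3 + 3 * t * (1 - t) ^ 2 = hh t := by unfold hh; ring

lemma necessary {p₀ p₃ : ℝ}
    (h : memDeltaK3 p₀ p₃) : 1 / 4 ≤ p₀ + p₃ ∧
      (p₃ ≤ hh (p₀ ^ ((1 : ℝ) / 3)) ∨ p₀ ≤ hh (p₃ ^ ((1 : ℝ) / 3))) := by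
  rw [mem_iff] at h
  obtain ⟨m, Gs, hm, h0, h3⟩ := h
  have hpos : ∀ᶠ j in Filter.atTop, 1 ≤ m j := hm.eventually_ge_atTop 1
  constructor
  · have hinv : Filter.Tendsto (fun j => ((m j : ℝ))⁻¹) Filter.atTop (nhds 0) :=
      (tendsto_inv_atTop_nhds_zero_nat (𝕜 := ℝ)).comp hm
    have hl : Filter.Tendsto (fun j => 1 / 4 - 3 * ((m j : ℝ))⁻¹) Filter.atTop
      (nhds (1 / 4 - 3 * 0)) := tendsto_const_nhds.sub (tendsto_const_nhds.mul hinv)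
    rw [show (1 / 4 - 3 * 0 : ℝ) = 1 / 4 by norm_num] at hl
    refine le_of_tendsto_of_tendsto hl (h0.add h3) ?_
    filter_upwards [hpos] with j hj
    have hj' : (0 : ℝ) < m j := by exact_mod_cast hj
    have := goodman (m j) (Gs j)
    rw [← add_div, le_div_iff₀ (by positivity)]
    have e : (1 / 4 - 3 * ((m j : ℝ))⁻¹) * (m j : ℝ) ^ 3 = (m j : ℝ) ^ 3 / 4 - 3 * (m j) ^ 2 := by
      field_simp
    linarith
  · have hcont : Continuous (fun p : ℝ => hh (p ^ ((1 : ℝ) / 3))) := by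
      have : Continuous hh := by unfold hh; fun_prop
      exact this.comp (Real.continuous_rpow_const (by norm_num))
    have hclosed : IsClosed {q : ℝ × ℝ | q.2 ≤ hh (q.1 ^ ((1 : ℝ) / 3)) ∨
        q.1 ≤ hh (q.2 ^ ((1 : ℝ) / 3))} :=
      (isClosed_le continuous_snd (hcont.comp continuous_fst)).union
        (isClosed_le continuous_fst (hcont.comp continuous_snd))
    refine hclosed.mem_of_tendsto (h0.prodMk_nhds h3) ?_
    filter_upwards [hpos] with j hj
    have hj' : (0 : ℝ) < m j := by exact_mod_cast hj
    have aux : ∀ P Q x y : ℝ, 0 ≤ P → 0 ≤ x → 0 ≤ y → x + y = m j → P ≤ x ^ 3 →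
        Q ≤ y ^ 3 + 3 * y ^ 2 * x →
        Q / (m j : ℝ) ^ 3 ≤ hh ((P / (m j : ℝ) ^ 3) ^ ((1 : ℝ) / 3)) := by
      intro P Q x y hP hx hy hxy h1 h2
      have hx1 : x / m j ≤ 1 := by rw [div_le_one hj']; linarith
      have hle : (P / (m j : ℝ) ^ 3) ^ ((1 : ℝ) / 3) ≤ x / m j := by
        have : P / (m j : ℝ) ^ 3 ≤ (x / m j) ^ 3 := by
          rw [div_pow]; gcongr
        have := Real.rpow_le_rpow (by positivity) this (show (0 : ℝ) ≤ 1 / 3 by norm_num)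
        refine this.trans_eq ?_
        rw [← Real.rpow_natCast, ← Real.rpow_mul (by positivity)]; norm_num
      refine le_trans ?_ (hh_anti (by positivity) hle hx1)
      rw [div_le_iff₀ (by positivity)]
      refine h2.trans_eq ?_
      have : y = m j - x := by linarith
      subst this
      unfold hh
      field_simp
      ring
    obtain ⟨x, y, hx, hy, hxy, h⟩ := upper_graph (m j) (Gs j)
    rcases h with ⟨a, b⟩ | ⟨a, b⟩
    · exact Or.inl (aux _ _ x y (k3_nonneg _) hx hy hxy b a)
    · exact Or.inr (aux _ _ x y (k3_nonneg _) hx hy hxy a b)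

/-- adjacency pattern of the four-block construction: `0,1` independent, `2,3` cliques -/
def MM (i j : Fin 4) : Prop :=
  (i = 0 ∧ j = 1) ∨ (i = 1 ∧ j = 0) ∨ (i = 2 ∧ j = 2) ∨ (i = 3 ∧ j = 3) ∨
  (i = 0 ∧ j = 2) ∨ (i = 2 ∧ j = 0) ∨ (i = 1 ∧ j = 3) ∨ (i = 3 ∧ j = 1)

lemma MM_symm (i j : Fin 4) (h : MM i j) : MM j i := by
  unfold MM at *; tauto

/-- blow-up with colouring `c` -/
def blow {n : ℕ} (c : Fin n → Fin 4) : SimpleGraph (Fin n) where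
  Adj x y := x ≠ y ∧ MM (c x) (c y)
  symm := ⟨fun _ _ h => ⟨h.1.symm, MM_symm _ _ h.2⟩⟩
  loopless := ⟨fun _ h => h.1 rfl⟩

/-- counting triples by a pattern of colours -/
lemma count_pattern {n : ℕ} (c : Fin n → Fin 4) (N : Fin 4 → ℝ)
    (hN : ∀ i, ((univ.filter (fun x => c x = i)).card : ℝ) = N i)
    (R : Fin 4 → Fin 4 → Prop) (G : SimpleGraph (Fin n))
    (hG : ∀ x y, G.Adj x y ↔ x ≠ y ∧ R (c x) (c y)) :
    |k3 G - ∑ i, ∑ j, ∑ k, (if R i j ∧ R j k ∧ R i k then N i * N j * N k else 0)| ≤ 3 * n ^ 2 := by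
  have hcomp : ∀ f : Fin 4 → ℝ, ∑ x, f (c x) = ∑ i, N i * f i := by
    intro f
    rw [← sum_fiberwise univ c]
    refine sum_congr rfl fun i _ => ?_
    rw [← hN i, ← nsmul_eq_mul, ← sum_const]
    refine sum_congr ?_ ?_
    · congr
    · intro x hx
      rw [(mem_filter.1 hx).2]
  have e1 : ∑ i, ∑ j, ∑ k, (if R i j ∧ R j k ∧ R i k then N i * N j * N k else 0)
      = ∑ x, ∑ y, ∑ z, (if R (c x) (c y) ∧ R (c y) (c z) ∧ R (c x) (c z) then (1 : ℝ) else 0) := by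
    have s1 : ∀ x y, ∑ z, (if R (c x) (c y) ∧ R (c y) (c z) ∧ R (c x) (c z) then (1 : ℝ) else 0)
        = ∑ k, N k * (if R (c x) (c y) ∧ R (c y) k ∧ R (c x) k then (1 : ℝ) else 0) :=
      fun x y => hcomp (fun k => if R (c x) (c y) ∧ R (c y) k ∧ R (c x) k then (1 : ℝ) else 0)
    simp only [s1]
    have s2 : ∀ x, ∑ y, ∑ k, N k * (if R (c x) (c y) ∧ R (c y) k ∧ R (c x) k then (1 : ℝ) else 0)
        = ∑ j, N j * ∑ k, N k * (if R (c x) j ∧ R j k ∧ R (c x) k then (1 : ℝ) else 0) :=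
      fun x => hcomp (fun j => ∑ k, N k * (if R (c x) j ∧ R j k ∧ R (c x) k then (1 : ℝ) else 0))
    simp only [s2]
    rw [hcomp (fun i => ∑ j, N j * ∑ k, N k * (if R i j ∧ R j k ∧ R i k then (1 : ℝ) else 0))]
    refine sum_congr rfl fun i _ => ?_
    rw [mul_sum]
    refine sum_congr rfl fun j _ => ?_
    rw [mul_sum, mul_sum]
    refine sum_congr rfl fun k _ => ?_
    split_ifs <;> ring
  rw [e1]
  have hpt : ∀ x y z : Fin n, |(if G.Adj x y ∧ G.Adj y z ∧ G.Adj x z then (1 : ℝ) else 0)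
      - (if R (c x) (c y) ∧ R (c y) (c z) ∧ R (c x) (c z) then (1 : ℝ) else 0)|
      ≤ (if x = y then 1 else 0) + (if y = z then 1 else 0) + (if x = z then 1 else 0) := by
    intro x y z
    simp only [hG]
    by_cases h1 : x = y
    · have : (0 : ℝ) ≤ if y = z then 1 else 0 := by split_ifs <;> norm_num
      have : (0 : ℝ) ≤ if x = z then 1 else 0 := by split_ifs <;> norm_num
      have : |(if (x ≠ y ∧ R (c x) (c y)) ∧ (y ≠ z ∧ R (c y) (c z)) ∧ x ≠ z ∧ R (c x) (c z) then (1 : ℝ) else 0)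
        - (if R (c x) (c y) ∧ R (c y) (c z) ∧ R (c x) (c z) then (1 : ℝ) else 0)| ≤ 1 := by
        split_ifs <;> norm_num
      rw [if_pos h1]
      linarith
    · by_cases h2 : y = z
      · have : (0 : ℝ) ≤ if x = z then 1 else 0 := by split_ifs <;> norm_num
        have : |(if (x ≠ y ∧ R (c x) (c y)) ∧ (y ≠ z ∧ R (c y) (c z)) ∧ x ≠ z ∧ R (c x) (c z) then (1 : ℝ) else 0)
          - (if R (c x) (c y) ∧ R (c y) (c z) ∧ R (c x) (c z) then (1 : ℝ) else 0)| ≤ 1 := by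
          split_ifs <;> norm_num
        rw [if_pos h2, if_neg h1]
        linarith
      · by_cases h3 : x = z
        · rw [if_pos h3, if_neg h1, if_neg h2]
          split_ifs <;> norm_num
        · simp [h1, h2, h3]
  have t7 : ∑ x : Fin n, ∑ y : Fin n, ∑ z : Fin n, ((if x = y then (1 : ℝ) else 0) + (if y = z then 1 else 0)
      + (if x = z then 1 else 0)) = 3 * n ^ 2 := by
    simp [sum_add_distrib]; ring
  rw [← t7]
  unfold k3
  simp only [← sum_sub_distrib]
  refine (abs_sum_le_sum_abs _ _).trans (sum_le_sum fun x _ => ?_)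
  refine (abs_sum_le_sum_abs _ _).trans (sum_le_sum fun y _ => ?_)
  refine (abs_sum_le_sum_abs _ _).trans (sum_le_sum fun z _ => ?_)
  exact hpt x y z

lemma exists_coloring (m : Fin 4 → ℕ) : ∃ c : Fin (∑ i, m i) → Fin 4,
    ∀ i, (univ.filter (fun x => c x = i)).card = m i := by
  refine ⟨fun x => (finSigmaFinEquiv.symm x).1, fun i => ?_⟩
  have : (univ.filter (fun x => (finSigmaFinEquiv (n := m).symm x).1 = i))
      = (univ : Finset (Fin (m i))).image (fun k => finSigmaFinEquiv ⟨i, k⟩) := by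
    ext x
    simp only [mem_filter, mem_univ, true_and, mem_image]
    constructor
    · intro h
      subst h
      exact ⟨(finSigmaFinEquiv.symm x).2, by simp⟩
    · rintro ⟨k, rfl⟩
      simp
  rw [this, card_image_of_injective, card_univ, Fintype.card_fin]
  intro k l h
  simpa using h

lemma construct (a : Fin 4 → ℝ) (ha : ∀ i, 0 ≤ a i) (hsum : ∑ i, a i = 1) :
    memDeltaK3
      (∑ i, ∑ j, ∑ k, (if ¬ MM i j ∧ ¬ MM j k ∧ ¬ MM i k then a i * a j * a k else 0))
      (∑ i, ∑ j, ∑ k, (if MM i j ∧ MM j k ∧ MM i k then a i * a j * a k else 0)) := by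
  rw [mem_iff]
  let mm : ℕ → Fin 4 → ℕ := fun N i => ⌊a i * N⌋₊
  let m : ℕ → ℕ := fun N => ∑ i, mm N i
  choose c hc using fun N => exists_coloring (mm N)
  have hlim : ∀ i, Filter.Tendsto (fun N : ℕ => (mm N i : ℝ) / N) Filter.atTop (nhds (a i)) :=
    fun i => (tendsto_nat_floor_mul_div_atTop (ha i)).comp tendsto_natCast_atTop_atTop
  have hmlim : Filter.Tendsto (fun N : ℕ => (m N : ℝ) / N) Filter.atTop (nhds 1) := by
    have := tendsto_finsetSum univ (fun i _ => hlim i)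
    rw [hsum] at this
    refine this.congr fun N => ?_
    simp only [m]; push_cast; rw [sum_div]
  have hm : Filter.Tendsto m Filter.atTop Filter.atTop := by
    have h1 : Filter.Tendsto (fun N : ℕ => (m N : ℝ) / N * N) Filter.atTop Filter.atTop :=
      hmlim.pos_mul_atTop one_pos tendsto_natCast_atTop_atTop
    rw [← tendsto_natCast_atTop_iff (R := ℝ)]
    refine h1.congr' ?_
    filter_upwards [Filter.eventually_ge_atTop 1] with N hN
    have : (N : ℝ) ≠ 0 := by positivity
    field_simp
  have hr : ∀ i, Filter.Tendsto (fun N : ℕ => (mm N i : ℝ) / m N) Filter.atTop (nhds (a i)) := by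
    intro i
    have := (hlim i).div hmlim one_ne_zero
    rw [div_one] at this
    refine this.congr' ?_
    filter_upwards [Filter.eventually_ge_atTop 1] with N hN
    have : (N : ℝ) ≠ 0 := by positivity
    simp only [Pi.div_apply]
    field_simp
  have main : ∀ (R : Fin 4 → Fin 4 → Prop) (Gs : ∀ N, SimpleGraph (Fin (m N))),
      (∀ N x y, (Gs N).Adj x y ↔ x ≠ y ∧ R (c N x) (c N y)) →
      Filter.Tendsto (fun N => k3 (Gs N) / (m N : ℝ) ^ 3) Filter.atTop
        (nhds (∑ i, ∑ j, ∑ k, (if R i j ∧ R j k ∧ R i k then a i * a j * a k else 0))) := by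
    intro R Gs hGs
    have hS : Filter.Tendsto (fun N => ∑ i, ∑ j, ∑ k, (if R i j ∧ R j k ∧ R i k then
        ((mm N i : ℝ) / m N) * ((mm N j : ℝ) / m N) * ((mm N k : ℝ) / m N) else 0)) Filter.atTop
        (nhds (∑ i, ∑ j, ∑ k, (if R i j ∧ R j k ∧ R i k then a i * a j * a k else 0))) := by
      refine tendsto_finsetSum _ fun i _ => tendsto_finsetSum _ fun j _ =>
        tendsto_finsetSum _ fun k _ => ?_
      split_ifs
      · exact ((hr i).mul (hr j)).mul (hr k)
      · exact tendsto_const_nhds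
    have hinv : Filter.Tendsto (fun N => 3 * ((m N : ℝ))⁻¹) Filter.atTop (nhds (3 * 0)) :=
      tendsto_const_nhds.mul ((tendsto_inv_atTop_nhds_zero_nat (𝕜 := ℝ)).comp hm)
    rw [mul_zero] at hinv
    have hd : Filter.Tendsto (fun N => k3 (Gs N) / (m N : ℝ) ^ 3
        - ∑ i, ∑ j, ∑ k, (if R i j ∧ R j k ∧ R i k then
        ((mm N i : ℝ) / m N) * ((mm N j : ℝ) / m N) * ((mm N k : ℝ) / m N) else 0))
        Filter.atTop (nhds 0) := by
      refine squeeze_zero_norm' ?_ hinv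
      filter_upwards [hm.eventually_ge_atTop 1] with N hN
      have hN' : (0 : ℝ) < m N := by exact_mod_cast hN
      have := count_pattern (c N) (fun i => (mm N i : ℝ)) (fun i => by rw [← hc N i]) R (Gs N) (hGs N)
      have e : k3 (Gs N) / (m N : ℝ) ^ 3 - ∑ i, ∑ j, ∑ k, (if R i j ∧ R j k ∧ R i k then
        ((mm N i : ℝ) / m N) * ((mm N j : ℝ) / m N) * ((mm N k : ℝ) / m N) else 0)
        = (k3 (Gs N) - ∑ i, ∑ j, ∑ k, (if R i j ∧ R j k ∧ R i k then
            (mm N i : ℝ) * (mm N j : ℝ) * (mm N k : ℝ) else 0)) / (m N : ℝ) ^ 3 := by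
        rw [sub_div, sum_div]
        congr 1
        refine sum_congr rfl fun i _ => ?_
        rw [sum_div]
        refine sum_congr rfl fun j _ => ?_
        rw [sum_div]
        refine sum_congr rfl fun k _ => ?_
        split_ifs
        · field_simp
        · simp
      rw [e, Real.norm_eq_abs, abs_div, abs_of_pos (by positivity : (0 : ℝ) < (m N : ℝ) ^ 3),
        div_le_iff₀ (by positivity)]
      refine this.trans_eq ?_
      field_simp
      rfl
    have := hd.add hS
    simpa using this
  refine ⟨m, fun N => blow (c N), hm, ?_, ?_⟩
  · have h := main (fun i j => ¬ MM i j) (fun N => (blow (c N))ᶜ) (by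
      intro N x y
      simp only [SimpleGraph.compl_adj, blow]
      tauto)
    convert h
  · exact main MM _ (fun N x y => Iff.rfl)

lemma sufficient {p₀ p₃ : ℝ} (hp₀ : p₀ ∈ Set.Icc (0 : ℝ) 1) (hp₃ : p₃ ∈ Set.Icc (0 : ℝ) 1)
    (hG : 1 / 4 ≤ p₀ + p₃) (hA : p₃ ≤ hh (p₀ ^ ((1 : ℝ) / 3))) : memDeltaK3 p₀ p₃ := by
  obtain ⟨s, μ, hs0, hs1, hμ0, hμ1, e0, e3⟩ := exists_params hp₀.1 hp₃.1
    (Real.rpow_nonneg hp₀.1 _) (Real.rpow_le_one hp₀.1 hp₀.2 (by norm_num))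
    (cube_root_cube hp₀.1) hG hA
  set l := Real.sqrt μ with hl
  have hl2 : l ^ 2 = μ := Real.sq_sqrt hμ0
  have hl0 : 0 ≤ l := Real.sqrt_nonneg _
  have hl1 : l ≤ 1 := Real.sqrt_le_one.2 hμ1
  have := construct ![s * (1 + l) / 2, s * (1 - l) / 2, (1 - s) * (1 + l) / 2,
    (1 - s) * (1 - l) / 2] (by
      have : 0 ≤ 1 - l := by linarith
      have : 0 ≤ 1 - s := by linarith
      intro i
      fin_cases i <;> simp <;> positivity) (by simp [Fin.sum_univ_four]; ring)
  convert this using 1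
  · rw [e0, ← hl2]
    simp [Fin.sum_univ_four, MM]
    ring
  · rw [e3, ← hl2]
    simp [Fin.sum_univ_four, MM, hh]
    ring

/-- Full description of the possible (3-anticlique, 3-clique) profiles:
`(p₀,p₃) ∈ Δ(K̄₃,K₃)` iff `p₀ + p₃ ≥ 1/4` and
`p₃ ≤ max{(1-p₀^{1/3})³ + 3 p₀^{1/3} (1-p₀^{1/3})², (1-β)³}`, where `β` is the unique
root in `[0,1]` of `β³ + 3β²(1-β) = p₀`. -/
theorem delta_K3_characterization (p₀ p₃ : ℝ)
    (hp₀ : p₀ ∈ Set.Icc (0 : ℝ) 1) (hp₃ : p₃ ∈ Set.Icc (0 : ℝ) 1)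
    (β : ℝ) (hβ : β ∈ Set.Icc (0 : ℝ) 1) (hβeq : β ^ 3 + 3 * β ^ 2 * (1 - β) = p₀) :
    memDeltaK3 p₀ p₃ ↔
      (p₀ + p₃ ≥ 1 / 4 ∧
        p₃ ≤ max ((1 - p₀ ^ ((1 : ℝ) / 3)) ^ 3 +
                    3 * p₀ ^ ((1 : ℝ) / 3) * (1 - p₀ ^ ((1 : ℝ) / 3)) ^ 2)
                 ((1 - β) ^ 3)) := by
  have hmain : memDeltaK3 p₀ p₃ ↔ (1 / 4 ≤ p₀ + p₃ ∧
      (p₃ ≤ hh (p₀ ^ ((1 : ℝ) / 3)) ∨ p₀ ≤ hh (p₃ ^ ((1 : ℝ) / 3)))) := by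
    constructor
    · exact necessary
    · rintro ⟨hG, h | h⟩
      · exact sufficient hp₀ hp₃ hG h
      · exact mem_swap (sufficient hp₃ hp₀ (by linarith) h)
  have hB : p₀ ≤ hh (p₃ ^ ((1 : ℝ) / 3)) ↔ p₃ ≤ (1 - β) ^ 3 := by
    have hβ' : p₀ = hh (1 - β) := by rw [← hβeq]; unfold hh; ring
    have hc := cube_root_cube hp₃.1
    have hc0 : 0 ≤ p₃ ^ ((1 : ℝ) / 3) := Real.rpow_nonneg hp₃.1 _
    have hc1 : p₃ ^ ((1 : ℝ) / 3) ≤ 1 := Real.rpow_le_one hp₃.1 hp₃.2 (by norm_num)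
    rw [hβ']
    have hb0 : 0 ≤ 1 - β := by linarith [hβ.2]
    have hb1 : 1 - β ≤ 1 := by linarith [hβ.1]
    constructor
    · intro h
      rw [← hc]
      refine pow_le_pow_left₀ hc0 ?_ 3
      by_contra hlt
      push Not at hlt
      have := hh_anti_strict hb0 hlt hc1
      linarith
    · intro h
      refine hh_anti hc0 ?_ hb1
      by_contra hlt
      push Not at hlt
      have := pow_lt_pow_left₀ hlt hb0 (n := 3) (by norm_num)
      linarith
  rw [hmain, hh_eq, le_max_iff, hB, ge_iff_le]
end

section
/- Let p_0, p_3 ∈ [0,1] satisfy p_0 + p_3 ≥ 1/4 and p_3 ≤ max{(1 − p_0^{1/3})³ + 3·p_0^{1/3}·(1 − p_0^{1/3})², (1−β)³}, where β is the unique root in [0,1] of β³ + 3β²(1−β) = p_0. Then for every ε > 0 and every N there exists a finite simple graph G on at least N vertices with |p_0(G) − p_0| ≤ ε and |p_3(G) − p_3| ≤ ε. -/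
open Finset

open scoped Classical

/-- Independent-triple density of the pattern. -/
noncomputable def indPoly (y₁ y₂ x z : ℝ) : ℝ :=
  z ^ 3 + 3 * z ^ 2 * (y₁ + y₂ + 2 * x) +
    3 * z * (2 * y₁ * y₂ + 2 * y₁ * x + 2 * y₂ * x + 2 * x ^ 2) +
    2 * x ^ 3 + 3 * (y₁ + y₂) * x ^ 2

/-- Triangle density of the pattern. -/
noncomputable def triPoly (y₁ y₂ x : ℝ) : ℝ :=
  y₁ ^ 3 + y₂ ^ 3 + 3 * (y₁ ^ 2 + y₂ ^ 2) * x

/-- There are weights for the pattern with given densities. -/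
def Weights (p₀ p₃ : ℝ) : Prop :=
  ∃ y₁ y₂ x z : ℝ, 0 ≤ y₁ ∧ 0 ≤ y₂ ∧ 0 ≤ x ∧ 0 ≤ z ∧ y₁ + y₂ + x + x + z = 1 ∧
    triPoly y₁ y₂ x = p₀ ∧ indPoly y₁ y₂ x z = p₃

lemma cubeRoot_pow {c : ℝ} (hc : 0 ≤ c) : (c ^ ((1 : ℝ) / 3)) ^ 3 = c := by
  rw [← Real.rpow_natCast, ← Real.rpow_mul hc]; norm_num

lemma cubeRoot_of_pow {a : ℝ} (ha : 0 ≤ a) : (a ^ 3) ^ ((1 : ℝ) / 3) = a := by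
  rw [← Real.rpow_natCast, ← Real.rpow_mul ha]; norm_num

/-- The two-clique path. -/
lemma seg_one {a p₃ w : ℝ} (hw : 0 ≤ w)
    (hle : ∀ v ∈ Set.Icc 0 w, v ^ 3 ≤ a ^ 3 ∧ a ^ 3 - v ^ 3 ≤ (1 - v) ^ 3) (ha : 0 ≤ a)
    (hw1 : w ≤ 1)
    (h2 : p₃ ≤ (1 - a) ^ 3 + 3 * a * (1 - a) ^ 2)
    (h3 : indPoly ((a ^ 3 - w ^ 3) ^ ((1 : ℝ) / 3)) w 0
      (1 - (a ^ 3 - w ^ 3) ^ ((1 : ℝ) / 3) - w) ≤ p₃) :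
    Weights (a ^ 3) p₃ := by
  let u : ℝ → ℝ := fun v => (a ^ 3 - v ^ 3) ^ ((1 : ℝ) / 3)
  have hu : Continuous u := by
    apply Continuous.rpow_const (by fun_prop)
    intro x; right; norm_num
  have hf : Continuous (fun v => indPoly (u v) v 0 (1 - u v - v)) := by
    unfold indPoly; fun_prop
  have h0 : p₃ ≤ indPoly (u 0) 0 0 (1 - u 0 - 0) := by
    have : u 0 = a := by
      simp only [u]
      rw [zero_pow (by norm_num), sub_zero, cubeRoot_of_pow ha]
    rw [this]; unfold indPoly; nlinarith
  obtain ⟨v, hv, hv'⟩ := intermediate_value_Icc' hw hf.continuousOn ⟨h3, h0⟩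
  obtain ⟨hv1, hv2⟩ := hle v hv
  have hu0 : 0 ≤ u v := Real.rpow_nonneg (by linarith) _
  have hu3 : u v ^ 3 = a ^ 3 - v ^ 3 := cubeRoot_pow (by linarith)
  have hu1 : u v ≤ 1 - v := by
    have := hv.2
    refine le_of_pow_le_pow_left₀ (n := 3) (by norm_num) (by linarith) (by rw [hu3]; exact hv2)
  refine ⟨u v, v, 0, 1 - u v - v, hu0, hv.1, le_rfl, by linarith, by ring, ?_, hv'⟩
  unfold triPoly; rw [hu3]; ring

lemma core_zero {p₃ : ℝ} (h1 : 1 / 4 ≤ p₃) (h2 : p₃ ≤ 1) : Weights 0 p₃ := by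
  have hf : Continuous (fun x : ℝ => indPoly 0 0 x (1 - 2 * x)) := by
    unfold indPoly; fun_prop
  obtain ⟨x, hx, hx'⟩ := intermediate_value_Icc' (a := (0 : ℝ)) (b := 1 / 2) (by norm_num)
    hf.continuousOn (show p₃ ∈ Set.Icc _ _ by constructor <;> norm_num [indPoly] <;> linarith)
  refine ⟨0, 0, x, 1 - 2 * x, le_rfl, le_rfl, hx.1, by linarith [hx.2], by ring, ?_, hx'⟩
  norm_num [triPoly]

lemma core_big {a p₃ : ℝ} (ha : 0 ≤ a) (ha1 : a ≤ 1) (h14 : 1 / 4 ≤ a ^ 3) (hp : 0 ≤ p₃)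
    (h2 : p₃ ≤ (1 - a) ^ 3 + 3 * a * (1 - a) ^ 2) : Weights (a ^ 3) p₃ := by
  have hf : Continuous (fun w : ℝ => w ^ 3 + (1 - w) ^ 3) := by fun_prop
  have ha3 : a ^ 3 ≤ 1 := pow_le_one₀ ha ha1
  obtain ⟨w, hw, hw'⟩ := intermediate_value_Icc' (a := (0 : ℝ)) (b := 1 / 2) (by norm_num)
    hf.continuousOn (show a ^ 3 ∈ Set.Icc _ _ by constructor <;> norm_num <;> linarith)
  simp only at hw'
  obtain ⟨hw0, hw2⟩ := hw
  have hr : (a ^ 3 - w ^ 3) ^ ((1 : ℝ) / 3) = 1 - w := by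
    rw [← hw', add_sub_cancel_left, cubeRoot_of_pow (by linarith)]
  refine seg_one hw0 ?_ ha (by linarith) h2 ?_
  · rintro v ⟨hv0, hv1⟩
    have h3 : v ^ 3 ≤ w ^ 3 := by gcongr
    have h4 : 0 ≤ (1 - w) ^ 3 := pow_nonneg (by linarith) _
    refine ⟨by linarith, ?_⟩
    nlinarith [mul_nonneg (sub_nonneg.2 hv1) (show 0 ≤ 1 - v - w by linarith)]
  · rw [hr]; simp [indPoly]; exact hp

lemma core_small {a p₃ : ℝ} (ha : 0 < a) (h14 : a ^ 3 ≤ 1 / 4)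
    (h1 : 1 / 4 ≤ a ^ 3 + p₃)
    (h2 : p₃ ≤ (1 - a) ^ 3 + 3 * a * (1 - a) ^ 2) : Weights (a ^ 3) p₃ := by
  have ha3 : 0 < a ^ 3 := by positivity
  obtain ⟨h, hh0, hh3⟩ : ∃ h : ℝ, 0 < h ∧ h ^ 3 = a ^ 3 / 2 :=
    ⟨_, Real.rpow_pos_of_pos (by positivity) _, cubeRoot_pow (by positivity)⟩
  have hh1 : h ≤ 1 / 2 := by
    refine le_of_pow_le_pow_left₀ (n := 3) (by norm_num) (by norm_num) (by rw [hh3]; linarith)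
  have hr : (a ^ 3 - h ^ 3) ^ ((1 : ℝ) / 3) = h := by
    rw [show a ^ 3 - h ^ 3 = h ^ 3 by linarith, cubeRoot_of_pow hh0.le]
  rcases le_total (indPoly h h 0 (1 - h - h)) p₃ with hc | hc
  · refine seg_one hh0.le ?_ ha.le (by linarith) h2 (by rw [hr]; exact hc)
    rintro v ⟨hv0, hv1⟩
    have h3 : v ^ 3 ≤ h ^ 3 := by gcongr
    refine ⟨by linarith, ?_⟩
    nlinarith [sq_nonneg (1 - 2 * v)]
  · have hf : Continuous (fun y : ℝ => 3 * y ^ 2 - 4 * y ^ 3) := by fun_prop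
    obtain ⟨s, ⟨hs0, hs1⟩, hs'⟩ := intermediate_value_Icc (a := (0 : ℝ)) (b := 1 / 2) (by norm_num)
      hf.continuousOn (show a ^ 3 ∈ Set.Icc _ _ by constructor <;> norm_num <;> linarith)
    simp only at hs'
    have hs0 : 0 < s := by
      rcases hs0.lt_or_eq with h | h
      · exact h
      · rw [← h] at hs'; norm_num at hs'; nlinarith
    have hsh : s ≤ h := by
      refine le_of_pow_le_pow_left₀ (n := 3) (by norm_num) hh0.le ?_
      rw [hh3]
      nlinarith [mul_nonneg (sq_nonneg s) (show 0 ≤ 1 / 2 - s by linarith)]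
    let x : ℝ → ℝ := fun y => (a ^ 3 / 2 - y ^ 3) / (3 * y ^ 2)
    have hx : ContinuousOn x (Set.Icc s h) := by
      apply ContinuousOn.div (by fun_prop) (by fun_prop)
      intro y hy
      have : 0 < y := lt_of_lt_of_le hs0 hy.1
      positivity
    have hg : ContinuousOn (fun y => indPoly y y (x y) (1 - 2 * y - 2 * x y)) (Set.Icc s h) := by
      unfold indPoly; fun_prop
    have hxs : x s = 1 / 2 - s := by
      simp only [x]; rw [div_eq_iff (by positivity)]; linarith
    have hxh : x h = 0 := by simp [x, hh3]
    obtain ⟨y, hy, hy'⟩ := intermediate_value_Icc hsh hg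
      (show p₃ ∈ Set.Icc _ _ by
        constructor
        · simp only [hxs]; unfold indPoly; nlinarith
        · simp only [hxh]; convert hc using 2; ring)
    have hy0 : 0 < y := lt_of_lt_of_le hs0 hy.1
    have hyh : y ^ 3 ≤ h ^ 3 := by have := hy.2; gcongr
    have hxy : x y * (3 * y ^ 2) = a ^ 3 / 2 - y ^ 3 := by
      simp only [x]; rw [div_mul_cancel₀]; positivity
    have hx0 : 0 ≤ x y := div_nonneg (by linarith) (by positivity)
    have hx1 : x y ≤ 1 / 2 - y := by
      simp only [x]; rw [div_le_iff₀ (by positivity)]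
      have hy1 := hy.1
      have hy2 := hy.2
      have e : 3 * y ^ 2 - 4 * y ^ 3 - (3 * s ^ 2 - 4 * s ^ 3) =
        (y - s) * (2 * y * (1 / 2 - y) + 2 * s * (1 / 2 - s) + 2 * y * (1 - y - s)
          + 2 * s * (1 - y - s) + 0) := by ring
      have : 0 ≤ 3 * y ^ 2 - 4 * y ^ 3 - (3 * s ^ 2 - 4 * s ^ 3) := by
        rw [e]
        have i1 : 0 ≤ 1 / 2 - y := by linarith
        have i2 : 0 ≤ 1 / 2 - s := by linarith
        have i3 : 0 ≤ 1 - y - s := by linarith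
        have i4 : 0 ≤ y - s := by linarith
        positivity
      nlinarith
    refine ⟨y, y, x y, 1 - 2 * y - 2 * x y, hy0.le, hy0.le, hx0, by linarith, by ring, ?_, hy'⟩
    unfold triPoly; nlinarith

lemma core {a p₃ : ℝ} (ha : 0 ≤ a) (ha1 : a ≤ 1) (hp : 0 ≤ p₃) (h1 : 1 / 4 ≤ a ^ 3 + p₃)
    (h2 : p₃ ≤ (1 - a) ^ 3 + 3 * a * (1 - a) ^ 2) : Weights (a ^ 3) p₃ := by
  rcases le_total (1 / 4) (a ^ 3) with h | h
  · exact core_big ha ha1 h hp h2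
  · rcases ha.lt_or_eq with h0 | h0
    · exact core_small h0 h h1 h2
    · subst h0
      norm_num at h1 h2 ⊢
      exact core_zero (by linarith) h2


/-- Blow-up graph of a pattern along a labelling. -/
def blowup {n : ℕ} {k : ℕ} (M : Fin k → Fin k → Bool) (hM : ∀ i j, M i j = M j i)
    (f : Fin n → Fin k) : SimpleGraph (Fin n) where
  Adj u v := u ≠ v ∧ M (f u) (f v) = true
  symm := ⟨fun u v h => ⟨h.1.symm, by rw [hM]; exact h.2⟩⟩
  loopless := ⟨fun u h => h.1 rfl⟩

/-- Density of monochromatic triples in the pattern. -/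
noncomputable def patDensity {k : ℕ} (M : Fin k → Fin k → Bool) (b : Bool) (w : Fin k → ℝ) : ℝ :=
  ∑ i, ∑ j, ∑ l, if M i j = b ∧ M i l = b ∧ M j l = b then w i * w j * w l else 0

lemma edgesIn_triple {V : Type*} [Fintype V] [DecidableEq V] (G : SimpleGraph V) {x y z : V}
    (hxy : x ≠ y) (hxz : x ≠ z) (hyz : y ≠ z) :
    edgesIn G {x, y, z} = (if G.Adj x y then 1 else 0) + (if G.Adj x z then 1 else 0)
      + (if G.Adj y z then 1 else 0) := by
  have h : ({x, y, z} : Finset V).powersetCard 2 = {{x, y}, {x, z}, {y, z}} := by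
    ext T
    simp only [mem_powersetCard, mem_insert, mem_singleton]
    constructor
    · rintro ⟨hT, hc⟩
      obtain ⟨a, b, hab, rfl⟩ := Finset.card_eq_two.1 hc
      have ha : a ∈ ({x, y, z} : Finset V) := hT (by simp)
      have hb : b ∈ ({x, y, z} : Finset V) := hT (by simp)
      simp only [mem_insert, mem_singleton] at ha hb
      rcases ha with rfl | rfl | rfl <;> rcases hb with rfl | rfl | rfl <;>
        simp_all [Finset.pair_comm]
    · rintro (rfl | rfl | rfl)
      · exact ⟨by intro t; simp; tauto, Finset.card_pair hxy⟩
      · exact ⟨by intro t; simp; tauto, Finset.card_pair hxz⟩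
      · exact ⟨by intro t; simp; tauto, Finset.card_pair hyz⟩
  have n1 : ({x, y} : Finset V) ≠ {x, z} := by
    intro h; have : y ∈ ({x, z} : Finset V) := h ▸ (by simp)
    simp at this; grind
  have n2 : ({x, y} : Finset V) ≠ {y, z} := by
    intro h; have : x ∈ ({y, z} : Finset V) := h ▸ (by simp)
    simp at this; grind
  have n3 : ({x, z} : Finset V) ≠ {y, z} := by
    intro h; have : x ∈ ({y, z} : Finset V) := h ▸ (by simp)
    simp at this; grind
  have key : ∀ a b : V, a ≠ b →
      ((∀ s ∈ ({a, b} : Finset V), ∀ t ∈ ({a, b} : Finset V), s ≠ t → G.Adj s t) ↔ G.Adj a b) := by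
    intro a b hab
    constructor
    · intro h; exact h a (by simp) b (by simp) hab
    · intro h s hs t ht hst
      simp only [mem_insert, mem_singleton] at hs ht
      rcases hs with rfl | rfl <;> rcases ht with rfl | rfl
      · exact absurd rfl hst
      · exact h
      · exact h.symm
      · exact absurd rfl hst
  unfold edgesIn
  rw [h, Finset.card_filter, Finset.sum_insert, Finset.sum_insert, Finset.sum_singleton]
  · simp only [key x y hxy, key x z hxz, key y z hyz]; ring
  · simp [n3]
  · simp [n1, n2]

/-- Ordered triples of distinct vertices versus 3-subsets. -/
lemma six_mul_card {n : ℕ} (P : Finset (Fin n) → Prop) :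
    6 * (((univ : Finset (Fin n)).powersetCard 3).filter P).card =
      ((univ : Finset (Fin n × Fin n × Fin n)).filter
        (fun t => (t.1 ≠ t.2.1 ∧ t.1 ≠ t.2.2 ∧ t.2.1 ≠ t.2.2) ∧ P {t.1, t.2.1, t.2.2})).card := by
  rw [Finset.card_eq_sum_card_fiberwise (f := fun t : Fin n × Fin n × Fin n => ({t.1, t.2.1, t.2.2} : Finset (Fin n)))
    (t := ((univ : Finset (Fin n)).powersetCard 3).filter P)]
  · rw [Finset.sum_const_nat (m := 6), mul_comm]
    intro S hS
    simp only [mem_filter, mem_powersetCard_univ] at hS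
    obtain ⟨hc, hP⟩ := hS
    obtain ⟨x, y, z, hxy, hxz, hyz, rfl⟩ := Finset.card_eq_three.1 hc
    have : ({a ∈ ({t | (t.1 ≠ t.2.1 ∧ t.1 ≠ t.2.2 ∧ t.2.1 ≠ t.2.2) ∧ P {t.1, t.2.1, t.2.2}} :
        Finset (Fin n × Fin n × Fin n)) | ({a.1, a.2.1, a.2.2} : Finset (Fin n)) = {x, y, z}}) =
        {(x, y, z), (x, z, y), (y, x, z), (y, z, x), (z, x, y), (z, y, x)} := by
      ext ⟨a, b, c⟩
      simp only [mem_filter, mem_univ, true_and, mem_insert, mem_singleton, Prod.mk.injEq]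
      constructor
      · rintro ⟨⟨⟨hab, hac, hbc⟩, -⟩, h⟩
        have ha : a ∈ ({x, y, z} : Finset (Fin n)) := h ▸ (by simp)
        have hb : b ∈ ({x, y, z} : Finset (Fin n)) := h ▸ (by simp)
        have hc : c ∈ ({x, y, z} : Finset (Fin n)) := h ▸ (by simp)
        simp only [mem_insert, mem_singleton] at ha hb hc
        grind
      · intro h
        have e : ({a, b, c} : Finset (Fin n)) = {x, y, z} := by
          ext t; simp only [mem_insert, mem_singleton]; grind
        refine ⟨⟨?_, by rw [e]; exact hP⟩, e⟩
        grind
    rw [this]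
    simp [hxy, hxz, hyz, hxy.symm, hxz.symm, hyz.symm]
  · rintro ⟨a, b, c⟩ h
    simp only [coe_filter, mem_univ, true_and, Set.mem_setOf_eq, mem_powersetCard_univ] at h ⊢
    exact ⟨Finset.card_eq_three.2 ⟨a, b, c, h.1.1, h.1.2.1, h.1.2.2, rfl⟩, h.2⟩

/-- Number of all labelled triples with the pattern. -/
lemma card_pattern {n k : ℕ} (M : Fin k → Fin k → Bool) (b : Bool) (f : Fin n → Fin k)
    (c : Fin k → ℕ) (hc : ∀ i, (univ.filter (fun v => f v = i)).card = c i) :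
    (((univ : Finset (Fin n × Fin n × Fin n)).filter
      (fun t => M (f t.1) (f t.2.1) = b ∧ M (f t.1) (f t.2.2) = b ∧
        M (f t.2.1) (f t.2.2) = b)).card : ℝ) = patDensity M b (fun i => (c i : ℝ)) := by
  have hs : ∀ F : Fin k → ℝ, ∑ v, F (f v) = ∑ i, (c i : ℝ) * F i := by
    intro F
    rw [← Finset.sum_fiberwise (univ : Finset (Fin n)) f]
    refine Finset.sum_congr rfl fun i _ => ?_
    rw [Finset.sum_congr rfl (g := fun _ => F i)]
    · simp [hc]
    · intro v hv; simp at hv; rw [hv]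
  rw [Finset.card_filter]
  push_cast
  simp only [Fintype.sum_prod_type]
  rw [hs (fun i => ∑ v, ∑ w, if M i (f v) = b ∧ M i (f w) = b ∧ M (f v) (f w) = b then (1:ℝ) else 0)]
  unfold patDensity
  refine Finset.sum_congr rfl fun i _ => ?_
  rw [hs (fun j => ∑ w, if M i j = b ∧ M i (f w) = b ∧ M j (f w) = b then (1:ℝ) else 0), mul_sum]
  refine Finset.sum_congr rfl fun j _ => ?_
  rw [hs (fun l => if M i j = b ∧ M i l = b ∧ M j l = b then (1:ℝ) else 0), mul_sum, mul_sum]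
  refine Finset.sum_congr rfl fun l _ => ?_
  split_ifs <;> ring

lemma card_bad (n : ℕ) : ((univ : Finset (Fin n × Fin n × Fin n)).filter
      (fun t => ¬ (t.1 ≠ t.2.1 ∧ t.1 ≠ t.2.2 ∧ t.2.1 ≠ t.2.2))).card ≤ 3 * n ^ 2 := by
  have hsub : (univ : Finset (Fin n × Fin n × Fin n)).filter
      (fun t => ¬ (t.1 ≠ t.2.1 ∧ t.1 ≠ t.2.2 ∧ t.2.1 ≠ t.2.2)) ⊆
      ((univ : Finset (Fin n × Fin n)).image (fun p => (p.1, p.1, p.2)) ∪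
       (univ : Finset (Fin n × Fin n)).image (fun p => (p.1, p.2, p.1))) ∪
       (univ : Finset (Fin n × Fin n)).image (fun p => (p.1, p.2, p.2)) := by
    rintro ⟨a, b, c⟩ h
    simp at h ⊢
    grind
  refine (card_le_card hsub).trans ((card_union_le _ _).trans ?_)
  refine (add_le_add_left (card_union_le _ _) _).trans ?_
  have hh : ∀ g : Fin n × Fin n → Fin n × Fin n × Fin n, (univ.image g).card ≤ n ^ 2 := by
    intro g
    refine card_image_le.trans ?_
    simp [sq]
  have := hh (fun p => (p.1, p.1, p.2))
  have := hh (fun p => (p.1, p.2, p.1))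
  have := hh (fun p => (p.1, p.2, p.2))
  linarith

/-- Number of edges in a homogeneous triple. -/
def tgt (b : Bool) : ℕ := if b then 3 else 0

lemma count_bound {n k : ℕ} (M : Fin k → Fin k → Bool) (hM : ∀ i j, M i j = M j i)
    (b : Bool) (f : Fin n → Fin k)
    (c : Fin k → ℕ) (hc : ∀ i, (univ.filter (fun v => f v = i)).card = c i) :
    |6 * ((((univ : Finset (Fin n)).powersetCard 3).filter
      (fun S => edgesIn (blowup M hM f) S = tgt b)).card : ℝ) -
        patDensity M b (fun i => (c i : ℝ))| ≤ 3 * (n : ℝ) ^ 2 := by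
  rw [← card_pattern M b f c hc]
  set A := (univ : Finset (Fin n × Fin n × Fin n)).filter
      (fun t => M (f t.1) (f t.2.1) = b ∧ M (f t.1) (f t.2.2) = b ∧
        M (f t.2.1) (f t.2.2) = b) with hA
  set D := (univ : Finset (Fin n × Fin n × Fin n)).filter
      (fun t => ¬ (t.1 ≠ t.2.1 ∧ t.1 ≠ t.2.2 ∧ t.2.1 ≠ t.2.2)) with hD
  have hBeq : (univ : Finset (Fin n × Fin n × Fin n)).filter
      (fun t => (t.1 ≠ t.2.1 ∧ t.1 ≠ t.2.2 ∧ t.2.1 ≠ t.2.2) ∧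
        edgesIn (blowup M hM f) {t.1, t.2.1, t.2.2} = tgt b) = A \ D := by
    ext ⟨u, v, w⟩
    simp only [hA, hD, mem_filter, mem_univ, true_and, mem_sdiff, not_not]
    constructor
    · rintro ⟨⟨h1, h2, h3⟩, he⟩
      refine ⟨?_, h1, h2, h3⟩
      rw [edgesIn_triple _ h1 h2 h3] at he
      simp only [blowup, ne_eq, h1, h2, h3, not_false_eq_true, true_and] at he
      cases b <;> simp only [tgt] at he <;> grind
    · rintro ⟨⟨e1, e2, e3⟩, h1, h2, h3⟩
      refine ⟨⟨h1, h2, h3⟩, ?_⟩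
      rw [edgesIn_triple _ h1 h2 h3]
      simp only [blowup, ne_eq, h1, h2, h3, not_false_eq_true, true_and, e1, e2, e3]
      cases b <;> simp [tgt]
  have h6 : 6 * (((univ : Finset (Fin n)).powersetCard 3).filter
      (fun S => edgesIn (blowup M hM f) S = tgt b)).card = (A \ D).card := by
    rw [← hBeq]
    convert six_mul_card (fun S => edgesIn (blowup M hM f) S = tgt b)
  have h7 : (A \ D).card ≤ A.card := card_le_card sdiff_subset
  have h8 : A.card ≤ (A \ D).card + D.card := by
    have := Finset.le_card_sdiff D A
    omega
  have h9 : D.card ≤ 3 * n ^ 2 := card_bad n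
  have h6' : (6 : ℝ) * ((((univ : Finset (Fin n)).powersetCard 3).filter
      (fun S => edgesIn (blowup M hM f) S = tgt b)).card : ℝ) = ((A \ D).card : ℝ) := by
    exact_mod_cast h6
  rw [h6', abs_le]
  have h7' : ((A \ D).card : ℝ) ≤ A.card := by exact_mod_cast h7
  have h8' : (A.card : ℝ) ≤ (A \ D).card + 3 * (n : ℝ) ^ 2 := by
    exact_mod_cast h8.trans (by omega)
  constructor
  · linarith
  · have : (0 : ℝ) ≤ 3 * (n : ℝ) ^ 2 := by positivity
    linarith

lemma six_choose (n : ℕ) : (6 : ℝ) * (n.choose 3 : ℝ) = n * (n - 1) * (n - 2) := by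
  have := Nat.cast_choose_eq_ascPochhammer_div ℝ n 3
  induction n with
  | zero => simp
  | succ m ih =>
    have h2 : (2 : ℝ) * (m.choose 2 : ℝ) = m * (m - 1) := by
      rw [Nat.cast_choose_two]; ring
    rw [Nat.choose_succ_succ' m 2]
    push_cast
    have := ih (Nat.cast_choose_eq_ascPochhammer_div ℝ m 3)
    linarith

open Filter Topology in
lemma realize {k : ℕ} (M : Fin k → Fin k → Bool) (hM : ∀ i j, M i j = M j i)
    (w : Fin k → ℝ) (hw : ∀ i, 0 ≤ w i) (hs : ∑ i, w i = 1) :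
    ∀ ε : ℝ, 0 < ε → ∀ N : ℕ, ∃ n : ℕ, N ≤ n ∧ 3 ≤ n ∧
      ∃ G : SimpleGraph (Fin n),
        |localProfile G 0 - patDensity M false w| ≤ ε ∧
        |localProfile G 3 - patDensity M true w| ≤ ε := by
  intro ε hε N
  let c : ℕ → Fin k → ℕ := fun m i => ⌊w i * m⌋₊
  let n : ℕ → ℕ := fun m => ∑ i, c m i
  let f : (m : ℕ) → Fin (n m) → Fin k := fun m v => (finSigmaFinEquiv.symm v).1
  have hc : ∀ m i, (univ.filter (fun v => f m v = i)).card = c m i := by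
    intro m i
    have : (univ.filter (fun v => f m v = i)) =
        (univ : Finset (Fin (c m i))).image (fun x => finSigmaFinEquiv ⟨i, x⟩) := by
      ext v
      simp only [mem_filter, mem_univ, true_and, mem_image, f]
      constructor
      · intro h
        obtain ⟨⟨j, x⟩, rfl⟩ := finSigmaFinEquiv.surjective v
        simp at h; subst h
        exact ⟨x, rfl⟩
      · rintro ⟨x, rfl⟩; simp
    rw [this, card_image_of_injective]
    · simp
    · intro x y hxy
      simpa using hxy
  let G : (m : ℕ) → SimpleGraph (Fin (n m)) := fun m => blowup M hM (f m)
  have tc : ∀ i, Tendsto (fun m : ℕ => (c m i : ℝ) / m) atTop (𝓝 (w i)) := by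
    intro i
    exact (tendsto_nat_floor_mul_div_atTop (hw i)).comp tendsto_natCast_atTop_atTop
  have tn : Tendsto (fun m : ℕ => (n m : ℝ) / m) atTop (𝓝 1) := by
    rw [← hs]
    have : (fun m : ℕ => (n m : ℝ) / m) = fun m : ℕ => ∑ i, (c m i : ℝ) / m := by
      ext m; simp only [n]; push_cast; rw [Finset.sum_div]
    rw [this]
    exact tendsto_finsetSum _ fun i _ => tc i
  have tinv : Tendsto (fun m : ℕ => (1 : ℝ) / m) atTop (𝓝 0) := tendsto_one_div_atTop_nhds_zero_nat
  have tninf : Tendsto n atTop atTop := by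
    rw [← tendsto_natCast_atTop_iff (R := ℝ)]
    have := tn.pos_mul_atTop one_pos (tendsto_natCast_atTop_atTop (R := ℝ))
    refine this.congr' ?_
    filter_upwards [eventually_gt_atTop 0] with m hm
    field_simp
  have tden : Tendsto (fun m : ℕ => (6 : ℝ) * ((n m).choose 3 : ℝ) / (m : ℝ) ^ 3) atTop (𝓝 1) := by
    have : Tendsto (fun m : ℕ => (n m : ℝ) / m * ((n m : ℝ) / m - 1 / m) *
        ((n m : ℝ) / m - 2 * (1 / m))) atTop (𝓝 (1 * (1 - 0) * (1 - 2 * 0))) :=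
      (tn.mul (tn.sub tinv)).mul (tn.sub (tinv.const_mul 2))
    norm_num at this
    refine this.congr' ?_
    filter_upwards [eventually_gt_atTop 0] with m hm
    rw [six_choose]
    field_simp
  have main : ∀ b, Tendsto (fun m => localProfile (G m) (tgt b)) atTop (𝓝 (patDensity M b w)) := by
    intro b
    have tp : Tendsto (fun m : ℕ => patDensity M b (fun i => (c m i : ℝ)) / (m : ℝ) ^ 3) atTop
        (𝓝 (patDensity M b w)) := by
      have : ∀ m : ℕ, patDensity M b (fun i => (c m i : ℝ)) / (m : ℝ) ^ 3 =
          patDensity M b (fun i => (c m i : ℝ) / m) := by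
        intro m
        unfold patDensity
        simp only [Finset.sum_div]
        refine Finset.sum_congr rfl fun i _ => Finset.sum_congr rfl fun j _ =>
          Finset.sum_congr rfl fun l _ => ?_
        split_ifs
        · ring
        · simp
      simp only [this]
      unfold patDensity
      refine tendsto_finsetSum _ fun i _ => tendsto_finsetSum _ fun j _ =>
        tendsto_finsetSum _ fun l _ => ?_
      split_ifs
      · exact ((tc i).mul (tc j)).mul (tc l)
      · exact tendsto_const_nhds
    let A : ℕ → ℝ := fun m => ((((univ : Finset (Fin (n m))).powersetCard 3).filter
      (fun S => edgesIn (G m) S = tgt b)).card : ℝ)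
    have tnum : Tendsto (fun m : ℕ => 6 * A m / (m : ℝ) ^ 3) atTop (𝓝 (patDensity M b w)) := by
      have hdiff : Tendsto (fun m : ℕ => 6 * A m / (m : ℝ) ^ 3 -
          patDensity M b (fun i => (c m i : ℝ)) / (m : ℝ) ^ 3) atTop (𝓝 0) := by
        have ub : Tendsto (fun m : ℕ => 3 * ((n m : ℝ) / m) ^ 2 * (1 / m)) atTop (𝓝 0) := by
          have := ((tn.pow 2).const_mul 3).mul tinv
          simpa using this
        refine squeeze_zero_norm' ?_ ub
        filter_upwards [eventually_gt_atTop 0] with m hm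
        have hm' : (0 : ℝ) < m := by exact_mod_cast hm
        rw [← sub_div, Real.norm_eq_abs, abs_div, abs_of_pos (by positivity : (0 : ℝ) < (m : ℝ) ^ 3),
          div_le_iff₀ (by positivity)]
        refine (count_bound M hM b (f m) (c m) (hc m)).trans (le_of_eq ?_)
        field_simp
      simpa using hdiff.add tp
    have := tnum.div tden one_ne_zero
    rw [div_one] at this
    refine this.congr' ?_
    filter_upwards [eventually_gt_atTop 0] with m hm
    have hm' : (0 : ℝ) < m := by exact_mod_cast hm
    simp only [Pi.div_apply, localProfile, A, card_powersetCard, card_univ, Fintype.card_fin]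
    rw [div_div_div_cancel_right₀ (by positivity), mul_div_mul_left _ _ (by norm_num)]
  have m0 := main false
  have m3 := main true
  simp only [tgt] at m0 m3
  have e0 := Metric.tendsto_nhds.1 m0 ε hε
  have e3 := Metric.tendsto_nhds.1 m3 ε hε
  obtain ⟨m, h0, h3, hN⟩ := (e0.and (e3.and (tninf.eventually_ge_atTop (max N 3)))).exists
  rw [Real.dist_eq] at h0 h3
  exact ⟨n m, le_trans (le_max_left _ _) hN, le_trans (le_max_right _ _) hN, G m,
    by simpa using h0.le, by simpa using h3.le⟩

/-- The pattern: two cliques, two independent sets joined to each other and each to its clique,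
and an isolated part. -/
def pat (i j : Fin 5) : Bool :=
  match i.val, j.val with
  | 0, 0 => true
  | 1, 1 => true
  | 0, 2 => true
  | 2, 0 => true
  | 1, 3 => true
  | 3, 1 => true
  | 2, 3 => true
  | 3, 2 => true
  | _, _ => false

lemma pat_symm : ∀ i j, pat i j = pat j i := by decide

lemma pat_true (y₁ y₂ x z : ℝ) : patDensity pat true ![y₁, y₂, x, x, z] = triPoly y₁ y₂ x := by
  simp [patDensity, Fin.sum_univ_five, pat, triPoly]
  ring

lemma pat_false (y₁ y₂ x z : ℝ) : patDensity pat false ![y₁, y₂, x, x, z] = indPoly y₁ y₂ x z := by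
  simp [patDensity, Fin.sum_univ_five, pat, indPoly]
  ring

lemma patDensity_not {k : ℕ} (M : Fin k → Fin k → Bool) (b : Bool) (w : Fin k → ℝ) :
    patDensity (fun i j => !(M i j)) b w = patDensity M (!b) w := by
  unfold patDensity
  cases b <;> simp

lemma weights_realize {p₀ p₃ : ℝ} (h : Weights p₀ p₃) :
    ∃ w : Fin 5 → ℝ, (∀ i, 0 ≤ w i) ∧ ∑ i, w i = 1 ∧ patDensity pat true w = p₀ ∧
      patDensity pat false w = p₃ := by
  obtain ⟨y₁, y₂, x, z, h1, h2, h3, h4, hs, ht, hi⟩ := h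
  refine ⟨![y₁, y₂, x, x, z], ?_, ?_, ?_, ?_⟩
  · intro i; fin_cases i <;> simpa
  · simp [Fin.sum_univ_five]; linarith
  · rw [pat_true, ht]
  · rw [pat_false, hi]

/-- If `p₀ + p₃ ≥ 1/4` and `p₃ ≤ max{(1-p₀^{1/3})³ + 3 p₀^{1/3}(1-p₀^{1/3})², (1-β)³}`,
where `β` is the unique root in `[0,1]` of `β³ + 3β²(1-β) = p₀`, then for every `ε > 0`
and every `N` there is a graph on at least `N` vertices whose 3-local profile satisfies
`|p₀(G) - p₀| ≤ ε` and `|p₃(G) - p₃| ≤ ε`. -/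
theorem delta_K3_realizability (p₀ p₃ : ℝ)
    (hp₀ : p₀ ∈ Set.Icc (0 : ℝ) 1) (hp₃ : p₃ ∈ Set.Icc (0 : ℝ) 1)
    (β : ℝ) (hβ : β ∈ Set.Icc (0 : ℝ) 1) (hβeq : β ^ 3 + 3 * β ^ 2 * (1 - β) = p₀)
    (h1 : p₀ + p₃ ≥ 1 / 4)
    (h2 : p₃ ≤ max ((1 - p₀ ^ ((1 : ℝ) / 3)) ^ 3 +
                      3 * p₀ ^ ((1 : ℝ) / 3) * (1 - p₀ ^ ((1 : ℝ) / 3)) ^ 2)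
                   ((1 - β) ^ 3)) :
    ∀ ε : ℝ, 0 < ε → ∀ N : ℕ, ∃ n : ℕ, N ≤ n ∧ 3 ≤ n ∧
      ∃ G : SimpleGraph (Fin n),
        |localProfile G 0 - p₀| ≤ ε ∧ |localProfile G 3 - p₃| ≤ ε := by
  rcases le_max_iff.1 h2 with h | h
  · have ha := Real.rpow_nonneg hp₀.1 ((1 : ℝ) / 3)
    have ha1 := Real.rpow_le_one hp₀.1 hp₀.2 (by norm_num : (0 : ℝ) ≤ 1 / 3)
    have ha3 := cubeRoot_pow hp₀.1
    have hW := core ha ha1 hp₃.1 (by rw [ha3]; exact h1) h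
    rw [ha3] at hW
    obtain ⟨w, hw, hs, ht, hi⟩ := weights_realize hW
    have := realize (fun i j => !(pat i j)) (fun i j => by rw [pat_symm]) w hw hs
    rw [patDensity_not, patDensity_not, Bool.not_false, Bool.not_true, ht, hi] at this
    exact this
  · have ha := Real.rpow_nonneg hp₃.1 ((1 : ℝ) / 3)
    have ha1 := Real.rpow_le_one hp₃.1 hp₃.2 (by norm_num : (0 : ℝ) ≤ 1 / 3)
    have ha3 := cubeRoot_pow hp₃.1
    have hb : p₃ ^ ((1 : ℝ) / 3) ≤ 1 - β :=
      le_of_pow_le_pow_left₀ (n := 3) (by norm_num) (by linarith [hβ.2]) (by rw [ha3]; exact h)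
    have hW : Weights ((p₃ ^ ((1 : ℝ) / 3)) ^ 3) p₀ := by
      refine core ha ha1 hp₀.1 (by rw [ha3]; linarith) ?_
      rw [← hβeq]
      obtain ⟨hβ0, hβ1⟩ := hβ
      generalize p₃ ^ ((1 : ℝ) / 3) = b at *
      have e : (1 - b) ^ 3 + 3 * b * (1 - b) ^ 2 - (β ^ 3 + 3 * β ^ 2 * (1 - β)) =
        (1 - b - β) * ((1 - b) * b + β * (1 - β) + ((1 - b) + β) * (b + (1 - β))) := by ring
      have : 0 ≤ (1 - b) ^ 3 + 3 * b * (1 - b) ^ 2 - (β ^ 3 + 3 * β ^ 2 * (1 - β)) := by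
        rw [e]
        have i1 : 0 ≤ 1 - b - β := by linarith
        have i2 : 0 ≤ 1 - b := by linarith
        have i3 : 0 ≤ 1 - β := by linarith
        positivity
      linarith
    rw [ha3] at hW
    obtain ⟨w, hw, hs, ht, hi⟩ := weights_realize hW
    have := realize pat pat_symm w hw hs
    rw [ht, hi] at this
    exact this
end
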